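/- Explicit solution of the elliptic multiplicative Horn problem in PU(2,1): Define the closed polytopes (all intersected with 𝒯³): P₄π^cl = {H₂₂₂ ≤ −4π} ∪ ({S ≤ 4π} ∩ {H₁₂₂ ≤ 2π} ∩ {H₂₁₂ ≤ 2π} ∩ {H₂₂₁ ≤ 2π} ∩ {H₁₁₁ ≥ 2π}); P₆π^cl = {H₂₂₂ ≤ 0} ∩ {H₁₁₁ ≥ 6π}; P₈π^cl = {H₁₁₁ ≥ 10π} ∪ ({S ≥ 8π} ∩ {H₂₁₁ ≥ 4π} ∩ {H₁₂₁ ≥ 4π} ∩ {H₁₁₂ ≥ 4π} ∩ {H₂₂₂ ≤ 4π}). Then 𝒫 ∩ (𝒯°)³ = (P₄π^cl ∪ P₆π^cl ∪ P₈π^cl) ∩ (𝒯°)³. -/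

import Mathlib

open Real Matrix Set

noncomputable section

abbrev Pt : Type := ℝ × ℝ
abbrev Tri : Type := Pt × Pt × Pt

/-- Membership in `𝒯 = {(a₁,a₂) ∈ [0,2π)² : a₁ ≥ a₂}`. -/
def memT (p : Pt) : Prop :=
  0 ≤ p.1 ∧ p.1 < 2 * π ∧ 0 ≤ p.2 ∧ p.2 < 2 * π ∧ p.2 ≤ p.1

def memT3 (τ : Tri) : Prop := memT τ.1 ∧ memT τ.2.1 ∧ memT τ.2.2

/-- Membership in the interior `𝒯° = {(a₁,a₂) : 0 < a₂ < a₁ < 2π}`. -/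
def memTo (p : Pt) : Prop := 0 < p.2 ∧ p.2 < p.1 ∧ p.1 < 2 * π

def memTo3 (τ : Tri) : Prop := memTo τ.1 ∧ memTo τ.2.1 ∧ memTo τ.2.2

/-- The sum `S(τ) = α₁+α₂+β₁+β₂+γ₁+γ₂`. -/
def Sf (τ : Tri) : ℝ := τ.1.1 + τ.1.2 + τ.2.1.1 + τ.2.1.2 + τ.2.2.1 + τ.2.2.2

/-- The coordinate of a pair: index `0` is the first coordinate (subscript 1),
index `1` the second (subscript 2). -/
def coord (p : Pt) (i : Fin 2) : ℝ := if i = 0 then p.1 else p.2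

/-- `sg τ i j k = σ_{(i+1)(j+1)(k+1)}(τ) = α_i + β_j + γ_k` (indices in `Fin 2`,
index `0` ↔ subscript 1, index `1` ↔ subscript 2). -/
def sg (τ : Tri) (i j k : Fin 2) : ℝ := coord τ.1 i + coord τ.2.1 j + coord τ.2.2 k

/-- `Hf τ i j k = 2 σ_{ijk}(τ) − σ_{ī j̄ k̄}(τ)`, the complementary index being `i+1` in `Fin 2`. -/
def Hf (τ : Tri) (i j k : Fin 2) : ℝ := 2 * sg τ i j k - sg τ (i + 1) (j + 1) (k + 1)

abbrev M3 : Type := Matrix (Fin 3) (Fin 3) ℂ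

/-- The form J = diag(1, 1, −1). -/
def J3 : M3 := Matrix.diagonal ![1, 1, -1]

/-- Membership in U(2,1). -/
def memU21 (M : M3) : Prop := Mᴴ * J3 * M = J3

/-- The diagonal matrix E(a₁,a₂) = diag(e^{ia₁}, e^{ia₂}, 1). -/
def Emat (a₁ a₂ : ℝ) : M3 :=
  Matrix.diagonal ![Complex.exp (a₁ * Complex.I), Complex.exp (a₂ * Complex.I), 1]

/-- `M` is of elliptic type `(a₁,a₂)`: conjugate in U(2,1) to E(a₁,a₂). -/
def ellType (M : M3) (a₁ a₂ : ℝ) : Prop :=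
  ∃ P : M3, memU21 P ∧ M = P * Emat a₁ a₂ * P⁻¹

/-- The closed polytope P₄π^cl. -/
def P4cl : Set Tri := {τ | memT3 τ ∧ (Hf τ 1 1 1 ≤ -(4 * π) ∨
  (Sf τ ≤ 4 * π ∧ Hf τ 0 1 1 ≤ 2 * π ∧ Hf τ 1 0 1 ≤ 2 * π ∧ Hf τ 1 1 0 ≤ 2 * π ∧
    2 * π ≤ Hf τ 0 0 0))}

/-- The closed polytope P₆π^cl. -/
def P6cl : Set Tri := {τ | memT3 τ ∧ Hf τ 1 1 1 ≤ 0 ∧ 6 * π ≤ Hf τ 0 0 0}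

/-- The closed polytope P₈π^cl. -/
def P8cl : Set Tri := {τ | memT3 τ ∧ (10 * π ≤ Hf τ 0 0 0 ∨
  (8 * π ≤ Sf τ ∧ 4 * π ≤ Hf τ 1 0 0 ∧ 4 * π ≤ Hf τ 0 1 0 ∧ 4 * π ≤ Hf τ 0 0 1 ∧
    Hf τ 1 1 1 ≤ 4 * π))}

/-- The elliptic Horn solution set 𝒫 in PU(2,1). -/
def HornSol : Set Tri := {τ | memT3 τ ∧ ∃ A B C : M3,
  memU21 A ∧ memU21 B ∧ memU21 C ∧
  ellType A τ.1.1 τ.1.2 ∧ ellType B τ.2.1.1 τ.2.1.2 ∧ ellType C τ.2.2.1 τ.2.2.2 ∧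
  ∃ lam : ℂ, A * B * C = lam • (1 : M3)}

lemma J3_sq : J3 * J3 = 1 := by
  unfold J3
  rw [diagonal_mul_diagonal, ← diagonal_one]
  congr 1
  funext i
  fin_cases i <;> simp

lemma J3_star : J3ᴴ = J3 := by
  unfold J3
  rw [diagonal_conjTranspose]
  congr 1
  funext i
  fin_cases i <;> simp

lemma memU21_left {M : M3} (h : memU21 M) : (J3 * Mᴴ * J3) * M = 1 := by
  have h1 : Mᴴ * J3 * M = J3 := h
  calc (J3 * Mᴴ * J3) * M = J3 * (Mᴴ * J3 * M) := by simp only [Matrix.mul_assoc]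
    _ = 1 := by rw [h1, J3_sq]

lemma memU21_right {M : M3} (h : memU21 M) : M * (J3 * Mᴴ * J3) = 1 :=
  mul_eq_one_comm.mp (memU21_left h)

lemma memU21_inv {M : M3} (h : memU21 M) : M⁻¹ = J3 * Mᴴ * J3 :=
  inv_eq_left_inv (memU21_left h)

lemma memU21_mul {M N : M3} (h : memU21 M) (k : memU21 N) : memU21 (M * N) := by
  have h1 : Mᴴ * J3 * M = J3 := h
  have k1 : Nᴴ * J3 * N = J3 := k
  show (M * N)ᴴ * J3 * (M * N) = J3
  rw [conjTranspose_mul]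
  calc Nᴴ * Mᴴ * J3 * (M * N) = Nᴴ * (Mᴴ * J3 * M) * N := by simp only [Matrix.mul_assoc]
    _ = J3 := by rw [h1, k1]

lemma memU21_inv' {M : M3} (h : memU21 M) : memU21 (M⁻¹) := by
  have h2 := memU21_right h
  show (M⁻¹)ᴴ * J3 * M⁻¹ = J3
  rw [memU21_inv h]
  simp only [conjTranspose_mul, conjTranspose_conjTranspose, J3_star]
  calc J3 * (M * J3) * J3 * (J3 * Mᴴ * J3) = J3 * (M * J3) * (J3 * J3) * (Mᴴ * J3) := by
        simp only [Matrix.mul_assoc]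
    _ = J3 * (M * (J3 * Mᴴ * J3)) := by rw [J3_sq]; simp only [Matrix.mul_assoc, Matrix.one_mul]
    _ = J3 := by rw [h2, Matrix.mul_one]

lemma memU21_diag {d : Fin 3 → ℂ} (h : ∀ i, star (d i) * d i = 1) :
    memU21 (Matrix.diagonal d) := by
  show (Matrix.diagonal d)ᴴ * J3 * Matrix.diagonal d = J3
  unfold J3
  rw [diagonal_conjTranspose, diagonal_mul_diagonal, diagonal_mul_diagonal]
  congr 1
  funext i
  have := h i
  simp only [Pi.star_apply]
  rw [mul_right_comm, this, one_mul]

/-- `e^{ix}`. -/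
def ex (x : ℝ) : ℂ := Complex.exp (x * Complex.I)

lemma ex_add (x y : ℝ) : ex (x + y) = ex x * ex y := by
  unfold ex; rw [← Complex.exp_add]; push_cast; ring_nf

lemma ex_zero : ex 0 = 1 := by simp [ex]

lemma ex_ne (x : ℝ) : ex x ≠ 0 := Complex.exp_ne_zero _

lemma ex_neg (x : ℝ) : ex (-x) = (ex x)⁻¹ := by
  unfold ex; rw [← Complex.exp_neg]; push_cast; ring_nf

lemma ex_star (x : ℝ) : star (ex x) = ex (-x) := by
  unfold ex
  rw [show (star (Complex.exp (x * Complex.I)) : ℂ)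
    = (starRingEnd ℂ) (Complex.exp (x * Complex.I)) from rfl, ← Complex.exp_conj]
  simp

lemma ex_conj (x : ℝ) : (starRingEnd ℂ) (ex x) = ex (-x) := ex_star x

lemma ex_star_mul (x : ℝ) : star (ex x) * ex x = 1 := by
  rw [ex_star, ← ex_add]; simp [ex_zero]

lemma ex_re (x : ℝ) : (ex x).re = Real.cos x := by
  unfold ex; exact Complex.exp_ofReal_mul_I_re x

lemma ex_im (x : ℝ) : (ex x).im = Real.sin x := by
  unfold ex; exact Complex.exp_ofReal_mul_I_im x

lemma ex_eq (x : ℝ) : ex x = (Real.cos x : ℂ) + (Real.sin x : ℂ) * Complex.I := by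
  unfold ex; rw [Complex.exp_mul_I]; push_cast; rfl

lemma Emat_ex (a b : ℝ) : Emat a b = Matrix.diagonal ![ex a, ex b, 1] := rfl

lemma memU21_Emat (a b : ℝ) : memU21 (Emat a b) := by
  rw [Emat_ex]
  apply memU21_diag
  intro i
  fin_cases i
  · exact ex_star_mul a
  · exact ex_star_mul b
  · simp

lemma memU21_of_ell {M : M3} {a b : ℝ} (h : ellType M a b) : memU21 M := by
  obtain ⟨P, hP, rfl⟩ := h
  exact memU21_mul (memU21_mul hP (memU21_Emat a b)) (memU21_inv' hP)

/-- The hermitian form. -/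
def hf (v w : Fin 3 → ℂ) : ℂ := star v ⬝ᵥ (J3 *ᵥ w)

lemma hf_expl (v w : Fin 3 → ℂ) :
    hf v w = star (v 0) * w 0 + star (v 1) * w 1 - star (v 2) * w 2 := by
  unfold hf J3
  simp only [mulVec_diagonal, dotProduct, Fin.sum_univ_three, Pi.star_apply]
  simp
  ring

lemma hf_add_right (v w w' : Fin 3 → ℂ) : hf v (w + w') = hf v w + hf v w' := by
  simp only [hf_expl, Pi.add_apply]; ring
lemma hf_smul_right (c : ℂ) (v w : Fin 3 → ℂ) : hf v (c • w) = c * hf v w := by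
  simp only [hf_expl, Pi.smul_apply, smul_eq_mul]; ring
lemma hf_smul_left (c : ℂ) (v w : Fin 3 → ℂ) : hf (c • v) w = star c * hf v w := by
  simp only [hf_expl, Pi.smul_apply, smul_eq_mul, star_mul']; ring
lemma hf_star (v w : Fin 3 → ℂ) : star (hf v w) = hf w v := by
  simp only [hf_expl, star_sub, star_add, star_mul', star_star]; ring

lemma hf_adj (M : M3) (v w : Fin 3 → ℂ) : hf (M *ᵥ v) w = hf v ((J3 * Mᴴ * J3) *ᵥ w) := by
  unfold hf
  rw [star_mulVec, mulVec_mulVec, ← dotProduct_mulVec, mulVec_mulVec]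
  rw [show J3 * (J3 * Mᴴ * J3) = (J3 * J3) * Mᴴ * J3 by simp only [Matrix.mul_assoc], J3_sq,
    Matrix.one_mul]

lemma hf_U {M : M3} (h : memU21 M) (v w : Fin 3 → ℂ) : hf (M *ᵥ v) (M *ᵥ w) = hf v w := by
  rw [hf_adj, mulVec_mulVec, memU21_left h, one_mulVec]

/-- Orthogonal to a negative vector implies positive. -/
lemma hf_pos_of_orth {v w : Fin 3 → ℂ} (hv : (hf v v).re < 0) (h : hf v w = 0) (hw : w ≠ 0) :
    0 < (hf w w).re := by
  have e1 : ∀ u : Fin 3 → ℂ, (hf u u).re = ‖u 0‖^2 + ‖u 1‖^2 - ‖u 2‖^2 := by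
    intro u
    rw [hf_expl]
    have : ∀ z : ℂ, (star z * z) = ((‖z‖^2 : ℝ) : ℂ) := by
      intro z
      have := Complex.conj_mul' z
      simpa using this
    rw [this, this, this]
    norm_cast
  rw [e1] at hv ⊢
  have h2 : star (v 2) * w 2 = star (v 0) * w 0 + star (v 1) * w 1 := by
    rw [hf_expl] at h; linear_combination -h
  have h3 : ‖v 2‖ * ‖w 2‖ ≤ ‖v 0‖ * ‖w 0‖ + ‖v 1‖ * ‖w 1‖ := by
    have := norm_add_le (star (v 0) * w 0) (star (v 1) * w 1)
    rw [← h2] at this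
    simpa [norm_mul] using this
  have p0 := norm_nonneg (v 0)
  have p1 := norm_nonneg (v 1)
  have p2 := norm_nonneg (v 2)
  have q0 := norm_nonneg (w 0)
  have q1 := norm_nonneg (w 1)
  have q2 := norm_nonneg (w 2)
  have h4 : ‖v 2‖^2 * ‖w 2‖^2 ≤ (‖v 0‖^2 + ‖v 1‖^2) * (‖w 0‖^2 + ‖w 1‖^2) := by
    have : (‖v 2‖ * ‖w 2‖)^2 ≤ (‖v 0‖ * ‖w 0‖ + ‖v 1‖ * ‖w 1‖)^2 := by
      apply pow_le_pow_left₀ (by positivity) h3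
    nlinarith [sq_nonneg (‖v 0‖ * ‖w 1‖ - ‖v 1‖ * ‖w 0‖)]
  by_contra hcon
  push Not at hcon
  have v2pos : 0 < ‖v 2‖^2 := by nlinarith [sq_nonneg ‖v 0‖, sq_nonneg ‖v 1‖]
  have z : ‖w 0‖^2 + ‖w 1‖^2 = 0 := by
    by_contra hne
    have hp : 0 < ‖w 0‖^2 + ‖w 1‖^2 := lt_of_le_of_ne (by positivity) (Ne.symm hne)
    nlinarith
  have z0 : ‖w 0‖ = 0 := by
    have : ‖w 0‖^2 = 0 := by nlinarith [sq_nonneg ‖w 0‖, sq_nonneg ‖w 1‖]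
    simpa using this
  have z1 : ‖w 1‖ = 0 := by
    have : ‖w 1‖^2 = 0 := by nlinarith [sq_nonneg ‖w 0‖, sq_nonneg ‖w 1‖]
    simpa using this
  have z2 : ‖w 2‖ = 0 := by
    rw [z, mul_zero] at h4
    have : ‖w 2‖^2 ≤ 0 := by
      by_contra hh
      push Not at hh
      nlinarith [mul_pos v2pos hh]
    nlinarith
  apply hw
  funext i
  fin_cases i
  · simpa using z0
  · simpa using z1
  · simpa using z2

lemma adj_CH (M : M3) :
    adjugate M = M * M - M.trace • M + (adjugate M).trace • (1 : M3) := by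
  rw [adjugate_fin_three]
  ext i j
  fin_cases i <;> fin_cases j <;>
    simp [Matrix.mul_apply, Fin.sum_univ_three, Matrix.trace, Matrix.diag] <;> ring

lemma det_charpoly (M : M3) (z : ℂ) :
    det (z • (1 : M3) - M)
      = z ^ 3 - M.trace * z ^ 2 + (adjugate M).trace * z - det M := by
  rw [adjugate_fin_three, det_fin_three, det_fin_three]
  simp [Fin.sum_univ_three, Matrix.trace, Matrix.diag]
  ring

lemma trace_JstarJ (M : M3) : (J3 * Mᴴ * J3).trace = star M.trace := by
  rw [Matrix.trace_mul_comm, ← Matrix.mul_assoc, J3_sq, Matrix.one_mul, trace_conjTranspose]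

lemma adj_U {M : M3} (h : memU21 M) : adjugate M = M.det • (J3 * Mᴴ * J3) := by
  have h1 := memU21_right h
  calc adjugate M = adjugate M * (M * (J3 * Mᴴ * J3)) := by rw [h1, Matrix.mul_one]
    _ = M.det • (J3 * Mᴴ * J3) := by
      rw [← Matrix.mul_assoc, adjugate_mul, smul_mul, Matrix.one_mul]

lemma CH_U {M : M3} (h : memU21 M) :
    M * M - M.trace • M + (M.det * star M.trace) • (1 : M3) = M.det • (J3 * Mᴴ * J3) := by
  have h1 := adj_CH M
  rw [adj_U h, trace_smul, trace_JstarJ, smul_eq_mul] at h1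
  exact h1.symm

/-- The test-vector computation: a vector `v` in the `m₃` eigenspace with the sign of `hf v v`. -/
lemma eig_vec {M : M3} (h : memU21 M) {m1 m2 m3 : ℂ}
    (h1 : star m1 * m1 = 1) (h2 : star m2 * m2 = 1) (h3 : star m3 * m3 = 1)
    (ht : M.trace = m1 + m2 + m3) (hd : M.det = m1 * m2 * m3) (w : Fin 3 → ℂ) :
    ∃ v : Fin 3 → ℂ, M *ᵥ v = m3 • v ∧
      hf v v = star (m1 * m2) * (m3 - (m1 + m2) + m1 * m2 * star m3) *
        (hf w (M *ᵥ w) - (m1 + m2) * hf w w + m1 * m2 * star (hf w (M *ᵥ w))) := by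
  set N : M3 := J3 * Mᴴ * J3 with hN
  have hMN : M * N = 1 := memU21_right h
  have hNM : N * M = 1 := memU21_left h
  set q : M3 := M - (m1 + m2) • (1 : M3) + (m1 * m2) • N with hq
  have hMq : M * q = m3 • q := by
    have e := CH_U h
    rw [ht, hd, ← hN] at e
    have e2 : (m1 * m2 * m3) * star (m1 + m2 + m3) = m1 * m2 + m1 * m3 + m2 * m3 := by
      simp only [star_add]
      linear_combination (m2 * m3) * h1 + (m1 * m3) * h2 + (m1 * m2) * h3
    rw [e2] at e
    have e3 : M * q = M * M - (m1 + m2) • M + (m1 * m2) • (1 : M3) := by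
      rw [hq, Matrix.mul_add, Matrix.mul_sub, Matrix.mul_smul, Matrix.mul_smul, hMN, Matrix.mul_one]
    rw [e3, hq]
    have e4 : M * M = (m1 * m2 * m3) • N + (m1 + m2 + m3) • M
        - (m1 * m2 + m1 * m3 + m2 * m3) • (1 : M3) := by
      rw [← e]; abel
    rw [e4]
    module
  have hNq : N * q = star m3 • q := by
    have e : N * (M * q) = m3 • (N * q) := by rw [hMq, Matrix.mul_smul]
    rw [← Matrix.mul_assoc, hNM, Matrix.one_mul] at e
    conv_rhs => rw [e, smul_smul, h3, one_smul]
  have hqq : q * q = (m3 - (m1 + m2) + m1 * m2 * star m3) • q := by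
    conv_lhs => rw [hq, Matrix.add_mul, Matrix.sub_mul, Matrix.smul_mul, Matrix.smul_mul,
      Matrix.one_mul]
    rw [← hq, hMq, hNq]
    module
  have hqs : J3 * qᴴ * J3 = star (m1 * m2) • q := by
    have n1 : J3 * Nᴴ * J3 = M := by
      rw [hN]
      simp only [conjTranspose_mul, conjTranspose_conjTranspose, J3_star]
      calc J3 * (J3 * (M * J3)) * J3 = (J3 * J3) * M * (J3 * J3) := by
            simp only [Matrix.mul_assoc]
        _ = M := by rw [J3_sq, Matrix.one_mul, Matrix.mul_one]
    have e : J3 * qᴴ * J3 = N - star (m1 + m2) • (1 : M3) + star (m1 * m2) • M := by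
      rw [hq]
      simp only [conjTranspose_add, conjTranspose_sub, conjTranspose_smul, conjTranspose_one,
        Matrix.mul_add, Matrix.mul_sub, Matrix.add_mul, Matrix.sub_mul, Matrix.mul_smul,
        Matrix.smul_mul, Matrix.mul_one, J3_sq, n1]
      rw [← hN]
    rw [e, hq]
    have c1 : star (m1 * m2) * (m1 + m2) = star (m1 + m2) := by
      simp only [star_mul', star_add]
      linear_combination (star m2) * h1 + (star m1) * h2
    have c2 : star (m1 * m2) * (m1 * m2) = 1 := by
      simp only [star_mul']
      linear_combination (star m2 * m2) * h1 + h2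
    rw [smul_add, smul_sub, smul_smul, smul_smul, c1, c2, one_smul]
    abel
  refine ⟨q *ᵥ w, ?_, ?_⟩
  · rw [mulVec_mulVec, hMq, smul_mulVec]
  · rw [hf_adj, hqs, mulVec_mulVec, smul_mul, hqq, smul_smul, smul_mulVec, hf_smul_right]
    congr 1
    have e : q *ᵥ w = M *ᵥ w + (-(m1 + m2)) • w + (m1 * m2) • (N *ᵥ w) := by
      rw [hq, Matrix.add_mulVec, Matrix.sub_mulVec, smul_mulVec, smul_mulVec, one_mulVec, neg_smul,
        sub_eq_add_neg]
    rw [e, hf_add_right, hf_add_right, hf_smul_right, hf_smul_right]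
    have : hf w (N *ᵥ w) = star (hf w (M *ᵥ w)) := by
      rw [hf_star, hf_adj]
    rw [this]
    ring

lemma exists_eig {M : M3} (h : memU21 M) {m1 m2 m3 : ℂ}
    (h1 : star m1 * m1 = 1) (h2 : star m2 * m2 = 1) (h3 : star m3 * m3 = 1)
    (ht : M.trace = m1 + m2 + m3) (hd : M.det = m1 * m2 * m3) :
    ∃ v : Fin 3 → ℂ, v ≠ 0 ∧ M *ᵥ v = m1 • v := by
  have hdet : det (m1 • (1 : M3) - M) = 0 := by
    rw [det_charpoly, adj_U h, trace_smul, trace_JstarJ, ht, hd, smul_eq_mul]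
    simp only [star_add]
    linear_combination (m1 * m2 * m3) * h1 + (m1 * m1 * m3) * h2 + (m1 * m1 * m2) * h3
  obtain ⟨v, hv, hv2⟩ := exists_mulVec_eq_zero_iff.mpr hdet
  refine ⟨v, hv, ?_⟩
  rw [Matrix.sub_mulVec, smul_mulVec, one_mulVec, sub_eq_zero] at hv2
  exact hv2.symm

lemma hf_orth {M : M3} (h : memU21 M) {m m' : ℂ} (h1 : star m * m = 1) (hne : m ≠ m')
    {v v' : Fin 3 → ℂ} (hv : M *ᵥ v = m • v) (hv' : M *ᵥ v' = m' • v') : hf v v' = 0 := by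
  have e := hf_U h v v'
  rw [hv, hv', hf_smul_left, hf_smul_right] at e
  have e2 : (star m * m' - 1) * hf v v' = 0 := by linear_combination e
  rcases mul_eq_zero.mp e2 with h3 | h3
  · exfalso; apply hne
    linear_combination m' * h1 - m * h3
  · exact h3

lemma hf_real (v : Fin 3 → ℂ) : hf v v = ((hf v v).re : ℂ) := by
  have := hf_star v v
  exact (Complex.conj_eq_iff_re.mp this).symm

lemma normalizeV {v : Fin 3 → ℂ} {e : ℝ} (he : e = 1 ∨ e = -1) (hv : 0 < e * (hf v v).re) :
    ∃ c : ℂ, hf (c • v) (c • v) = (e : ℂ) := by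
  refine ⟨((Real.sqrt (e * (hf v v).re))⁻¹ : ℝ), ?_⟩
  rw [hf_smul_left, hf_smul_right]
  have hr := hf_real v
  have hs : (Real.sqrt (e * (hf v v).re))^2 = e * (hf v v).re := Real.sq_sqrt hv.le
  have hs0 : Real.sqrt (e * (hf v v).re) ≠ 0 := (Real.sqrt_pos.mpr hv).ne'
  set s := Real.sqrt (e * (hf v v).re)
  generalize hf v v = z at *
  rw [hr]
  have : star ((s⁻¹ : ℝ) : ℂ) = ((s⁻¹ : ℝ) : ℂ) := Complex.conj_ofReal _
  rw [this]
  norm_cast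
  field_simp
  have he2 : e * e = 1 := by rcases he with h | h <;> rw [h] <;> norm_num
  rw [hs]
  linear_combination -z.re * he2

/-- Diagonalization of `M`. -/
lemma diagonalize {M : M3} (h : memU21 M) {m1 m2 m3 : ℂ}
    (h1 : star m1 * m1 = 1) (h2 : star m2 * m2 = 1) (h3 : star m3 * m3 = 1)
    (h12 : m1 ≠ m2) (h13 : m1 ≠ m3) (h23 : m2 ≠ m3)
    (ht : M.trace = m1 + m2 + m3) (hd : M.det = m1 * m2 * m3)
    (hneg : ∃ v : Fin 3 → ℂ, M *ᵥ v = m3 • v ∧ (hf v v).re < 0) :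
    ∃ P : M3, memU21 P ∧ M * P = P * Matrix.diagonal ![m1, m2, m3] := by
  obtain ⟨v3, hv3, hn3⟩ := hneg
  obtain ⟨v1, hz1, hv1⟩ := exists_eig h h1 h2 h3 ht hd
  obtain ⟨v2, hz2, hv2⟩ := exists_eig h h2 h1 h3 (by rw [ht]; ring) (by rw [hd]; ring)
  have p1 := hf_pos_of_orth hn3 (hf_orth h h3 h13.symm hv3 hv1) hz1
  have p2 := hf_pos_of_orth hn3 (hf_orth h h3 h23.symm hv3 hv2) hz2
  obtain ⟨c1, hc1⟩ := normalizeV (v := v1) (e := 1) (Or.inl rfl) (by linarith)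
  obtain ⟨c2, hc2⟩ := normalizeV (v := v2) (e := 1) (Or.inl rfl) (by linarith)
  obtain ⟨c3, hc3⟩ := normalizeV (v := v3) (e := -1) (Or.inr rfl) (by linarith)
  have key : ∀ (c : ℂ) (m : ℂ) (v : Fin 3 → ℂ), M *ᵥ v = m • v →
      M *ᵥ (c • v) = m • (c • v) := by
    intro c m v hv
    rw [mulVec_smul, hv, smul_comm]
  have k1 := key c1 m1 v1 hv1
  have k2 := key c2 m2 v2 hv2
  have k3 := key c3 m3 v3 hv3
  generalize c1 • v1 = x1 at *
  generalize c2 • v2 = x2 at *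
  generalize c3 • v3 = x3 at *
  have o12 := hf_orth h h1 h12 k1 k2
  have o13 := hf_orth h h1 h13 k1 k3
  have o23 := hf_orth h h2 h23 k2 k3
  have o21 := hf_orth h h2 h12.symm k2 k1
  have o31 := hf_orth h h3 h13.symm k3 k1
  have o32 := hf_orth h h3 h23.symm k3 k2
  rw [hf_expl] at o12 o13 o23 o21 o31 o32 hc1 hc2 hc3
  refine ⟨Matrix.of (fun i j => ![x1 i, x2 i, x3 i] j), ?_, ?_⟩
  · show _ * J3 * _ = J3
    ext i j
    unfold J3
    simp only [Matrix.mul_apply, Fin.sum_univ_three, conjTranspose_apply, Matrix.of_apply]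
    fin_cases i <;> fin_cases j <;> simp [Matrix.diagonal] at * <;>
      first | linear_combination hc1 | linear_combination hc2 | linear_combination hc3
            | linear_combination o12 | linear_combination o13 | linear_combination o23
            | linear_combination o21 | linear_combination o31 | linear_combination o32
  · ext i j
    have a1 := congrFun k1 i
    have a2 := congrFun k2 i
    have a3 := congrFun k3 i
    simp only [mulVec, dotProduct, Fin.sum_univ_three, Pi.smul_apply, smul_eq_mul] at a1 a2 a3
    rw [Matrix.mul_diagonal, Matrix.mul_apply, Fin.sum_univ_three]
    fin_cases j
    · simp; linear_combination a1
    · simp; linear_combination a2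
    · simp; linear_combination a3

lemma ex_ne_of {x y : ℝ} (h : 0 < x - y) (h' : x - y < 2 * π) : ex x ≠ ex y := by
  intro e
  have e1 : ex (x - y) = 1 := by
    rw [sub_eq_add_neg, ex_add, ex_neg, e, mul_inv_cancel₀ (ex_ne y)]
  have e2 := congrArg Complex.re e1
  rw [ex_re, Complex.one_re] at e2
  have := (Real.cos_eq_one_iff_of_lt_of_lt (by linarith) h').mp e2
  linarith

lemma ex_add_neg (x : ℝ) : ex x + ex (-x) = ((2 * Real.cos x : ℝ) : ℂ) := by
  rw [ex_eq, ex_eq, Real.cos_neg, Real.sin_neg]; push_cast; ring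

/-- The existential part of membership in the Horn solution set. -/
def Hs (τ : Tri) : Prop := ∃ A B C : M3,
  memU21 A ∧ memU21 B ∧ memU21 C ∧
  ellType A τ.1.1 τ.1.2 ∧ ellType B τ.2.1.1 τ.2.1.2 ∧ ellType C τ.2.2.1 τ.2.2.2 ∧
  ∃ lam : ℂ, A * B * C = lam • (1 : M3)

lemma memU21_one : memU21 (1 : M3) := by
  show (1 : M3)ᴴ * J3 * 1 = J3
  simp

lemma memU21_isUnit {P : M3} (h : memU21 P) : IsUnit P.det :=
  isUnit_det_of_left_inverse (memU21_left h)

lemma finish {a1 a2 b1 b2 g1 g2 θ : ℝ} (hg2 : 0 < g2) (hg : g2 < g1) (hg1 : g1 < 2 * π)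
    (P : M3) (hP : memU21 P)
    (hdet : ex (a1 + a2 + b1 + b2) = ex (3 * θ - g1 - g2))
    (htr : (Emat a1 a2 * (P * Emat b1 b2 * P⁻¹)).trace = ex (θ - g1) + ex (θ - g2) + ex θ)
    (w : Fin 3 → ℂ)
    (hK : 0 < (hf w ((Emat a1 a2 * (P * Emat b1 b2 * P⁻¹)) *ᵥ w)
        * ex (-(θ - (g1 + g2) / 2))).re - (hf w w).re * Real.cos ((g1 - g2) / 2)) :
    Hs ((a1, a2), (b1, b2), (g1, g2)) := by
  set B : M3 := P * Emat b1 b2 * P⁻¹ with hB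
  have hBe : ellType B b1 b2 := ⟨P, hP, hB⟩
  have hBU := memU21_of_ell hBe
  have hAe : ellType (Emat a1 a2) a1 a2 := ⟨1, memU21_one, by simp⟩
  have hM := memU21_mul (memU21_Emat a1 a2) hBU
  set M : M3 := Emat a1 a2 * B with hMdef
  have hd : M.det = ex (θ - g1) * ex (θ - g2) * ex θ := by
    have e1 : ∀ x y : ℝ, (Emat x y).det = ex x * ex y := by
      intro x y; rw [Emat_ex, det_diagonal]; simp [Fin.prod_univ_three]
    have e2 : B.det = ex b1 * ex b2 := by
      rw [hB, det_mul, det_mul, mul_right_comm, ← det_mul, mul_nonsing_inv _ (memU21_isUnit hP),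
        det_one, one_mul, e1]
    rw [hMdef, det_mul, e1, e2, ← ex_add, ← ex_add, ← ex_add, ← ex_add, ← ex_add,
      show a1 + a2 + (b1 + b2) = a1 + a2 + b1 + b2 by ring, hdet]
    congr 1; ring
  have h12 : ex (θ - g1) ≠ ex (θ - g2) := (ex_ne_of (by linarith) (by linarith)).symm
  have h13 : ex (θ - g1) ≠ ex θ := (ex_ne_of (by linarith) (by linarith)).symm
  have h23 : ex (θ - g2) ≠ ex θ := (ex_ne_of (by linarith) (by linarith)).symm
  obtain ⟨v, hv, hvv⟩ := eig_vec hM (ex_star_mul (θ - g1)) (ex_star_mul (θ - g2))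
    (ex_star_mul θ) htr hd w
  have hneg : (hf v v).re < 0 := by
    set τ := hf w (M *ᵥ w) with hτ
    set K := (τ * ex (-(θ - (g1 + g2) / 2))).re - (hf w w).re * Real.cos ((g1 - g2) / 2) with hKd
    have f1 : ex (-(θ - (g1 + g2) / 2)) * (ex θ - (ex (θ - g1) + ex (θ - g2))
        + ex (θ - g1) * ex (θ - g2) * star (ex θ))
        = ((-4 * (Real.sin (g1 / 2) * Real.sin (g2 / 2)) : ℝ) : ℂ) := by
      rw [ex_star, mul_add, mul_sub, mul_add, ← ex_add, ← ex_add, ← ex_add, ← ex_add, ← ex_add,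
        ← ex_add]
      have c1 := ex_add_neg ((g1 + g2) / 2)
      have c2 := ex_add_neg ((g1 - g2) / 2)
      have t1 : Real.cos ((g1 + g2) / 2) - Real.cos ((g1 - g2) / 2)
          = -2 * (Real.sin (g1 / 2) * Real.sin (g2 / 2)) := by
        rw [show (g1 + g2) / 2 = g1 / 2 + g2 / 2 by ring,
          show (g1 - g2) / 2 = g1 / 2 - g2 / 2 by ring, Real.cos_add, Real.cos_sub]; ring
      rw [show (-4 * (Real.sin (g1 / 2) * Real.sin (g2 / 2))) =
        2 * Real.cos ((g1 + g2) / 2) - 2 * Real.cos ((g1 - g2) / 2) by linarith,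
        Complex.ofReal_sub, ← c1, ← c2]
      rw [show -(θ - (g1 + g2) / 2) + θ = (g1 + g2) / 2 by ring,
        show -(θ - (g1 + g2) / 2) + (θ - g1) = -((g1 - g2) / 2) by ring,
        show -(θ - (g1 + g2) / 2) + (θ - g2) = (g1 - g2) / 2 by ring,
        show -(θ - (g1 + g2) / 2) + (θ - g1 + (θ - g2) + -θ) = -((g1 + g2) / 2) by ring]
      ring
    have f2 : ex (-(θ - (g1 + g2) / 2)) * (τ - (ex (θ - g1) + ex (θ - g2)) * hf w w
        + ex (θ - g1) * ex (θ - g2) * star τ) = ((2 * K : ℝ) : ℂ) := by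
      have r1 : τ * ex (-(θ - (g1 + g2) / 2)) + star (τ * ex (-(θ - (g1 + g2) / 2)))
          = ((2 * (τ * ex (-(θ - (g1 + g2) / 2))).re : ℝ) : ℂ) := by
        have := Complex.add_conj (τ * ex (-(θ - (g1 + g2) / 2)))
        simpa using this
      have c2 := ex_add_neg ((g1 - g2) / 2)
      have r2 := hf_real w
      rw [show (2 * K) = 2 * (τ * ex (-(θ - (g1 + g2) / 2))).re
        - (2 * Real.cos ((g1 - g2) / 2)) * (hf w w).re by rw [hKd]; ring]
      rw [Complex.ofReal_sub, Complex.ofReal_mul (2 * Real.cos ((g1 - g2) / 2)), ← c2, ← r2, ← r1,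
        star_mul', ex_star]
      have q1 : ex (-(θ - (g1 + g2) / 2)) * ex (θ - g1) = ex (-((g1 - g2) / 2)) := by
        rw [← ex_add]; congr 1; ring
      have q2 : ex (-(θ - (g1 + g2) / 2)) * ex (θ - g2) = ex ((g1 - g2) / 2) := by
        rw [← ex_add]; congr 1; ring
      have q3 : ex (-(θ - (g1 + g2) / 2)) * (ex (θ - g1) * ex (θ - g2))
          = ex (-(-(θ - (g1 + g2) / 2))) := by
        rw [← ex_add, ← ex_add]; congr 1; ring
      linear_combination (-hf w w) * q1 + (-hf w w) * q2 + (star τ) * q3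
    have f3 : star (ex (θ - g1) * ex (θ - g2))
        = ex (-(θ - (g1 + g2) / 2)) * ex (-(θ - (g1 + g2) / 2)) := by
      rw [← ex_add, ex_star, ← ex_add]; congr 1; ring
    have f4 : hf v v = ((-4 * (Real.sin (g1 / 2) * Real.sin (g2 / 2)) * (2 * K) : ℝ) : ℂ) := by
      rw [hvv, f3, Complex.ofReal_mul, ← f1, ← f2]; ring
    rw [f4, Complex.ofReal_re]
    have s1 : 0 < Real.sin (g1 / 2) := Real.sin_pos_of_pos_of_lt_pi (by linarith) (by linarith)
    have s2 : 0 < Real.sin (g2 / 2) := Real.sin_pos_of_pos_of_lt_pi (by linarith) (by linarith)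
    have := mul_pos (mul_pos s1 s2) hK
    nlinarith
  obtain ⟨R, hR, hMR⟩ := diagonalize hM (ex_star_mul (θ - g1)) (ex_star_mul (θ - g2))
    (ex_star_mul θ) h12 h13 h23 htr hd ⟨v, hv, hneg⟩
  have hCe : ellType (R * Emat g1 g2 * R⁻¹) g1 g2 := ⟨R, hR, rfl⟩
  refine ⟨Emat a1 a2, B, R * Emat g1 g2 * R⁻¹, memU21_Emat _ _, hBU, memU21_of_ell hCe, hAe, hBe,
    hCe, ex θ, ?_⟩
  rw [← hMdef, ← Matrix.mul_assoc, ← Matrix.mul_assoc, hMR, Matrix.mul_assoc R, Emat_ex,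
    diagonal_mul_diagonal]
  have e : (fun i => (![ex (θ - g1), ex (θ - g2), ex θ] : Fin 3 → ℂ) i *
      (![ex g1, ex g2, 1] : Fin 3 → ℂ) i) = fun _ => ex θ := by
    funext i
    fin_cases i
    · simp [← ex_add]
    · simp [← ex_add]
    · simp
  rw [e, ← smul_one_eq_diagonal, Matrix.mul_smul, Matrix.mul_one, Matrix.smul_mul,
    mul_nonsing_inv _ (memU21_isUnit hR)]

set_option linter.unusedSimpArgs false

/-- Matrix of the family with `e₁ ⊥ f₂`. -/
def F12 (c s C S : ℂ) : M3 := !![C, 0, S; s * S, c, s * C; c * S, s, c * C]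
def F12i (c s C S : ℂ) : M3 := !![C, s * S, -(c * S); 0, c, -s; -S, -(s * C), c * C]

lemma F12_inv {c s C S : ℂ} (h1 : c * c = 1 + s * s) (h2 : C * C = 1 + S * S) :
    F12i c s C S * F12 c s C S = 1 := by
  ext i j
  fin_cases i <;> fin_cases j <;>
    simp [F12, F12i, Matrix.mul_apply, Fin.sum_univ_three]
  · linear_combination h2 - S * S * h1
  · ring
  · linear_combination (-C * S) * h1
  · ring
  · linear_combination h1
  · ring
  · linear_combination (C * S) * h1
  · ring
  · linear_combination (C * C) * h1 + h2

lemma F12_star {c s C S : ℂ} (hc : star c = c) (hs : star s = s) (hC : star C = C)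
    (hS : star S = S) : J3 * (F12 c s C S)ᴴ * J3 = F12i c s C S := by
  unfold J3
  ext i j
  rw [Matrix.mul_diagonal, Matrix.diagonal_mul, conjTranspose_apply]
  fin_cases i <;> fin_cases j <;>
    simp [F12, F12i] <;> simp_all

lemma memU21_of_inv {P Q : M3} (h : J3 * Pᴴ * J3 = Q) (h' : Q * P = 1) : memU21 P := by
  show Pᴴ * J3 * P = J3
  rw [← h] at h'
  calc Pᴴ * J3 * P = J3 * J3 * (Pᴴ * J3 * P) := by rw [J3_sq, Matrix.one_mul]
    _ = J3 * (J3 * Pᴴ * J3 * P) := by simp only [Matrix.mul_assoc]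
    _ = J3 := by rw [h', Matrix.mul_one]

lemma F12_trace {c s C S p q : ℂ} (h1 : c * c = 1 + p) (h1' : s * s = p) (h2 : C * C = 1 + q)
    (h2' : S * S = q) (a1 a2 b1 b2 : ℝ) :
    (Emat a1 a2 * (F12 c s C S * Emat b1 b2 * F12i c s C S)).trace
      = ex a1 * ex b1 + ex a2 * ex b2 + 1 + p * ((ex a2 - 1) * (ex b2 - 1))
        + q * ((ex a1 - 1) * (ex b1 - 1)) + p * q * ((ex a2 - 1) * (ex b1 - 1)) := by
  rw [Emat_ex, Emat_ex]
  simp only [Matrix.trace, Matrix.diag, Fin.sum_univ_three, Matrix.diagonal_mul, Matrix.mul_apply,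
    Matrix.mul_diagonal]
  simp [F12, F12i]
  have e1 : c ^ 2 = 1 + p := by rw [← h1]; ring
  have e2 : s ^ 2 = p := by rw [← h1']; ring
  have e3 : C ^ 2 = 1 + q := by rw [← h2]; ring
  have e4 : S ^ 2 = q := by rw [← h2']; ring
  ring_nf
  simp only [e1, e2, e3, e4]
  ring

lemma F12_e2 {c s C S p q : ℂ} (h1 : c * c = 1 + p) (h1' : s * s = p) (h2 : C * C = 1 + q)
    (h2' : S * S = q) (a1 a2 b1 b2 : ℝ) :
    hf ![0, 1, 0] ((Emat a1 a2 * (F12 c s C S * Emat b1 b2 * F12i c s C S)) *ᵥ ![0, 1, 0])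
      = ex a2 * (p * q * ex b1 + (1 + p) * ex b2 - p * (1 + q)) := by
  rw [Emat_ex, Emat_ex, hf_expl]
  simp only [mulVec, dotProduct, Fin.sum_univ_three, Matrix.diagonal_mul, Matrix.mul_apply,
    Matrix.mul_diagonal]
  simp [F12, F12i]
  left
  have e1 : c ^ 2 = 1 + p := by rw [← h1]; ring
  have e2 : s ^ 2 = p := by rw [← h1']; ring
  have e3 : C ^ 2 = 1 + q := by rw [← h2]; ring
  have e4 : S ^ 2 = q := by rw [← h2']; ring
  ring_nf
  simp only [e1, e2, e3, e4]
  ring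

lemma F12_e3 {c s C S p q : ℂ} (h1 : c * c = 1 + p) (h1' : s * s = p) (h2 : C * C = 1 + q)
    (h2' : S * S = q) (a1 a2 b1 b2 : ℝ) :
    hf ![0, 0, 1] ((Emat a1 a2 * (F12 c s C S * Emat b1 b2 * F12i c s C S)) *ᵥ ![0, 0, 1])
      = -(-(1 + p) * q * ex b1 - p * ex b2 + (1 + p) * (1 + q)) := by
  rw [Emat_ex, Emat_ex, hf_expl]
  simp only [mulVec, dotProduct, Fin.sum_univ_three, Matrix.diagonal_mul, Matrix.mul_apply,
    Matrix.mul_diagonal]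
  simp [F12, F12i]
  have e1 : c ^ 2 = 1 + p := by rw [← h1]; ring
  have e2 : s ^ 2 = p := by rw [← h1']; ring
  have e3 : C ^ 2 = 1 + q := by rw [← h2]; ring
  have e4 : S ^ 2 = q := by rw [← h2']; ring
  ring_nf
  simp only [e1, e2, e3, e4]
  ring

/-- first column test vector. -/
lemma F12_f1 {c s C S p q : ℂ} (hc : star c = c) (hs : star s = s) (hC : star C = C)
    (hS : star S = S) (h1 : c * c = 1 + p) (h1' : s * s = p) (h2 : C * C = 1 + q)
    (h2' : S * S = q) (a1 a2 b1 b2 : ℝ) :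
    hf ![C, s * S, c * S] ((Emat a1 a2 * (F12 c s C S * Emat b1 b2 * F12i c s C S)) *ᵥ
      ![C, s * S, c * S])
      = ex b1 * ((1 + q) * ex a1 + p * q * ex a2 - (1 + p) * q) := by
  have h := F12_inv (c := c) (s := s) (C := C) (S := S) (by rw [h1, h1']) (by rw [h2, h2'])
  have e0 : F12i c s C S *ᵥ ![C, s * S, c * S] = ![1, 0, 0] := by
    have : (![C, s * S, c * S] : Fin 3 → ℂ) = F12 c s C S *ᵥ ![1, 0, 0] := by
      funext i
      fin_cases i <;> simp [F12, mulVec, dotProduct, Fin.sum_univ_three]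
    rw [this, mulVec_mulVec, h, one_mulVec]
  rw [← Matrix.mul_assoc, ← mulVec_mulVec, e0, Emat_ex, Emat_ex, hf_expl]
  simp only [mulVec, dotProduct, Fin.sum_univ_three, Matrix.diagonal_mul, Matrix.mul_apply,
    Matrix.mul_diagonal]
  simp [F12]
  simp only [Complex.star_def] at hc hs hC hS
  rw [hc, hs, hC, hS]
  have e1 : c ^ 2 = 1 + p := by rw [← h1]; ring
  have e2 : s ^ 2 = p := by rw [← h1']; ring
  have e3 : C ^ 2 = 1 + q := by rw [← h2]; ring
  have e4 : S ^ 2 = q := by rw [← h2']; ring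
  ring_nf
  simp only [e1, e2, e3, e4]
  ring

/-- Matrix of the family with `e₂ ⊥ f₃`. -/
def F23 (c s k l : ℂ) : M3 := !![c * k, c * l, s; -l, k, 0; s * k, s * l, c]
def F23i (c s k l : ℂ) : M3 := !![c * k, -l, -(s * k); c * l, k, -(s * l); -s, 0, c]

lemma F23_inv {c s k l : ℂ} (h1 : c * c = 1 + s * s) (h2 : k * k + l * l = 1) :
    F23i c s k l * F23 c s k l = 1 := by
  ext i j
  fin_cases i <;> fin_cases j <;>
    simp [F23, F23i, Matrix.mul_apply, Fin.sum_univ_three]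
  · linear_combination h2 + k * k * h1
  · linear_combination k * l * h1
  · ring
  · linear_combination k * l * h1
  · linear_combination h2 + l * l * h1
  · ring
  · ring
  · ring
  · linear_combination h1

lemma F23_star {c s k l : ℂ} (hc : star c = c) (hs : star s = s) (hC : star k = k)
    (hS : star l = l) : J3 * (F23 c s k l)ᴴ * J3 = F23i c s k l := by
  unfold J3
  ext i j
  rw [Matrix.mul_diagonal, Matrix.diagonal_mul, conjTranspose_apply]
  fin_cases i <;> fin_cases j <;>
    simp [F23, F23i] <;> simp_all

lemma F23_trace {c s k l p y : ℂ} (h1 : c * c = 1 + p) (h1' : s * s = p) (h2 : k * k = 1 - y)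
    (h2' : l * l = y) (a1 a2 b1 b2 : ℝ) :
    (Emat a1 a2 * (F23 c s k l * Emat b1 b2 * F23i c s k l)).trace
      = 1 + y * (ex a2 * ex b1 + ex a1 * ex b2) + (1 - y) * (ex a1 * ex b1 + ex a2 * ex b2)
        + p * ((ex a1 - 1) * ((1 - y) * (ex b1 - 1) + y * (ex b2 - 1))) := by
  rw [Emat_ex, Emat_ex]
  simp only [Matrix.trace, Matrix.diag, Fin.sum_univ_three, Matrix.diagonal_mul, Matrix.mul_apply,
    Matrix.mul_diagonal]
  simp [F23, F23i]
  have e1 : c ^ 2 = 1 + p := by rw [← h1]; ring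
  have e2 : s ^ 2 = p := by rw [← h1']; ring
  have e3 : k ^ 2 = 1 - y := by rw [← h2]; ring
  have e4 : l ^ 2 = y := by rw [← h2']; ring
  ring_nf
  simp only [e1, e2, e3, e4]
  ring

lemma F23_e3 {c s k l p y : ℂ} (h1 : c * c = 1 + p) (h1' : s * s = p) (h2 : k * k = 1 - y)
    (h2' : l * l = y) (a1 a2 b1 b2 : ℝ) :
    hf ![0, 0, 1] ((Emat a1 a2 * (F23 c s k l * Emat b1 b2 * F23i c s k l)) *ᵥ ![0, 0, 1])
      = -(-p * (1 - y) * ex b1 - p * y * ex b2 + (1 + p)) := by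
  rw [Emat_ex, Emat_ex, hf_expl]
  simp only [mulVec, dotProduct, Fin.sum_univ_three, Matrix.diagonal_mul, Matrix.mul_apply,
    Matrix.mul_diagonal]
  simp [F23, F23i]
  have e1 : c ^ 2 = 1 + p := by rw [← h1]; ring
  have e2 : s ^ 2 = p := by rw [← h1']; ring
  have e3 : k ^ 2 = 1 - y := by rw [← h2]; ring
  have e4 : l ^ 2 = y := by rw [← h2']; ring
  ring_nf
  simp only [e1, e2, e3, e4]
  ring

lemma F23_f1 {c s k l p y : ℂ} (hc : star c = c) (hs : star s = s) (hC : star k = k)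
    (hS : star l = l) (h1 : c * c = 1 + p) (h1' : s * s = p) (h2 : k * k = 1 - y)
    (h2' : l * l = y) (a1 a2 b1 b2 : ℝ) :
    hf ![c * k, -l, s * k] ((Emat a1 a2 * (F23 c s k l * Emat b1 b2 * F23i c s k l)) *ᵥ
      ![c * k, -l, s * k])
      = ex b1 * ((1 + p) * (1 - y) * ex a1 + y * ex a2 - p * (1 - y)) := by
  have h := F23_inv (c := c) (s := s) (k := k) (l := l) (by rw [h1, h1']) (by rw [h2, h2']; ring)
  have e0 : F23i c s k l *ᵥ ![c * k, -l, s * k] = ![1, 0, 0] := by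
    have : (![c * k, -l, s * k] : Fin 3 → ℂ) = F23 c s k l *ᵥ ![1, 0, 0] := by
      funext i
      fin_cases i <;> simp [F23, mulVec, dotProduct, Fin.sum_univ_three]
    rw [this, mulVec_mulVec, h, one_mulVec]
  rw [← Matrix.mul_assoc, ← mulVec_mulVec, e0, Emat_ex, Emat_ex, hf_expl]
  simp only [mulVec, dotProduct, Fin.sum_univ_three, Matrix.diagonal_mul, Matrix.mul_apply,
    Matrix.mul_diagonal]
  simp [F23]
  simp only [Complex.star_def] at hc hs hC hS
  rw [hc, hs, hC, hS]
  have e1 : c ^ 2 = 1 + p := by rw [← h1]; ring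
  have e2 : s ^ 2 = p := by rw [← h1']; ring
  have e3 : k ^ 2 = 1 - y := by rw [← h2]; ring
  have e4 : l ^ 2 = y := by rw [← h2']; ring
  ring_nf
  simp only [e1, e2, e3, e4]
  ring

/-- half angle sine -/
def sh (x : ℝ) : ℝ := Real.sin (x / 2)

lemma sh_pos {x : ℝ} (h : 0 < x) (h' : x < 2 * π) : 0 < sh x :=
  Real.sin_pos_of_pos_of_lt_pi (by linarith) (by linarith)
lemma sh_nonneg {x : ℝ} (h : 0 ≤ x) (h' : x ≤ 2 * π) : 0 ≤ sh x :=
  Real.sin_nonneg_of_nonneg_of_le_pi (by linarith) (by linarith)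
lemma sh_neg (x : ℝ) : sh (-x) = - sh x := by
  unfold sh; rw [neg_div, Real.sin_neg]
lemma sh_add (x : ℝ) : sh (x + 2 * π) = - sh x := by
  unfold sh; rw [show (x + 2 * π) / 2 = x / 2 + π by ring, Real.sin_add_pi]
lemma sh_sub (x : ℝ) : sh (x - 2 * π) = - sh x := by
  unfold sh; rw [show (x - 2 * π) / 2 = x / 2 - π by ring, Real.sin_sub_pi]

lemma four_sin (A B C : ℝ) : 4 * (Real.sin A * Real.sin B * Real.sin C) =
    Real.sin (A + B - C) + Real.sin (A - B + C) + Real.sin (-A + B + C) - Real.sin (A + B + C) := by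
  simp only [Real.sin_add, Real.sin_sub, Real.cos_add, Real.cos_sub, Real.sin_neg, Real.cos_neg]
  ring

/-- the identity used for type estimates -/
lemma two_sin (a b c d : ℝ) (h : a + b = c + d) :
    sh a * sh b - sh c * sh d = sh (c - a) * sh (a - d) := by
  have e : d = a + b - c := by linarith
  subst e
  unfold sh
  have h1 : ∀ p q : ℝ, Real.sin p * Real.sin q = (Real.cos (p - q) - Real.cos (p + q)) / 2 := by
    intro p q; rw [Real.cos_add, Real.cos_sub]; ring
  rw [h1, h1, h1]
  rw [show a / 2 - b / 2 = -((c - a) / 2 - (a - (a + b - c)) / 2) by ring, Real.cos_neg,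
    show a / 2 + b / 2 = c / 2 + (a + b - c) / 2 by ring,
    show c / 2 - (a + b - c) / 2 = (c - a) / 2 + (a - (a + b - c)) / 2 by ring]
  ring

lemma ex_half (a b : ℝ) : (ex a - 1) * (ex b - 1) = -4 * (sh a * sh b : ℝ) * ex ((a + b) / 2) := by
  have h : ∀ x : ℝ, ex x - 1 = 2 * Complex.I * (sh x : ℝ) * ex (x / 2) := by
    intro x
    have e1 : ex x = ex (x / 2) * ex (x / 2) := by rw [← ex_add]; congr 1; ring
    have e2 : ex (x / 2) * ex (-(x / 2)) = 1 := by rw [← ex_add]; simp [ex_zero]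
    have e3 : ex (x / 2) - ex (-(x / 2)) = 2 * Complex.I * (sh x : ℝ) := by
      rw [ex_eq, ex_eq, Real.cos_neg, Real.sin_neg, sh]; push_cast; ring
    rw [← e3, e1]; linear_combination e2
  rw [h, h, show (a + b) / 2 = a / 2 + b / 2 by ring, ex_add]
  push_cast
  linear_combination (4 * (sh a : ℂ) * sh b * ex (a / 2) * ex (b / 2)) * Complex.I_mul_I

/-- shift data: ρ = 0, ε = 1 or ρ = π, ε = -1. -/
structure Shift (ρ ε : ℝ) : Prop where
  s : ∀ x, Real.sin (x - ρ) = ε * Real.sin x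
  e : ex (2 * ρ) = 1

lemma shift0 : Shift 0 1 := ⟨fun x => by simp, by simp [ex_zero]⟩
lemma shift1 : Shift π (-1) := ⟨fun x => by rw [Real.sin_sub_pi]; ring, by
  rw [ex_eq]; simp⟩

/-- target trace -/
def tst (θ g1 g2 : ℝ) : ℂ := ex (θ - g1) + ex (θ - g2) + ex θ

lemma corner {ρ ε θ g1 g2 x1 x2 : ℝ} (hs : Shift ρ ε) (hD : x1 + x2 + g1 + g2 = 3 * θ - 2 * ρ) :
    ((tst θ g1 g2 - (ex x1 + ex x2 + 1)) * ex (-(x1 / 2))).im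
      = 4 * (ε * (sh (x2 + g1 - θ) * sh (x2 + g2 - θ) * sh (x2 - θ))) := by
  rw [show 4 * (ε * (sh (x2 + g1 - θ) * sh (x2 + g2 - θ) * sh (x2 - θ))) =
    ε * (4 * (sh (x2 + g1 - θ) * sh (x2 + g2 - θ) * sh (x2 - θ))) by ring]
  unfold sh tst
  rw [four_sin]
  have hh : ∀ x, ε * Real.sin x = Real.sin (x - ρ) := fun x => (hs.s x).symm
  have hε : ε * ε = 1 := by
    have a1 := hs.s (π / 2 + ρ)
    have a2 := hs.s (π / 2)
    have a3 := hs.e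
    have a4 : Real.cos (2 * ρ) = 1 := by rw [← ex_re, a3]; rfl
    have a5 : Real.sin ρ = 0 := by
      rw [Real.cos_two_mul] at a4
      nlinarith [Real.sin_sq_add_cos_sq ρ]
    rw [add_sub_cancel_right, Real.sin_pi_div_two, add_comm, Real.sin_add_pi_div_two] at a1
    rw [Real.sin_pi_div_two, show π / 2 - ρ = π / 2 - ρ from rfl, Real.sin_pi_div_two_sub] at a2
    rw [a2] at a1; linarith
  have hh' : ∀ x, ε * Real.sin x = Real.sin (x + ρ) := fun x => by
    have := hs.s (x + ρ); rw [add_sub_cancel_right] at this; rw [this, ← mul_assoc, hε, one_mul]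
  simp only [mul_sub, mul_add, hh']
  simp only [sub_mul, add_mul, one_mul, ← ex_add, Complex.add_im, Complex.sub_im, ex_im]
  have e : g1 = 3 * θ - 2 * ρ - g2 - x1 - x2 := by linarith
  subst e
  ring_nf
  rw [show x1 * (-1 / 2) = -(x1 * (1 / 2)) by ring, Real.sin_neg]
  ring

lemma Klem {ρ ε θ g1 g2 x y φ c : ℝ} {τ : ℂ} (hs : Shift ρ ε)
    (hD : x + y + φ + g1 + g2 = 3 * θ - 2 * ρ)
    (hτ : τ * (1 - ex (-φ)) = tst θ g1 g2 - (ex x + ex y + 1 - 4 * (c : ℝ) * ex (y / 2))) :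
    2 * sh φ * ((τ * ex (-(θ - (g1 + g2) / 2))).re - Real.cos ((g1 - g2) / 2)) =
      -4 * (ε * (sh (θ - x) * (sh θ * sh (θ - y) - c))) := by
  have h1 : (2 * sh φ : ℝ) * (τ * ex (-(θ - (g1 + g2) / 2))).re
      = ((tst θ g1 g2 - (ex x + ex y + 1 - 4 * (c : ℝ) * ex (y / 2))) *
        ex (φ / 2 - (θ - (g1 + g2) / 2))).im := by
    rw [← hτ]
    have e1 : (1 - ex (-φ)) * ex (φ / 2 - (θ - (g1 + g2) / 2))
        = ((2 * sh φ : ℝ) : ℂ) * (Complex.I * ex (-(θ - (g1 + g2) / 2))) := by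
      have e3 : ex (φ / 2) - ex (-(φ / 2)) = 2 * Complex.I * (sh φ : ℝ) := by
        rw [ex_eq, ex_eq, Real.cos_neg, Real.sin_neg, sh]; push_cast; ring
      have e4 : (1 - ex (-φ)) * ex (φ / 2) = ex (φ / 2) - ex (-(φ / 2)) := by
        rw [sub_mul, ← ex_add, one_mul]; congr 2; ring
      rw [sub_eq_add_neg (φ / 2), ex_add, ← mul_assoc, e4, e3]; push_cast; ring
    rw [mul_assoc τ, e1]
    rw [show τ * (((2 * sh φ : ℝ) : ℂ) * (Complex.I * ex (-(θ - (g1 + g2) / 2)))) =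
      ((2 * sh φ : ℝ) : ℂ) * (Complex.I * (τ * ex (-(θ - (g1 + g2) / 2)))) by ring]
    rw [Complex.im_ofReal_mul]
    simp
  have h2 : 2 * sh φ * Real.cos ((g1 - g2) / 2) = Real.sin (φ / 2 - (g1 - g2) / 2) +
      Real.sin (φ / 2 + (g1 - g2) / 2) := by
    unfold sh; rw [Real.sin_add, Real.sin_sub]; ring
  rw [mul_sub, h1, h2]
  rw [show -4 * (ε * (sh (θ - x) * (sh θ * sh (θ - y) - c))) =
    4 * c * (ε * sh (θ - x)) - ε * (4 * (sh θ * sh (θ - x) * sh (θ - y))) by ring]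
  unfold sh tst
  rw [four_sin]
  simp only [mul_sub, mul_add, ← hs.s]
  have h5 : ((ex (θ - g1) + ex (θ - g2) + ex θ - (ex x + ex y + 1 - 4 * (c : ℝ) * ex (y / 2))) *
        ex (φ / 2 - (θ - (g1 + g2) / 2))).im =
      Real.sin (θ - g1 + (φ / 2 - (θ - (g1 + g2) / 2))) + Real.sin (θ - g2 + (φ / 2 - (θ - (g1 + g2) / 2)))
      + Real.sin (θ + (φ / 2 - (θ - (g1 + g2) / 2))) - (Real.sin (x + (φ / 2 - (θ - (g1 + g2) / 2)))
      + Real.sin (y + (φ / 2 - (θ - (g1 + g2) / 2))) + Real.sin (φ / 2 - (θ - (g1 + g2) / 2))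
      - 4 * c * Real.sin (y / 2 + (φ / 2 - (θ - (g1 + g2) / 2)))) := by
    simp only [sub_mul, add_mul, one_mul, mul_assoc, ← ex_add]
    rw [show (4 : ℂ) * ((c : ℂ) * ex (y / 2 + (φ / 2 - (θ - (g1 + g2) / 2)))) =
      ((4 * c : ℝ) : ℂ) * ex (y / 2 + (φ / 2 - (θ - (g1 + g2) / 2))) by push_cast; ring]
    simp only [Complex.add_im, Complex.sub_im, Complex.im_ofReal_mul, ex_im]
    ring
  rw [h5]
  have e : φ = 3 * θ - 2 * ρ - g2 - g1 - x - y := by linarith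
  subst e
  ring_nf

lemma quad_root {A B C : ℝ} (hA : 0 < A) (hC : C ≤ 0) : ∃ v : ℝ, 0 ≤ v ∧ A * v ^ 2 + B * v + C = 0 := by
  have hd : 0 ≤ B ^ 2 - 4 * A * C := by nlinarith [sq_nonneg B]
  refine ⟨(-B + Real.sqrt (B ^ 2 - 4 * A * C)) / (2 * A), ?_, ?_⟩
  · apply div_nonneg _ (by linarith)
    have : |B| ≤ Real.sqrt (B ^ 2 - 4 * A * C) := Real.abs_le_sqrt (by nlinarith)
    linarith [le_abs_self B]
  · have h := Real.sq_sqrt hd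
    set r := Real.sqrt (B ^ 2 - 4 * A * C)
    field_simp
    nlinarith

lemma solve_aux {X Y k1 k2 S1 S2 C1 C2 : ℝ} (hk1 : 0 < k1) (hk2 : 0 < k2) (hS1 : 0 < S1)
    (hS2 : 0 < S2) (hY : 0 ≤ Y) (h1 : Y * C1 ≤ X * S1) :
    ∃ u v : ℝ, 0 ≤ u ∧ 0 ≤ v ∧ Y = u * k1 * S1 - v * k2 * S2 ∧
      X = u * k1 * C1 + v * k2 * C2 + u * v := by
  obtain ⟨v, hv, e⟩ := quad_root (A := k2 * S2) (B := Y + k1 * k2 * S2 * C1 + k1 * S1 * k2 * C2)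
    (C := k1 * (Y * C1 - X * S1)) (by positivity) (by
      exact mul_nonpos_of_nonneg_of_nonpos hk1.le (by linarith))
  refine ⟨(Y + v * k2 * S2) / (k1 * S1), v, by positivity, hv, ?_, ?_⟩
  · field_simp; ring
  · field_simp
    nlinarith

lemma solve_uv {X Y k1 k2 S1 S2 C1 C2 : ℝ} (hk1 : 0 < k1) (hk2 : 0 < k2) (hS1 : 0 < S1)
    (hS2 : 0 < S2) (h1 : 0 ≤ X * S1 - Y * C1) (h2 : 0 ≤ Y * C2 + X * S2) :
    ∃ u v : ℝ, 0 ≤ u ∧ 0 ≤ v ∧ Y = u * k1 * S1 - v * k2 * S2 ∧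
      X = u * k1 * C1 + v * k2 * C2 + u * v := by
  rcases le_total 0 Y with hY | hY
  · exact solve_aux hk1 hk2 hS1 hS2 hY (by linarith)
  · obtain ⟨v, u, hv, hu, e1, e2⟩ := solve_aux (X := X) (Y := -Y) (C1 := C2) (C2 := C1) hk2 hk1 hS2 hS1
      (by linarith) (by linarith)
    exact ⟨u, v, hu, hv, by linarith, by linarith⟩

lemma hf_e3 : (hf ![0, 0, 1] ![0, 0, 1]).re = -1 := by rw [hf_expl]; simp
lemma hf_e2 : (hf ![0, 1, 0] ![0, 1, 0]).re = 1 := by rw [hf_expl]; simp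
lemma hf_e1 : (hf ![1, 0, 0] ![1, 0, 0]).re = 1 := by rw [hf_expl]; simp

lemma e3_pos {θ g1 g2 : ℝ} (hg2 : 0 < g2) (hg : g2 < g1) (hg1 : g1 < 2 * π) (hθ : θ = 2 * π) :
    0 < ((-1 : ℂ) * ex (-(θ - (g1 + g2) / 2))).re - (-1) * Real.cos ((g1 - g2) / 2) := by
  have : ((-1 : ℂ) * ex (-(θ - (g1 + g2) / 2))).re = - Real.cos ((g1 + g2) / 2) := by
    rw [neg_one_mul, Complex.neg_re, ex_re, Real.cos_neg, hθ, Real.cos_two_pi_sub]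
  rw [this]
  have s1 : 0 < Real.sin (g1 / 2) := Real.sin_pos_of_pos_of_lt_pi (by linarith) (by linarith)
  have s2 : 0 < Real.sin (g2 / 2) := Real.sin_pos_of_pos_of_lt_pi (by linarith) (by linarith)
  rw [show (g1 + g2) / 2 = g1 / 2 + g2 / 2 by ring,
          show (g1 - g2) / 2 = g1 / 2 - g2 / 2 by ring, Real.cos_add, Real.cos_sub]
  nlinarith [mul_pos s1 s2]

section
variable {ρ ε θ a1 a2 b1 b2 g1 g2 : ℝ}

lemma det_cond (hs : Shift ρ ε) (hD : a1 + a2 + b1 + b2 + g1 + g2 = 3 * θ - 2 * ρ) :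
    ex (a1 + a2 + b1 + b2) = ex (3 * θ - g1 - g2) := by
  have : 3 * θ - g1 - g2 = a1 + a2 + b1 + b2 + 2 * ρ := by linarith
  rw [this, ex_add _ (2 * ρ), hs.e, mul_one]

lemma fam12 (hs : Shift ρ ε) (hD : a1 + a2 + b1 + b2 + g1 + g2 = 3 * θ - 2 * ρ)
    (ha2 : 0 < a2) (ha : a2 < a1) (ha1 : a1 < 2 * π)
    (hb2 : 0 < b2) (hb : b2 < b1) (hb1 : b1 < 2 * π)
    (hg2 : 0 < g2) (hg : g2 < g1) (hg1 : g1 < 2 * π) {u v : ℝ} (hu : 0 ≤ u) (hv : 0 ≤ v)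
    (htr : tst θ g1 g2 = ex (a1 + b1) + ex (a2 + b2) + 1
      - 4 * (((v * sh b2 : ℝ) : ℂ) * ex ((a2 + b2) / 2) + ((u * sh a1 : ℝ) : ℂ) * ex ((a1 + b1) / 2)
        + ((u * v : ℝ) : ℂ) * ex ((a2 + b1) / 2)))
    (hK : (ε * (sh (θ - b2) * (sh θ * sh (θ - (a1 + b1)) - u * sh a1)) < 0) ∨
      (ε * (sh (θ - a1) * (sh θ * sh (θ - (a2 + b2)) - v * sh b2)) < 0) ∨
      (u = 0 ∧ v = 0 ∧ θ = 2 * π)) :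
    Hs ((a1, a2), (b1, b2), (g1, g2)) := by
  have sa2 : 0 < sh a2 := sh_pos ha2 (by linarith)
  have sb1 : 0 < sh b1 := sh_pos (by linarith) hb1
  set p : ℝ := v / sh a2 with hp
  set q : ℝ := u / sh b1 with hq
  have hp0 : 0 ≤ p := div_nonneg hv sa2.le
  have hq0 : 0 ≤ q := div_nonneg hu sb1.le
  have hvp : v = p * sh a2 := by rw [hp]; field_simp
  have huq : u = q * sh b1 := by rw [hq]; field_simp
  set c : ℂ := ((Real.sqrt (1 + p) : ℝ) : ℂ)
  set s : ℂ := ((Real.sqrt p : ℝ) : ℂ)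
  set C : ℂ := ((Real.sqrt (1 + q) : ℝ) : ℂ)
  set S : ℂ := ((Real.sqrt q : ℝ) : ℂ)
  have h1 : c * c = 1 + (p : ℂ) := by
    rw [← Complex.ofReal_mul, Real.mul_self_sqrt (by linarith)]; push_cast; rfl
  have h1' : s * s = (p : ℂ) := by
    rw [← Complex.ofReal_mul, Real.mul_self_sqrt (by linarith)]
  have h2 : C * C = 1 + (q : ℂ) := by
    rw [← Complex.ofReal_mul, Real.mul_self_sqrt (by linarith)]; push_cast; rfl
  have h2' : S * S = (q : ℂ) := by
    rw [← Complex.ofReal_mul, Real.mul_self_sqrt (by linarith)]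
  have kc : star c = c := Complex.conj_ofReal _
  have ks : star s = s := Complex.conj_ofReal _
  have kC : star C = C := Complex.conj_ofReal _
  have kS : star S = S := Complex.conj_ofReal _
  have hinv := F12_inv (c := c) (s := s) (C := C) (S := S) (by rw [h1, h1']) (by rw [h2, h2'])
  have hU := memU21_of_inv (F12_star kc ks kC kS) hinv
  have hi : (F12 c s C S)⁻¹ = F12i c s C S := inv_eq_left_inv hinv
  have t1 : (Emat a1 a2 * (F12 c s C S * Emat b1 b2 * F12i c s C S)).trace = tst θ g1 g2 := by
    rw [F12_trace h1 h1' h2 h2', htr, ex_half, ex_half, ex_half, hvp, huq, ex_add a1, ex_add a2]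
    push_cast
    ring
  have key : ∀ (w : Fin 3 → ℂ) , 0 < (hf w ((Emat a1 a2 * (F12 c s C S * Emat b1 b2 * F12i c s C S)) *ᵥ w)
        * ex (-(θ - (g1 + g2) / 2))).re - (hf w w).re * Real.cos ((g1 - g2) / 2) →
    Hs ((a1, a2), (b1, b2), (g1, g2)) := by
    intro w hw
    rw [← hi] at t1 hw
    exact finish hg2 hg hg1 _ hU (det_cond hs hD) t1 w hw
  rcases hK with hK | hK | ⟨hu0, hv0, h2π⟩
  · apply key ![0, 1, 0]
    rw [hf_e2, one_mul]
    have := Klem (τ := hf ![0, 1, 0] ((Emat a1 a2 * (F12 c s C S * Emat b1 b2 * F12i c s C S)) *ᵥ ![0, 1, 0]))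
      (θ := θ) (g1 := g1) (g2 := g2) (x := b2) (y := a1 + b1) (φ := a2) (c := u * sh a1) hs (by linarith) (by
        rw [F12_e2 h1 h1' h2 h2', ← t1, F12_trace h1 h1' h2 h2', ex_half a1, huq, ex_add a1, ex_neg]
        have := ex_ne a2
        push_cast
        field_simp
        ring)
    nlinarith
  · apply key ![C, s * S, c * S]
    have hw : (![C, s * S, c * S] : Fin 3 → ℂ) = F12 c s C S *ᵥ ![1, 0, 0] := by
      funext i
      fin_cases i <;> simp [F12, mulVec, dotProduct, Fin.sum_univ_three]
    rw [show hf ![C, s * S, c * S] ![C, s * S, c * S] = hf ![1, 0, 0] ![1, 0, 0] by rw [hw, hf_U hU],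
      hf_e1, one_mul]
    have := Klem (τ := hf ![C, s * S, c * S] ((Emat a1 a2 * (F12 c s C S * Emat b1 b2 * F12i c s C S)) *ᵥ ![C, s * S, c * S]))
      (θ := θ) (g1 := g1) (g2 := g2) (x := a1) (y := a2 + b2) (φ := b1) (c := v * sh b2) hs (by linarith) (by
        rw [F12_f1 kc ks kC kS h1 h1' h2 h2', ← t1, F12_trace h1 h1' h2 h2', ex_half a2 b2, hvp, ex_add a2, ex_neg]
        have := ex_ne b1
        push_cast
        field_simp
        ring)
    nlinarith
  · apply key ![0, 0, 1]
    have p0 : p = 0 := by rw [hp, hv0, zero_div]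
    have q0 : q = 0 := by rw [hq, hu0, zero_div]
    rw [F12_e3 h1 h1' h2 h2', hf_e3, p0, q0]
    convert e3_pos hg2 hg hg1 h2π using 4
    simp

lemma im_mul_ex (X Y δ : ℝ) : (((X : ℂ) + Y * Complex.I) * ex δ).im
    = X * Real.sin δ + Y * Real.cos δ := by
  rw [Complex.mul_im, ex_re, ex_im]; simp

/-- solving the trace equation in the first family -/
lemma solve12 (hs : Shift ρ ε) (hD : a1 + a2 + b1 + b2 + g1 + g2 = 3 * θ - 2 * ρ)
    (ha2 : 0 < a2) (ha : a2 < a1) (ha1 : a1 < 2 * π)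
    (hb2 : 0 < b2) (hb : b2 < b1) (hb1 : b1 < 2 * π)
    (hG1 : 0 ≤ ε * (sh (a2 + b2 + g1 - θ) * sh (a2 + b2 + g2 - θ) * sh (a2 + b2 - θ)))
    (hG2 : 0 ≤ -(ε * (sh (a1 + b1 + g1 - θ) * sh (a1 + b1 + g2 - θ) * sh (a1 + b1 - θ)))) :
    ∃ u v : ℝ, 0 ≤ u ∧ 0 ≤ v ∧
    tst θ g1 g2 = ex (a1 + b1) + ex (a2 + b2) + 1
      - 4 * (((v * sh b2 : ℝ) : ℂ) * ex ((a2 + b2) / 2) + ((u * sh a1 : ℝ) : ℂ) * ex ((a1 + b1) / 2)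
        + ((u * v : ℝ) : ℂ) * ex ((a2 + b1) / 2)) ∧
    ε * (sh (a2 + b2 + g1 - θ) * sh (a2 + b2 + g2 - θ) * sh (a2 + b2 - θ))
      = v * (sh b2 * sh (a1 + b1 - (a2 + b2)) + u * sh (a1 - a2)) ∧
    -(ε * (sh (a1 + b1 + g1 - θ) * sh (a1 + b1 + g2 - θ) * sh (a1 + b1 - θ)))
      = u * (sh a1 * sh (a1 + b1 - (a2 + b2)) + v * sh (b1 - b2)) := by
  set W : ℂ := (ex (a1 + b1) + ex (a2 + b2) + 1 - tst θ g1 g2) / 4 with hW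
  set Z : ℂ := W * ex (-((a2 + b1) / 2)) with hZ
  have hZ' : Z = (Z.re : ℂ) + Z.im * Complex.I := (Complex.re_add_im Z).symm
  have i1 := corner (θ := θ) (x1 := a1 + b1) (x2 := a2 + b2) (g1 := g1) (g2 := g2) hs (by linarith)
  have i2 := corner (θ := θ) (x1 := a2 + b2) (x2 := a1 + b1) (g1 := g1) (g2 := g2) hs (by linarith)
  have j1 : (tst θ g1 g2 - (ex (a1 + b1) + ex (a2 + b2) + 1)) * ex (-((a1 + b1) / 2))
      = ((-4 : ℝ) : ℂ) * (Z * ex (-((a1 - a2) / 2))) := by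
    rw [hZ, mul_assoc W, ← ex_add, show -((a2 + b1) / 2) + -((a1 - a2) / 2) = -((a1 + b1) / 2) by ring,
      hW]; push_cast; ring
  have j2 : (tst θ g1 g2 - (ex (a2 + b2) + ex (a1 + b1) + 1)) * ex (-((a2 + b2) / 2))
      = ((-4 : ℝ) : ℂ) * (Z * ex ((b1 - b2) / 2)) := by
    rw [hZ, mul_assoc W, ← ex_add, show -((a2 + b1) / 2) + ((b1 - b2) / 2) = -((a2 + b2) / 2) by ring,
      hW]; push_cast; ring
  rw [j1, Complex.im_ofReal_mul, hZ', im_mul_ex, Real.sin_neg, Real.cos_neg] at i1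
  rw [j2, Complex.im_ofReal_mul, hZ', im_mul_ex] at i2
  have hS1 : 0 < sh (a1 - a2) := sh_pos (by linarith) (by linarith)
  have hS2 : 0 < sh (b1 - b2) := sh_pos (by linarith) (by linarith)
  have hk1 : 0 < sh a1 := sh_pos (by linarith) (by linarith)
  have hk2 : 0 < sh b2 := sh_pos (by linarith) (by linarith)
  have f1 : ε * (sh (a2 + b2 + g1 - θ) * sh (a2 + b2 + g2 - θ) * sh (a2 + b2 - θ))
      = Z.re * sh (a1 - a2) - Z.im * Real.cos ((a1 - a2) / 2) := by unfold sh at i1 ⊢; linarith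
  have f2 : -(ε * (sh (a1 + b1 + g1 - θ) * sh (a1 + b1 + g2 - θ) * sh (a1 + b1 - θ)))
      = Z.im * Real.cos ((b1 - b2) / 2) + Z.re * sh (b1 - b2) := by unfold sh at i2 ⊢; linarith
  rw [f1] at hG1
  rw [f2] at hG2
  obtain ⟨u, v, hu, hv, eY, eX⟩ := solve_uv hk1 hk2 hS1 hS2 hG1 hG2
  have hΔ : sh (a1 + b1 - (a2 + b2)) = sh (a1 - a2) * Real.cos ((b1 - b2) / 2)
      + Real.cos ((a1 - a2) / 2) * sh (b1 - b2) := by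
    unfold sh
    rw [show (a1 + b1 - (a2 + b2)) / 2 = (a1 - a2) / 2 + (b1 - b2) / 2 by ring, Real.sin_add]
  refine ⟨u, v, hu, hv, ?_, ?_, ?_⟩
  · have : W = Z * ex ((a2 + b1) / 2) := by
      rw [hZ, mul_assoc, ← ex_add, neg_add_cancel, ex_zero, mul_one]
    have w1 : 4 * W = ex (a1 + b1) + ex (a2 + b2) + 1 - tst θ g1 g2 := by rw [hW]; ring
    have w2 : tst θ g1 g2 = ex (a1 + b1) + ex (a2 + b2) + 1 - 4 * W := by rw [w1]; ring
    rw [w2, this, hZ', eX, eY]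
    have x1 : ex ((a2 + b2) / 2) = ex (-((b1 - b2) / 2)) * ex ((a2 + b1) / 2) := by
      rw [← ex_add]; congr 1; ring
    have x2 : ex ((a1 + b1) / 2) = ex ((a1 - a2) / 2) * ex ((a2 + b1) / 2) := by
      rw [← ex_add]; congr 1; ring
    rw [x1, x2, ex_eq (-((b1 - b2) / 2)), ex_eq ((a1 - a2) / 2), Real.cos_neg, Real.sin_neg]
    unfold sh
    push_cast
    ring
  · rw [f1, hΔ, eX, eY]; ring
  · rw [f2, hΔ, eX, eY]; ring

end

section
variable {ρ ε θ a1 a2 b1 b2 g1 g2 : ℝ}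

lemma fam23 (hs : Shift ρ ε) (hD : a1 + a2 + b1 + b2 + g1 + g2 = 3 * θ - 2 * ρ)
    (hb : b2 < b1) (hb1 : b1 - b2 < 2 * π)
    (hg2 : 0 < g2) (hg : g2 < g1) (hg1 : g1 < 2 * π) {p y : ℝ} (hp : 0 ≤ p) (hy : 0 ≤ y) (hy1 : y ≤ 1)
    (htr : tst θ g1 g2 = 1 + y * (ex (a2 + b1) + ex (a1 + b2)) + (1 - y) * (ex (a1 + b1) + ex (a2 + b2))
      - 4 * (p * sh a1 : ℝ) * (((1 - y) * sh b1 : ℝ) * ex ((a1 + b1) / 2) +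
          (y * sh b2 : ℝ) * ex ((a1 + b2) / 2)))
    (hK : (ε * (sh (θ - (a2 + b2)) * (sh θ * sh (θ - (a1 + b2)) - p * sh a1 * sh b2)) < 0) ∨
      (p = 0 ∧ θ = 2 * π)) :
    Hs ((a1, a2), (b1, b2), (g1, g2)) := by
  set c : ℂ := ((Real.sqrt (1 + p) : ℝ) : ℂ)
  set s : ℂ := ((Real.sqrt p : ℝ) : ℂ)
  set k : ℂ := ((Real.sqrt (1 - y) : ℝ) : ℂ)
  set l : ℂ := ((Real.sqrt y : ℝ) : ℂ)
  have h1 : c * c = 1 + (p : ℂ) := by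
    rw [← Complex.ofReal_mul, Real.mul_self_sqrt (by linarith)]; push_cast; rfl
  have h1' : s * s = (p : ℂ) := by
    rw [← Complex.ofReal_mul, Real.mul_self_sqrt (by linarith)]
  have h2 : k * k = 1 - (y : ℂ) := by
    rw [← Complex.ofReal_mul, Real.mul_self_sqrt (by linarith)]; push_cast; rfl
  have h2' : l * l = (y : ℂ) := by
    rw [← Complex.ofReal_mul, Real.mul_self_sqrt (by linarith)]
  have kc : star c = c := Complex.conj_ofReal _
  have ks : star s = s := Complex.conj_ofReal _
  have kC : star k = k := Complex.conj_ofReal _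
  have kS : star l = l := Complex.conj_ofReal _
  have hinv := F23_inv (c := c) (s := s) (k := k) (l := l) (by rw [h1, h1']) (by rw [h2, h2']; ring)
  have hU := memU21_of_inv (F23_star kc ks kC kS) hinv
  have hi : (F23 c s k l)⁻¹ = F23i c s k l := inv_eq_left_inv hinv
  have t1 : (Emat a1 a2 * (F23 c s k l * Emat b1 b2 * F23i c s k l)).trace = tst θ g1 g2 := by
    have e1 := ex_half a1 b1
    have e2 := ex_half a1 b2
    rw [F23_trace h1 h1' h2 h2', htr, ex_add a1 b1, ex_add a2 b2, ex_add a1 b2, ex_add a2 b1]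
    push_cast at e1 e2 ⊢
    linear_combination (p * (1 - y) : ℂ) * e1 + (p * y : ℂ) * e2
  have key : ∀ (w : Fin 3 → ℂ) , 0 < (hf w ((Emat a1 a2 * (F23 c s k l * Emat b1 b2 * F23i c s k l)) *ᵥ w)
        * ex (-(θ - (g1 + g2) / 2))).re - (hf w w).re * Real.cos ((g1 - g2) / 2) →
    Hs ((a1, a2), (b1, b2), (g1, g2)) := by
    intro w hw
    rw [← hi] at t1 hw
    exact finish hg2 hg hg1 _ hU (det_cond hs hD) t1 w hw
  have sb : 0 < sh (b1 - b2) := sh_pos (by linarith) hb1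
  rcases hK with hK | ⟨p0, h2π⟩
  · apply key ![c * k, -l, s * k]
    have hw : (![c * k, -l, s * k] : Fin 3 → ℂ) = F23 c s k l *ᵥ ![1, 0, 0] := by
      funext i
      fin_cases i <;> simp [F23, mulVec, dotProduct, Fin.sum_univ_three]
    rw [show hf ![c * k, -l, s * k] ![c * k, -l, s * k] = hf ![1, 0, 0] ![1, 0, 0] by rw [hw, hf_U hU],
      hf_e1, one_mul]
    have := Klem (τ := hf ![c * k, -l, s * k] ((Emat a1 a2 * (F23 c s k l * Emat b1 b2 * F23i c s k l)) *ᵥ ![c * k, -l, s * k]))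
      (θ := θ) (g1 := g1) (g2 := g2) (x := a2 + b2) (y := a1 + b2) (φ := b1 - b2) (c := p * sh a1 * sh b2) hs (by linarith) (by
        have e2 := ex_half a1 b2
        rw [F23_f1 kc ks kC kS h1 h1' h2 h2', ← t1, F23_trace h1 h1' h2 h2', ex_add a2 b2, ex_add a1 b2]
        have e3 : ex b1 * ex (-(b1 - b2)) = ex b2 := by rw [← ex_add]; congr 1; ring
        push_cast at e2 ⊢
        linear_combination (-(1 + p) * (1 - y) * ex a1 - y * ex a2 + p * (1 - y) : ℂ) * e3 + (-p : ℂ) * e2)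
    nlinarith
  · apply key ![0, 0, 1]
    rw [F23_e3 h1 h1' h2 h2', hf_e3, p0]
    convert e3_pos hg2 hg hg1 h2π using 4
    simp

lemma reg6 (hD : a1 + a2 + b1 + b2 + g1 + g2 = 3 * θ)
    (ha2 : 0 < a2) (ha : a2 < a1) (ha1 : a1 < 2 * π)
    (hb2 : 0 < b2) (hb : b2 < b1) (hb1 : b1 < 2 * π)
    (hg2 : 0 < g2) (hg : g2 < g1) (hg1 : g1 < 2 * π) (hθ : θ ≤ 2 * π)
    (h222 : a2 + b2 + g2 ≤ θ) (h111 : θ + 2 * π ≤ a1 + b1 + g1) (h221 : θ ≤ a2 + b2 + g1) :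
    Hs ((a1, a2), (b1, b2), (g1, g2)) := by
  have hD' : a1 + a2 + b1 + b2 + g1 + g2 = 3 * θ - 2 * 0 := by linarith
  have n1 : 0 ≤ sh (a2 + b2 + g1 - θ) := sh_nonneg (by linarith) (by linarith)
  have n2 : 0 ≤ sh (-(a2 + b2 + g2 - θ)) := sh_nonneg (by linarith) (by linarith)
  have n3 : 0 < sh (-(a2 + b2 - θ)) := sh_pos (by linarith) (by linarith)
  have m1 : 0 ≤ sh (a1 + b1 + g1 - θ - 2 * π) := sh_nonneg (by linarith) (by linarith)
  have m2 : 0 ≤ sh (a1 + b1 + g2 - θ) := sh_nonneg (by linarith) (by linarith)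
  have m3 : 0 < sh (a1 + b1 - θ) := sh_pos (by linarith) (by linarith)
  rw [sh_neg] at n2 n3
  rw [sh_sub] at m1
  obtain ⟨u, v, hu, hv, htr, -, -⟩ := solve12 (θ := θ) (g1 := g1) (g2 := g2) shift0 hD' ha2 ha ha1 hb2 hb hb1
    (by
      have := mul_nonneg (mul_nonneg n1 n2) n3.le
      linarith)
    (by
      have := mul_nonneg (mul_nonneg m1 m2) m3.le
      linarith)
  apply fam12 shift0 hD' ha2 ha ha1 hb2 hb hb1 hg2 hg hg1 hu hv htr
  have k1 : 0 < sh (θ - b2) := sh_pos (by linarith) (by linarith)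
  have k2 : sh (θ - (a1 + b1)) < 0 := by
    rw [show θ - (a1 + b1) = -(a1 + b1 - θ) by ring, sh_neg]; linarith
  have sa1 : 0 < sh a1 := sh_pos (by linarith) ha1
  have sb2 : 0 < sh b2 := sh_pos (by linarith) (by linarith)
  rcases hθ.lt_or_eq with hlt | heq
  · left
    have k3 : 0 < sh θ := sh_pos (by linarith) hlt
    have := mul_neg_of_pos_of_neg k3 k2
    have h4 := mul_nonneg hu sa1.le
    rw [one_mul]
    exact mul_neg_of_pos_of_neg k1 (by linarith)
  · have k3 : sh θ = 0 := by rw [heq]; unfold sh; simp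
    rcases hu.lt_or_eq with hu | hu
    · left
      rw [one_mul, k3, zero_mul]
      exact mul_neg_of_pos_of_neg k1 (by linarith [mul_pos hu sa1])
    rcases hv.lt_or_eq with hv | hv
    · right; left
      rw [one_mul, k3, zero_mul]
      have : 0 < sh (θ - a1) := sh_pos (by linarith) (by linarith)
      exact mul_neg_of_pos_of_neg this (by linarith [mul_pos hv sb2])
    · right; right; exact ⟨hu.symm, hv.symm, heq⟩

lemma reg4a (hD : a1 + a2 + b1 + b2 + g1 + g2 = 3 * θ - 2 * π)
    (ha2 : 0 < a2) (ha : a2 < a1) (ha1 : a1 < 2 * π)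
    (hb2 : 0 < b2) (hb : b2 < b1) (hb1 : b1 < 2 * π)
    (hg2 : 0 < g2) (hg : g2 < g1) (hg1 : g1 < 2 * π) (hθ : θ ≤ 2 * π)
    (h221 : a2 + b2 + g1 ≤ θ)
    (h111 : θ ≤ a1 + b1 + g1) (h112 : a1 + b1 + g2 ≤ θ) :
    Hs ((a1, a2), (b1, b2), (g1, g2)) := by
  have n1 : 0 ≤ sh (-(a2 + b2 + g1 - θ)) := sh_nonneg (by linarith) (by linarith)
  have n2 : 0 < sh (-(a2 + b2 + g2 - θ)) := sh_pos (by linarith) (by linarith)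
  have n3 : 0 < sh (-(a2 + b2 - θ)) := sh_pos (by linarith) (by linarith)
  have m1 : 0 ≤ sh (a1 + b1 + g1 - θ) := sh_nonneg (by linarith) (by linarith)
  have m2 : 0 ≤ sh (-(a1 + b1 + g2 - θ)) := sh_nonneg (by linarith) (by linarith)
  have m3 : 0 < sh (-(a1 + b1 - θ)) := sh_pos (by linarith) (by linarith)
  rw [sh_neg] at n1 n2 n3 m2 m3
  obtain ⟨u, v, hu, hv, htr, e1, e2⟩ := solve12 (θ := θ) (g1 := g1) (g2 := g2) shift1 hD ha2 ha ha1 hb2 hb hb1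
    (by
      have := mul_nonneg (mul_nonneg n1 n2.le) n3.le
      linarith)
    (by
      have := mul_nonneg (mul_nonneg m1 m2) m3.le
      linarith)
  have hΔ : 0 < sh (a1 + b1 - (a2 + b2)) := sh_pos (by linarith) (by linarith)
  have sa1 : 0 < sh a1 := sh_pos (by linarith) ha1
  have sb2 : 0 < sh b2 := sh_pos (by linarith) (by linarith)
  have sa : 0 < sh (a1 - a2) := sh_pos (by linarith) (by linarith)
  have sb : 0 < sh (b1 - b2) := sh_pos (by linarith) (by linarith)
  have z0 : sh 0 = 0 := by unfold sh; simp
  have hv0 : a2 + b2 + g1 = θ → v = 0 := by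
    intro h
    rw [h, sub_self, z0] at e1
    have : 0 < sh b2 * sh (a1 + b1 - (a2 + b2)) + u * sh (a1 - a2) := by positivity
    have h3 : v * (sh b2 * sh (a1 + b1 - (a2 + b2)) + u * sh (a1 - a2)) = 0 := by rw [← e1]; ring
    rcases mul_eq_zero.mp h3 with h | h
    · exact h
    · exact absurd h this.ne'
  have hu0 : a1 + b1 + g2 = θ → u = 0 := by
    intro h
    rw [h, sub_self, z0] at e2
    have : 0 < sh a1 * sh (a1 + b1 - (a2 + b2)) + v * sh (b1 - b2) := by positivity
    have h3 : u * (sh a1 * sh (a1 + b1 - (a2 + b2)) + v * sh (b1 - b2)) = 0 := by rw [← e2]; ring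
    rcases mul_eq_zero.mp h3 with h | h
    · exact h
    · exact absurd h this.ne'
  apply fam12 shift1 hD ha2 ha ha1 hb2 hb hb1 hg2 hg hg1 hu hv htr
  rcases hθ.lt_or_eq with hlt | heq
  · have k3 : 0 < sh θ := sh_pos (by linarith) hlt
    rcases h221.lt_or_eq with h | h
    · left
      have k1 : 0 < sh (θ - b2) := sh_pos (by linarith) (by linarith)
      suffices u * sh a1 < sh θ * sh (θ - (a1 + b1)) by
        have := mul_pos k1 (sub_pos.mpr this); linarith
      have e4 := two_sin (a1 + b1 + g1 - θ) (a1 + b1 + g2 - θ) (a1 + b1 - (a2 + b2)) (θ - 2 * π) (by linarith)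
      rw [sh_sub, show a1 + b1 - (a2 + b2) - (a1 + b1 + g1 - θ) = θ - (a2 + b2 + g1) by ring,
        show a1 + b1 + g1 - θ - (θ - 2 * π) = θ - (a2 + b2 + g2) by linarith] at e4
      have q1 : 0 < sh (θ - (a2 + b2 + g1)) := sh_pos (by linarith) (by linarith)
      have q2 : 0 < sh (θ - (a2 + b2 + g2)) := sh_pos (by linarith) (by linarith)
      have q3 := mul_pos q1 q2
      have q4 : sh (θ - (a1 + b1)) = - sh (a1 + b1 - θ) := by rw [← sh_neg]; congr 1; ring
      have q5 : 0 < sh (θ - (a1 + b1)) := by linarith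
      have q6 : u * sh a1 * sh (a1 + b1 - (a2 + b2)) ≤
          (sh (a1 + b1 + g1 - θ) * (-sh (a1 + b1 + g2 - θ))) * sh (θ - (a1 + b1)) := by
        rw [q4]
        have : 0 ≤ u * (v * sh (b1 - b2)) := by positivity
        linarith
      have q7 : (sh (a1 + b1 + g1 - θ) * (-sh (a1 + b1 + g2 - θ))) * sh (θ - (a1 + b1))
          < (sh (a1 + b1 - (a2 + b2)) * sh θ) * sh (θ - (a1 + b1)) :=
        mul_lt_mul_of_pos_right (by linarith) q5
      have q8 : u * sh a1 * sh (a1 + b1 - (a2 + b2)) <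
        (sh θ * sh (θ - (a1 + b1))) * sh (a1 + b1 - (a2 + b2)) := by linarith
      exact lt_of_mul_lt_mul_right q8 hΔ.le
    · right; left
      rw [hv0 h, zero_mul, sub_zero]
      have k1 : 0 < sh (θ - a1) := sh_pos (by linarith) (by linarith)
      have k2 : 0 < sh (θ - (a2 + b2)) := sh_pos (by linarith) (by linarith)
      have := mul_pos k1 (mul_pos k3 k2)
      linarith
  · right; right
    exact ⟨hu0 (by linarith), hv0 (by linarith), heq⟩

lemma reg4b (hD : a1 + a2 + b1 + b2 + g1 + g2 = 3 * θ - 2 * π)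
    (ha2 : 0 < a2) (ha : a2 < a1) (ha1 : a1 < 2 * π)
    (hb2 : 0 < b2) (hb : b2 < b1) (hb1 : b1 < 2 * π)
    (hg2 : 0 < g2) (hg : g2 < g1) (hg1 : g1 < 2 * π) (hθ : θ ≤ 2 * π)
    (h211 : θ < a2 + b1 + g1) (h121 : θ < a1 + b2 + g1) (h112 : θ < a1 + b1 + g2) :
    Hs ((a1, a2), (b1, b2), (g1, g2)) := by
  have sa1 : 0 < sh a1 := sh_pos (by linarith) ha1
  have sa2 : 0 < sh a2 := sh_pos (by linarith) (by linarith)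
  have sb2 : 0 < sh b2 := sh_pos (by linarith) (by linarith)
  have sb1 : 0 < sh b1 := sh_pos (by linarith) (by linarith)
  have sb : 0 < sh (b1 - b2) := sh_pos (by linarith) (by linarith)
  have ss2 : 0 < sh (a2 + b2) := sh_pos (by linarith) (by linarith)
  have ss3 : 0 < sh (a2 + b1) := sh_pos (by linarith) (by linarith)
  set D : ℝ := a1 + a2 + b1 + b2 with hDdef
  set Z : ℂ := (tst θ g1 g2 - 1) * ex (-(D / 2)) with hZ
  have hZ' : Z = (Z.re : ℂ) + Z.im * Complex.I := (Complex.re_add_im Z).symm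
  have hZt : tst θ g1 g2 = 1 + Z * ex (D / 2) := by
    rw [hZ, mul_assoc, ← ex_add, neg_add_cancel, ex_zero]; ring
  -- imaginary part
  have hY : Z.im = 4 * (sh (θ - g1) * sh (θ - g2) * sh θ) := by
    have i1 := corner (θ := θ) (x1 := D) (x2 := 0) (g1 := g1) (g2 := g2) shift1 (by linarith)
    have e1 : (tst θ g1 g2 - (ex D + ex 0 + 1)) * ex (-(D / 2)) = Z - ((2 * Real.cos (D / 2) : ℝ) : ℂ) := by
      rw [← ex_add_neg, hZ, ex_zero]
      have : ex D * ex (-(D / 2)) = ex (D / 2) := by rw [← ex_add]; congr 1; ring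
      linear_combination -this
    rw [e1, Complex.sub_im, Complex.ofReal_im, sub_zero] at i1
    rw [i1, show (0 + g1 - θ) = -(θ - g1) by ring, show (0 + g2 - θ) = -(θ - g2) by ring,
      show (0 - θ) = -θ by ring, sh_neg, sh_neg, sh_neg]
    ring
  have hY0 : 0 ≤ Z.im := by
    rw [hY]
    have := sh_nonneg (x := θ - g1) (by linarith) (by linarith)
    have := sh_nonneg (x := θ - g2) (by linarith) (by linarith)
    have := sh_nonneg (x := θ) (by linarith) (by linarith)
    positivity
  let L : ℝ → ℝ := fun y => (1 - y) * sh b1 * sh (a2 + b2) + y * sh b2 * sh (a2 + b1)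
  let Cc : ℝ → ℝ := fun y => (1 - y) * sh b1 * Real.cos ((a2 + b2) / 2) + y * sh b2 * Real.cos ((a2 + b1) / 2)
  let f : ℝ → ℝ := fun y => 2 * (y * Real.cos ((a1 + b2 - (a2 + b1)) / 2) +
    (1 - y) * Real.cos ((a1 + b1 - (a2 + b2)) / 2)) - Z.im * Cc y / L y - Z.re
  have hdiff : sh b1 * sh (a2 + b2) - sh b2 * sh (a2 + b1) = sh (b1 - b2) * sh a2 := by
    rw [two_sin b1 (a2 + b2) b2 (a2 + b1) (by ring), show b2 - b1 = -(b1 - b2) by ring,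
      show b1 - (a2 + b1) = -a2 by ring, sh_neg, sh_neg]; ring
  have hL0 : ∀ y, y ≤ 1 → sh b2 * sh (a2 + b1) ≤ L y := by
    intro y hy
    have h3 : L y = sh b2 * sh (a2 + b1) + (1 - y) * (sh (b1 - b2) * sh a2) := by
      rw [← hdiff]; show _ + _ = _; ring
    have : 0 ≤ (1 - y) * (sh (b1 - b2) * sh a2) := mul_nonneg (by linarith) (by positivity)
    linarith
  have hLp : ∀ y, y ≤ 1 → 0 < L y := fun y hy => lt_of_lt_of_le (by positivity) (hL0 y hy)
  have hcont : ContinuousOn f (Icc 0 1) := by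
    have c1 : Continuous L := by fun_prop
    have c2 : Continuous Cc := by fun_prop
    apply ContinuousOn.sub _ continuousOn_const
    apply ContinuousOn.sub
    · fun_prop
    · apply ContinuousOn.div
      · fun_prop
      · exact c1.continuousOn
      · intro y hy; exact (hLp y hy.2).ne'
  have corn : ∀ x1 x2 : ℝ, x1 + x2 = D → 2 * Real.cos ((x1 - x2) / 2) * sh x2 - Z.im * Real.cos (x2 / 2) - Z.re * sh x2
      = 4 * (sh (x2 + g1 - θ) * sh (x2 + g2 - θ) * sh (x2 - θ)) := by
    intro x1 x2 hx
    have i1 := corner (θ := θ) (x1 := x1) (x2 := x2) (g1 := g1) (g2 := g2) shift1 (by linarith)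
    have e1 : (tst θ g1 g2 - (ex x1 + ex x2 + 1)) * ex (-(x1 / 2)) =
        Z * ex (x2 / 2) - ((2 * Real.cos ((x1 - x2) / 2) : ℝ) : ℂ) * ex (x2 / 2) := by
      have q1 : ex (D / 2) * ex (-(x1 / 2)) = ex (x2 / 2) := by rw [← ex_add, ← hx]; congr 1; ring
      have q2 : ex x1 * ex (-(x1 / 2)) = ex ((x1 - x2) / 2) * ex (x2 / 2) := by
        rw [← ex_add, ← ex_add]; congr 1; ring
      have q3 : ex x2 * ex (-(x1 / 2)) = ex (-((x1 - x2) / 2)) * ex (x2 / 2) := by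
        rw [← ex_add, ← ex_add]; congr 1; ring
      rw [hZt, ← ex_add_neg]
      linear_combination Z * q1 - q2 - q3
    rw [e1, Complex.sub_im, Complex.im_ofReal_mul, hZ', im_mul_ex, ex_im] at i1
    unfold sh at i1 ⊢
    linarith
  have f0 : f 0 ≤ 0 := by
    have h1 := corn (a1 + b1) (a2 + b2) (by rw [hDdef]; ring)
    have n1 : 0 ≤ sh (-(a2 + b2 + g1 - θ)) := sh_nonneg (by linarith) (by linarith)
    have n2 : 0 ≤ sh (-(a2 + b2 + g2 - θ)) := sh_nonneg (by linarith) (by linarith)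
    have n3 : 0 ≤ sh (-(a2 + b2 - θ)) := sh_nonneg (by linarith) (by linarith)
    rw [sh_neg] at n1 n2 n3
    have n4 := mul_nonneg (mul_nonneg n1 n2) n3
    have h2 : f 0 * sh (a2 + b2) = 2 * Real.cos ((a1 + b1 - (a2 + b2)) / 2) * sh (a2 + b2)
        - Z.im * Real.cos ((a2 + b2) / 2) - Z.re * sh (a2 + b2) := by
      simp only [f, L, Cc]
      field_simp
      ring
    rw [h1] at h2
    by_contra hc
    push Not at hc
    have := mul_pos hc ss2
    linarith
  have f1 : 0 ≤ f 1 := by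
    have h1 := corn (a1 + b2) (a2 + b1) (by rw [hDdef]; ring)
    have n1 : 0 ≤ sh (a2 + b1 + g1 - θ) := sh_nonneg (by linarith) (by linarith)
    have n2 : 0 ≤ sh (-(a2 + b1 + g2 - θ)) := sh_nonneg (by linarith) (by linarith)
    have n3 : 0 ≤ sh (-(a2 + b1 - θ)) := sh_nonneg (by linarith) (by linarith)
    rw [sh_neg] at n2 n3
    have n4 := mul_nonneg (mul_nonneg n1 n2) n3
    have h2 : f 1 * sh (a2 + b1) = 2 * Real.cos ((a1 + b2 - (a2 + b1)) / 2) * sh (a2 + b1)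
        - Z.im * Real.cos ((a2 + b1) / 2) - Z.re * sh (a2 + b1) := by
      simp only [f, L, Cc]
      field_simp
      ring
    rw [h1] at h2
    by_contra hc
    push Not at hc
    have := mul_neg_of_neg_of_pos hc ss3
    linarith
  obtain ⟨y, ⟨hy0, hy1⟩, hfy⟩ := intermediate_value_Icc (zero_le_one) hcont ⟨f0, f1⟩
  have hLy := hLp y hy1
  have hsb := hL0 y hy1
  set p : ℝ := Z.im / (4 * sh a1 * L y) with hp
  have hp0 : 0 ≤ p := by positivity
  have hpL : 4 * (p * sh a1) * L y = Z.im := by rw [hp]; field_simp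
  have hre : Z.re = 2 * (y * Real.cos ((a1 + b2 - (a2 + b1)) / 2) +
    (1 - y) * Real.cos ((a1 + b1 - (a2 + b2)) / 2)) - 4 * (p * sh a1) * Cc y := by
    have : 4 * (p * sh a1) * Cc y = Z.im * Cc y / L y := by rw [hp]; field_simp
    rw [this]
    simp only [f] at hfy
    linarith
  apply fam23 (θ := θ) shift1 (by linarith) hb (by linarith) hg2 hg hg1 hp0 hy0 hy1
  · rw [hZt, hZ', hre, ← hpL]
    have q1 : ex (a2 + b1) = ex (-((a1 + b2 - (a2 + b1)) / 2)) * ex (D / 2) := by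
      rw [← ex_add, hDdef]; congr 1; ring
    have q2 : ex (a1 + b2) = ex (((a1 + b2 - (a2 + b1)) / 2)) * ex (D / 2) := by
      rw [← ex_add, hDdef]; congr 1; ring
    have q3 : ex (a2 + b2) = ex (-((a1 + b1 - (a2 + b2)) / 2)) * ex (D / 2) := by
      rw [← ex_add, hDdef]; congr 1; ring
    have q4 : ex (a1 + b1) = ex (((a1 + b1 - (a2 + b2)) / 2)) * ex (D / 2) := by
      rw [← ex_add, hDdef]; congr 1; ring
    have q5 : ex ((a1 + b1) / 2) = ex (-((a2 + b2) / 2)) * ex (D / 2) := by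
      rw [← ex_add, hDdef]; congr 1; ring
    have q6 : ex ((a1 + b2) / 2) = ex (-((a2 + b1) / 2)) * ex (D / 2) := by
      rw [← ex_add, hDdef]; congr 1; ring
    have r1 := ex_add_neg ((a1 + b2 - (a2 + b1)) / 2)
    have r2 := ex_add_neg ((a1 + b1 - (a2 + b2)) / 2)
    have r3 := ex_eq (-((a2 + b2) / 2))
    have r4 := ex_eq (-((a2 + b1) / 2))
    rw [Real.cos_neg, Real.sin_neg] at r3 r4
    rw [q1, q2, q3, q4, q5, q6, r3, r4]
    simp only [L, Cc]
    unfold sh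
    push_cast at r1 r2 ⊢
    linear_combination (-y * ex (D / 2)) * r1 - ((1 - y) * ex (D / 2)) * r2
  · rcases hθ.lt_or_eq with hlt | heq
    · left
      have k3 : 0 < sh θ := sh_pos (by linarith) hlt
      have k1 : 0 < sh (θ - (a2 + b2)) := sh_pos (by linarith) (by linarith)
      suffices p * sh a1 * sh b2 < sh θ * sh (θ - (a1 + b2)) by
        have := mul_pos k1 (sub_pos.mpr this); linarith
      have t := two_sin (θ - g1) (θ - g2) (a2 + b1) (a1 + b2 - θ + 2 * π) (by linarith)
      rw [sh_add, show a1 + b2 - θ = -(θ - (a1 + b2)) by ring, sh_neg,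
        show a2 + b1 - (θ - g1) = a2 + b1 + g1 - θ by ring,
        show θ - g1 - (-(θ - (a1 + b2)) + 2 * π) = -(θ - (a2 + b1 + g2)) by linarith, sh_neg] at t
      have q1 : 0 < sh (a2 + b1 + g1 - θ) := sh_pos (by linarith) (by linarith)
      have q2 : 0 < sh (θ - (a2 + b1 + g2)) := sh_pos (by linarith) (by linarith)
      have q3 := mul_pos q1 q2
      have q4 : p * sh a1 * sh b2 * L y = (sh (θ - g1) * sh (θ - g2)) * (sh θ * sh b2) := by
        have : p * sh a1 * sh b2 * L y = sh b2 * (4 * (p * sh a1) * L y) / 4 := by ring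
        rw [this, hpL, hY]; ring
      have q5 : (sh (θ - g1) * sh (θ - g2)) * (sh θ * sh b2)
          < (sh (a2 + b1) * sh (θ - (a1 + b2))) * (sh θ * sh b2) :=
        mul_lt_mul_of_pos_right (by linarith) (by positivity)
      have q6 : 0 ≤ sh θ * sh (θ - (a1 + b2)) :=
        mul_nonneg k3.le (sh_nonneg (by linarith) (by linarith))
      have q7 := mul_le_mul_of_nonneg_left hsb q6
      have q8 : p * sh a1 * sh b2 * L y < sh θ * sh (θ - (a1 + b2)) * L y := by linarith
      exact lt_of_mul_lt_mul_right q8 hLy.le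
    · right
      have k3 : sh θ = 0 := by rw [heq]; unfold sh; simp
      refine ⟨?_, heq⟩
      rw [hp, hY, k3]; simp

end

set_option linter.unusedSimpArgs false

lemma Hs_cyc {p q r : Pt} (h : Hs (p, q, r)) : Hs (q, r, p) := by
  obtain ⟨A, B, C, hA, hB, hC, eA, eB, eC, lam, e⟩ := h
  refine ⟨B, C, A, hB, hC, hA, eB, eC, eA, lam, ?_⟩
  have h1 : A⁻¹ * A = 1 := nonsing_inv_mul _ (memU21_isUnit hA)
  calc B * C * A = A⁻¹ * A * (B * C * A) := by rw [h1, Matrix.one_mul]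
    _ = A⁻¹ * (A * B * C) * A := by simp only [Matrix.mul_assoc]
    _ = lam • 1 := by rw [e, Matrix.mul_smul, Matrix.smul_mul, Matrix.mul_one, h1]

/-- entrywise conjugation -/
def cj (M : M3) : M3 := M.map (starRingEnd ℂ)

lemma cj_mul (M N : M3) : cj (M * N) = cj M * cj N := Matrix.map_mul
lemma cj_one : cj 1 = 1 := by unfold cj; exact Matrix.map_one _ (map_zero _) (map_one _)
lemma cj_star (M : M3) : cj Mᴴ = (cj M)ᴴ := by ext i j; simp [cj]
lemma cj_J : cj J3 = J3 := by
  unfold cj J3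
  rw [Matrix.diagonal_map (map_zero _)]
  congr 1
  funext i
  fin_cases i <;> simp

lemma cj_U {P : M3} (h : memU21 P) : memU21 (cj P) := by
  have h1 : Pᴴ * J3 * P = J3 := h
  show (cj P)ᴴ * J3 * cj P = J3
  rw [← cj_star, ← cj_J, ← cj_mul, ← cj_mul, h1]

lemma cj_inv {P : M3} (h : memU21 P) : cj P⁻¹ = (cj P)⁻¹ := by
  symm
  apply inv_eq_left_inv
  rw [← cj_mul, nonsing_inv_mul _ (memU21_isUnit h), cj_one]

def swp : M3 := !![0, 1, 0; 1, 0, 0; 0, 0, 1]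

lemma swp_sq : swp * swp = 1 := by
  unfold swp
  ext i j
  fin_cases i <;> fin_cases j <;> simp

lemma swp_U : memU21 swp := by
  show swpᴴ * J3 * swp = J3
  unfold swp J3
  ext i j
  fin_cases i <;> fin_cases j <;> simp [Matrix.mul_apply, Fin.sum_univ_three, Matrix.diagonal, Matrix.vecHead, Matrix.vecTail]

lemma swp_E (a b : ℝ) : swp * Emat a b * swp = Emat b a := by
  rw [Emat_ex, Emat_ex]
  unfold swp
  ext i j
  fin_cases i <;> fin_cases j <;> simp [Matrix.mul_apply, Fin.sum_univ_three, Matrix.diagonal, Matrix.vecHead, Matrix.vecTail]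

lemma cj_E (a b : ℝ) : cj (Emat a b) = Emat (2 * π - a) (2 * π - b) := by
  have h : ∀ x, ex (2 * π - x) = ex (-x) := by
    intro x
    rw [sub_eq_add_neg, ex_add, shift1.e, one_mul]
  rw [Emat_ex, Emat_ex, h, h]
  unfold cj
  rw [Matrix.diagonal_map (map_zero _)]
  congr 1
  funext i
  fin_cases i
  · exact ex_conj a
  · exact ex_conj b
  · simp

lemma cj_ell {M : M3} {a b : ℝ} (h : ellType M a b) : ellType (cj M) (2 * π - b) (2 * π - a) := by
  obtain ⟨P, hP, rfl⟩ := h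
  refine ⟨cj P * swp, memU21_mul (cj_U hP) swp_U, ?_⟩
  rw [cj_mul, cj_mul, cj_E, cj_inv hP, Matrix.mul_inv_rev, inv_eq_left_inv swp_sq, ← swp_E]
  simp only [Matrix.mul_assoc]

/-- the conjugate pair -/
def cjp (p : Pt) : Pt := (2 * π - p.2, 2 * π - p.1)

lemma cjp_cjp (p : Pt) : cjp (cjp p) = p := by
  unfold cjp
  ext <;> simp

lemma Hs_cj {p q r : Pt} (h : Hs (cjp p, cjp q, cjp r)) : Hs (p, q, r) := by
  obtain ⟨A, B, C, hA, hB, hC, eA, eB, eC, lam, e⟩ := h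
  have eA' := cj_ell eA
  have eB' := cj_ell eB
  have eC' := cj_ell eC
  simp only [cjp, sub_sub_cancel] at eA' eB' eC'
  refine ⟨cj A, cj B, cj C, cj_U hA, cj_U hB, cj_U hC, eA', eB', eC', star lam, ?_⟩
  rw [← cj_mul, ← cj_mul, e]
  unfold cj
  ext i j
  simp [Matrix.one_apply]
  split_ifs <;> simp

section
variable {θ a1 a2 b1 b2 g1 g2 : ℝ}

lemma core6 (hD : a1 + a2 + b1 + b2 + g1 + g2 = 3 * θ)
    (ha2 : 0 < a2) (ha : a2 < a1) (ha1 : a1 < 2 * π)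
    (hb2 : 0 < b2) (hb : b2 < b1) (hb1 : b1 < 2 * π)
    (hg2 : 0 < g2) (hg : g2 < g1) (hg1 : g1 < 2 * π) (hθ : θ ≤ 2 * π)
    (h222 : a2 + b2 + g2 ≤ θ) (h111 : θ + 2 * π ≤ a1 + b1 + g1) :
    Hs ((a1, a2), (b1, b2), (g1, g2)) := by
  rcases le_total θ (a2 + b2 + g1) with h | h
  · exact reg6 hD ha2 ha ha1 hb2 hb hb1 hg2 hg hg1 hθ h222 h111 h
  rcases le_total θ (a2 + b1 + g2) with h' | h'
  · exact Hs_cyc (reg6 (by linarith) hg2 hg hg1 ha2 ha ha1 hb2 hb hb1 hθ (by linarith) (by linarith)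
      (by linarith))
  · exact Hs_cyc (Hs_cyc (reg6 (by linarith) hb2 hb hb1 hg2 hg hg1 ha2 ha ha1 hθ (by linarith) (by linarith)
      (by linarith)))

lemma full6 (hD : a1 + a2 + b1 + b2 + g1 + g2 = 3 * θ)
    (ha2 : 0 < a2) (ha : a2 < a1) (ha1 : a1 < 2 * π)
    (hb2 : 0 < b2) (hb : b2 < b1) (hb1 : b1 < 2 * π)
    (hg2 : 0 < g2) (hg : g2 < g1) (hg1 : g1 < 2 * π)
    (h222 : a2 + b2 + g2 ≤ θ) (h111 : θ + 2 * π ≤ a1 + b1 + g1) :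
    Hs ((a1, a2), (b1, b2), (g1, g2)) := by
  rcases le_total θ (2 * π) with h | h
  · exact core6 hD ha2 ha ha1 hb2 hb hb1 hg2 hg hg1 h h222 h111
  · apply Hs_cj
    exact core6 (θ := 4 * π - θ) (by simp only; linarith) (by linarith) (by simp only; linarith) (by linarith)
      (by linarith) (by simp only; linarith) (by linarith) (by linarith) (by simp only; linarith) (by linarith)
      (by linarith) (by simp only; linarith) (by simp only; linarith)

lemma full4 (hD : a1 + a2 + b1 + b2 + g1 + g2 = 3 * θ - 2 * π)
    (ha2 : 0 < a2) (ha : a2 < a1) (ha1 : a1 < 2 * π)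
    (hb2 : 0 < b2) (hb : b2 < b1) (hb1 : b1 < 2 * π)
    (hg2 : 0 < g2) (hg : g2 < g1) (hg1 : g1 < 2 * π) (hθ : θ ≤ 2 * π)
    (h122 : a1 + b2 + g2 ≤ θ) (h212 : a2 + b1 + g2 ≤ θ) (h221 : a2 + b2 + g1 ≤ θ)
    (h111 : θ ≤ a1 + b1 + g1) :
    Hs ((a1, a2), (b1, b2), (g1, g2)) := by
  rcases le_or_gt (a1 + b1 + g2) θ with h | h
  · exact reg4a hD ha2 ha ha1 hb2 hb hb1 hg2 hg hg1 hθ h221 h111 h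
  rcases le_or_gt (a1 + b2 + g1) θ with h' | h'
  · exact Hs_cyc (reg4a (by linarith) hg2 hg hg1 ha2 ha ha1 hb2 hb hb1 hθ (by linarith) (by linarith)
      (by linarith))
  rcases le_or_gt (a2 + b1 + g1) θ with h'' | h''
  · exact Hs_cyc (Hs_cyc (reg4a (by linarith) hb2 hb hb1 hg2 hg hg1 ha2 ha ha1 hθ (by linarith) (by linarith)
      (by linarith)))
  · exact reg4b hD ha2 ha ha1 hb2 hb hb1 hg2 hg hg1 hθ h'' h' h

lemma full8 (hD : a1 + a2 + b1 + b2 + g1 + g2 = 3 * θ - 4 * π)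
    (ha2 : 0 < a2) (ha : a2 < a1) (ha1 : a1 < 2 * π)
    (hb2 : 0 < b2) (hb : b2 < b1) (hb1 : b1 < 2 * π)
    (hg2 : 0 < g2) (hg : g2 < g1) (hg1 : g1 < 2 * π) (hθ : 4 * π ≤ θ)
    (h211 : θ ≤ a2 + b1 + g1) (h121 : θ ≤ a1 + b2 + g1) (h112 : θ ≤ a1 + b1 + g2)
    (h222 : a2 + b2 + g2 ≤ θ) :
    Hs ((a1, a2), (b1, b2), (g1, g2)) := by
  apply Hs_cj
  exact full4 (θ := 6 * π - θ) (by simp only; linarith) (by linarith) (by simp only; linarith) (by linarith)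
      (by linarith) (by simp only; linarith) (by linarith) (by linarith) (by simp only; linarith) (by linarith)
      (by linarith) (by simp only; linarith) (by simp only; linarith) (by simp only; linarith)
      (by simp only; linarith)
end

lemma HornSol_iff (τ : Tri) : τ ∈ HornSol ↔ memT3 τ ∧ Hs τ := Iff.rfl

lemma memTo_memT {p : Pt} (h : memTo p) : memT p := by
  obtain ⟨h1, h2, h3⟩ := h
  exact ⟨by linarith, h3, h1.le, by linarith, h2.le⟩

lemma suff {τ : Tri} (ho : memTo3 τ) (h : τ ∈ P4cl ∪ P6cl ∪ P8cl) : Hs τ := by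
  obtain ⟨⟨a1, a2⟩, ⟨b1, b2⟩, ⟨g1, g2⟩⟩ := τ
  obtain ⟨⟨ha2, ha, ha1⟩, ⟨hb2, hb, hb1⟩, ⟨hg2, hg, hg1⟩⟩ := ho
  simp only at ha2 ha ha1 hb2 hb hb1 hg2 hg hg1
  have hS : a1 + a2 + b1 + b2 + g1 + g2 = 3 * ((a1 + a2 + b1 + b2 + g1 + g2) / 3) := by ring
  rcases h with (⟨-, h⟩ | ⟨-, h⟩) | ⟨-, h⟩
  · rcases h with h | h
    · simp [Hf, sg, coord] at h
      exact full6 hS ha2 ha ha1 hb2 hb hb1 hg2 hg hg1 (by linarith) (by linarith)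
    · simp [Hf, Sf, sg, coord] at h
      obtain ⟨h0, h1, h2, h3, h4⟩ := h
      exact full4 (θ := (a1 + a2 + b1 + b2 + g1 + g2 + 2 * π) / 3) (by ring)
        ha2 ha ha1 hb2 hb hb1 hg2 hg hg1 (by linarith) (by linarith) (by linarith) (by linarith)
        (by linarith)
  · simp [Hf, sg, coord] at h
    exact full6 hS ha2 ha ha1 hb2 hb hb1 hg2 hg hg1 (by linarith) (by linarith)
  · rcases h with h | h
    · simp [Hf, sg, coord] at h
      exact full6 hS ha2 ha ha1 hb2 hb hb1 hg2 hg hg1 (by linarith) (by linarith)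
    · simp [Hf, Sf, sg, coord] at h
      obtain ⟨h0, h1, h2, h3, h4⟩ := h
      exact full8 (θ := (a1 + a2 + b1 + b2 + g1 + g2 + 4 * π) / 3) (by ring)
        ha2 ha ha1 hb2 hb hb1 hg2 hg hg1 (by linarith) (by linarith) (by linarith) (by linarith)
        (by linarith)

set_option linter.unusedSimpArgs false
set_option linter.unusedSectionVars false

section inertia
variable {ι : Type} [Fintype ι] [DecidableEq ι]

/-- number of positive entries -/
def cnt (d : ι → ℝ) : ℤ := ∑ i, if 0 < d i then 1 else 0

lemma cnt_card (d : ι → ℝ) : cnt d = (Fintype.card {i // 0 < d i} : ℤ) := by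
  unfold cnt
  rw [Fintype.card_subtype, Finset.sum_boole]

/-- complex diagonal matrix of a real vector -/
def rd (d : ι → ℝ) : Matrix ι ι ℂ := Matrix.diagonal (fun i => ((d i : ℝ) : ℂ))

lemma quad_form (W : Matrix ι ι ℂ) (d : ι → ℝ) (v : ι → ℂ) :
    star v ⬝ᵥ ((Wᴴ * rd d * W) *ᵥ v) = ((∑ i, d i * ‖(W *ᵥ v) i‖ ^ 2 : ℝ) : ℂ) := by
  rw [← mulVec_mulVec, ← mulVec_mulVec, dotProduct_mulVec, ← star_mulVec]
  unfold rd
  simp only [mulVec_diagonal, dotProduct, Pi.star_apply]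
  push_cast
  apply Finset.sum_congr rfl
  intro i _
  have : (‖(W *ᵥ v) i‖ : ℂ) ^ 2 = star ((W *ᵥ v) i) * (W *ᵥ v) i := by
    rw [Complex.star_def, Complex.conj_mul']
  rw [this]; ring

lemma inertia_le {W V : Matrix ι ι ℂ} {d e : ι → ℝ} (hW : IsUnit W.det)
    (h : Wᴴ * rd d * W = Vᴴ * rd e * V) :
    Fintype.card {i // 0 < d i} ≤ Fintype.card {i // 0 < e i} := by
  by_contra hc
  push Not at hc
  let L : ({i // 0 < d i} → ℂ) →ₗ[ℂ] ({i // 0 < e i} → ℂ) :=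
    (LinearMap.funLeft ℂ ℂ Subtype.val) ∘ₗ (V * W⁻¹).mulVecLin ∘ₗ
      (Function.ExtendByZero.linearMap ℂ Subtype.val)
  have hk : LinearMap.ker L ≠ ⊥ := LinearMap.ker_ne_bot_of_finrank_lt (by simpa using hc)
  obtain ⟨c, hcL, hc0⟩ := Submodule.exists_mem_ne_zero_of_ne_bot hk
  set w : ι → ℂ := Function.extend Subtype.val c 0 with hw
  have hLc : ∀ j : {i // 0 < e i}, ((V * W⁻¹) *ᵥ w) j = 0 := by
    intro j
    have := congrFun (LinearMap.mem_ker.mp hcL) j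
    exact this
  set v := W⁻¹ *ᵥ w with hv
  have hWv : W *ᵥ v = w := by rw [hv, mulVec_mulVec, mul_nonsing_inv _ hW, one_mulVec]
  have hVv : V *ᵥ v = (V * W⁻¹) *ᵥ w := by rw [hv, mulVec_mulVec]
  have e1 := quad_form W d v
  rw [h, quad_form V e v, hWv, hVv] at e1
  have e2 := Complex.ofReal_injective e1
  have hle : ∑ i, e i * ‖((V * W⁻¹) *ᵥ w) i‖ ^ 2 ≤ 0 := by
    apply Finset.sum_nonpos
    intro i _
    by_cases hi : 0 < e i
    · rw [hLc ⟨i, hi⟩]; simp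
    · exact mul_nonpos_of_nonpos_of_nonneg (not_lt.mp hi) (by positivity)
  have hwd : ∀ i (hi : 0 < d i), w i = c ⟨i, hi⟩ := fun i hi =>
    Subtype.val_injective.extend_apply c 0 ⟨i, hi⟩
  have hwn : ∀ i, ¬ 0 < d i → w i = 0 := fun i hi => by
    rw [hw, Function.extend_apply']
    · rfl
    · rintro ⟨a, rfl⟩; exact hi a.2
  have hpos : 0 < ∑ i, d i * ‖w i‖ ^ 2 := by
    obtain ⟨⟨i, hi⟩, hci⟩ := Function.ne_iff.mp hc0
    apply Finset.sum_pos'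
    · intro j _
      by_cases hj : 0 < d j
      · positivity
      · rw [hwn j hj]; simp
    · refine ⟨i, Finset.mem_univ _, ?_⟩
      rw [hwd i hi]
      have : c ⟨i, hi⟩ ≠ 0 := hci
      positivity
  linarith

lemma inertia {W V : Matrix ι ι ℂ} {d e : ι → ℝ} (hW : IsUnit W.det) (hV : IsUnit V.det)
    (h : Wᴴ * rd d * W = Vᴴ * rd e * V) : cnt d = cnt e := by
  rw [cnt_card, cnt_card]
  exact_mod_cast le_antisymm (inertia_le hW h) (inertia_le hV h.symm)

lemma blk_cong (W1 W2 : Matrix ι ι ℂ) (d1 d2 : ι → ℝ) :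
    (fromBlocks W1 0 0 W2)ᴴ * rd (Sum.elim d1 d2) * fromBlocks W1 0 0 W2
      = fromBlocks (W1ᴴ * rd d1 * W1) 0 0 (W2ᴴ * rd d2 * W2) := by
  have : rd (Sum.elim d1 d2) = fromBlocks (rd d1) 0 0 (rd d2) := by
    unfold rd
    rw [fromBlocks_diagonal]
    congr 1
    funext i
    rcases i with i | i <;> rfl
  rw [this, fromBlocks_conjTranspose, fromBlocks_multiply, fromBlocks_multiply]
  simp

lemma cnt_elim (d1 d2 : ι → ℝ) : cnt (Sum.elim d1 d2) = cnt d1 + cnt d2 := by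
  unfold cnt; rw [Fintype.sum_sum_type]; rfl

lemma jump_idx {X' X Δ Y E W1 W2 W3 W4 : Matrix ι ι ℂ} {d1 d2 d3 d4 : ι → ℝ}
    (hX : X = X' + Δ) (hXu : IsUnit X.det) (hY : X' * Y = 1) (hE : Δ * E = 1)
    (hYh : Yᴴ = Y) (hEh : Eᴴ = E)
    (u1 : IsUnit W1.det) (u2 : IsUnit W2.det) (u3 : IsUnit W3.det) (u4 : IsUnit W4.det)
    (h1 : X' = W1ᴴ * rd d1 * W1) (h2 : Δ = W2ᴴ * rd d2 * W2) (h3 : X = W3ᴴ * rd d3 * W3)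
    (h4 : Y + E = W4ᴴ * rd d4 * W4) : cnt d1 + cnt d2 = cnt d3 + cnt d4 := by
  rw [← cnt_elim, ← cnt_elim]
  have hY' : Y * X' = 1 := mul_eq_one_comm.mp hY
  have hE' : E * Δ = 1 := mul_eq_one_comm.mp hE
  have hYE : X' * (Y + E) * Δ = X := by
    rw [Matrix.mul_add, hY, Matrix.add_mul, Matrix.one_mul, Matrix.mul_assoc, hE', Matrix.mul_one, hX,
      add_comm]
  have hYEu : IsUnit (Y + E).det := by
    rw [← hYE, det_mul, det_mul] at hXu
    exact isUnit_of_mul_isUnit_right (isUnit_of_mul_isUnit_left hXu)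
  let T : Matrix (ι ⊕ ι) (ι ⊕ ι) ℂ := fromBlocks 1 Y 1 (-E)
  have hT : IsUnit T.det := by
    show IsUnit (fromBlocks 1 Y 1 (-E)).det
    rw [det_fromBlocks_one₁₁, Matrix.one_mul, show -E - Y = -(Y + E) by abel, det_neg]
    exact (IsUnit.mul ((isUnit_neg_one (α := ℂ)).pow _) hYEu)
  apply inertia (W := fromBlocks W1 0 0 W2 * T) (V := fromBlocks W3 0 0 W4)
  · rw [det_mul, det_fromBlocks_zero₂₁]; exact (u1.mul u2).mul hT
  · rw [det_fromBlocks_zero₂₁]; exact u3.mul u4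
  · rw [blk_cong, ← h3, ← h4, conjTranspose_mul]
    calc Tᴴ * (fromBlocks W1 0 0 W2)ᴴ * rd (Sum.elim d1 d2) * (fromBlocks W1 0 0 W2 * T)
        = Tᴴ * ((fromBlocks W1 0 0 W2)ᴴ * rd (Sum.elim d1 d2) * fromBlocks W1 0 0 W2) * T := by
          simp only [Matrix.mul_assoc]
      _ = _ := by
        rw [blk_cong, ← h1, ← h2]
        show (fromBlocks 1 Y 1 (-E))ᴴ * _ * fromBlocks 1 Y 1 (-E) = _
        rw [fromBlocks_conjTranspose, fromBlocks_multiply, fromBlocks_multiply]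
        simp [hYh, hEh, hY, hE, hY', hE', hX]

/-- index of a hermitian matrix -/
def Nidx (H : Matrix ι ι ℂ) : ℤ := by
  classical exact if h : H.IsHermitian then cnt h.eigenvalues else 0

lemma Nidx_spec {H : Matrix ι ι ℂ} (h : H.IsHermitian) : ∃ (W : Matrix ι ι ℂ) (d : ι → ℝ),
    IsUnit W.det ∧ H = Wᴴ * rd d * W ∧ Nidx H = cnt d := by
  let U : Matrix ι ι ℂ := (h.eigenvectorUnitary : Matrix ι ι ℂ)
  have hU : Uᴴ * U = 1 := (Matrix.mem_unitaryGroup_iff'.mp h.eigenvectorUnitary.2)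
  have hU' : U * Uᴴ = 1 := mul_eq_one_comm.mp hU
  refine ⟨Uᴴ, h.eigenvalues, isUnit_det_of_right_inverse hU, ?_, by simp [Nidx, h]⟩
  have := h.spectral_theorem
  rw [conjTranspose_conjTranspose]
  rw [Unitary.conjStarAlgAut_apply] at this
  exact this

lemma cnt_nonneg (d : ι → ℝ) : 0 ≤ cnt d := by rw [cnt_card]; positivity

lemma Nidx_nonneg (H : Matrix ι ι ℂ) : 0 ≤ Nidx H := by
  unfold Nidx; split_ifs
  · exact cnt_nonneg _
  · exact le_rfl
end inertia

lemma cnt3 (d : Fin 3 → ℝ) : cnt d = (if 0 < d 0 then 1 else 0) + (if 0 < d 1 then 1 else 0)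
    + (if 0 < d 2 then 1 else 0) := by unfold cnt; rw [Fin.sum_univ_three]

lemma Nidx_le (H : M3) : Nidx H ≤ 3 := by
  unfold Nidx; split_ifs
  · rw [cnt3]; split_ifs <;> norm_num
  · norm_num

/-- conjugate of a diagonal matrix -/
def sp (P : M3) (d : Fin 3 → ℂ) : M3 := P * Matrix.diagonal d * P⁻¹

lemma U_inv_mul {P : M3} (h : memU21 P) : P⁻¹ * P = 1 := nonsing_inv_mul _ (memU21_isUnit h)
lemma U_mul_inv {P : M3} (h : memU21 P) : P * P⁻¹ = 1 := mul_nonsing_inv _ (memU21_isUnit h)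

lemma sp_mul {P : M3} (h : memU21 P) (d e : Fin 3 → ℂ) : sp P d * sp P e = sp P (fun k => d k * e k) := by
  unfold sp
  calc P * Matrix.diagonal d * P⁻¹ * (P * Matrix.diagonal e * P⁻¹)
      = P * Matrix.diagonal d * (P⁻¹ * P) * Matrix.diagonal e * P⁻¹ := by simp only [Matrix.mul_assoc]
    _ = _ := by rw [U_inv_mul h, Matrix.mul_one, Matrix.mul_assoc P, diagonal_mul_diagonal]

lemma sp_add (P : M3) (d e : Fin 3 → ℂ) : sp P d + sp P e = sp P (fun k => d k + e k) := by
  unfold sp; rw [← diagonal_add, Matrix.mul_add, Matrix.add_mul]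

lemma sp_sub (P : M3) (d e : Fin 3 → ℂ) : sp P d - sp P e = sp P (fun k => d k - e k) := by
  unfold sp; rw [← diagonal_sub, Matrix.mul_sub, Matrix.sub_mul]

lemma sp_smul (P : M3) (c : ℂ) (d : Fin 3 → ℂ) : c • sp P d = sp P (fun k => c * d k) := by
  unfold sp
  rw [show Matrix.diagonal (fun k => c * d k) = c • Matrix.diagonal d from diagonal_smul c d,
    Matrix.mul_smul, Matrix.smul_mul]

lemma sp_one {P : M3} (h : memU21 P) : sp P (fun _ => 1) = 1 := by
  unfold sp
  rw [diagonal_one, Matrix.mul_one, U_mul_inv h]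

lemma sp_det {P : M3} (h : memU21 P) (d : Fin 3 → ℂ) : (sp P d).det = d 0 * d 1 * d 2 := by
  unfold sp
  rw [det_mul, det_mul, mul_right_comm, ← det_mul, U_mul_inv h, det_one, one_mul, det_diagonal,
    Fin.prod_univ_three]

/-- signs -/
def sJ : Fin 3 → ℝ := ![1, 1, -1]

lemma J3_rd : J3 = rd sJ := by
  unfold J3 rd sJ; congr 1; funext i; fin_cases i <;> simp

lemma J3_P {P : M3} (h : memU21 P) : J3 * P = (P⁻¹)ᴴ * J3 := by
  rw [memU21_inv h]
  simp only [conjTranspose_mul, conjTranspose_conjTranspose, J3_star]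
  simp only [Matrix.mul_assoc, J3_sq, Matrix.mul_one]

lemma J3_sp {P : M3} (h : memU21 P) (d : Fin 3 → ℝ) :
    J3 * sp P (fun k => (d k : ℂ)) = (P⁻¹)ᴴ * rd (fun k => sJ k * d k) * P⁻¹ := by
  unfold sp
  rw [← Matrix.mul_assoc, ← Matrix.mul_assoc, J3_P h, Matrix.mul_assoc _ J3]
  congr 2
  rw [J3_rd]; unfold rd
  rw [diagonal_mul_diagonal]; congr 1; funext k; push_cast; rfl

lemma rd_herm (d : Fin 3 → ℝ) : (rd d)ᴴ = rd d := by
  unfold rd; rw [diagonal_conjTranspose]; congr 1; funext k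
  exact Complex.conj_ofReal _

lemma cong_herm (W : M3) (d : Fin 3 → ℝ) : (Wᴴ * rd d * W)ᴴ = Wᴴ * rd d * W := by
  rw [conjTranspose_mul, conjTranspose_mul, conjTranspose_conjTranspose, rd_herm, Matrix.mul_assoc]

lemma J3_sp_herm {P : M3} (h : memU21 P) (d : Fin 3 → ℝ) :
    (J3 * sp P (fun k => (d k : ℂ)))ᴴ = J3 * sp P (fun k => (d k : ℂ)) := by
  rw [J3_sp h, cong_herm]

lemma inv_herm {X Y : M3} (hX : Xᴴ = X) (h : X * Y = 1) : Yᴴ = Y := by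
  have h1 : Yᴴ * X = 1 := by
    have := congrArg conjTranspose h
    rwa [conjTranspose_mul, hX, conjTranspose_one] at this
  calc Yᴴ = Yᴴ * (X * Y) := by rw [h, Matrix.mul_one]
    _ = Y := by rw [← Matrix.mul_assoc, h1, Matrix.one_mul]

/-- minus cotangent of half -/
def mc (t : ℝ) : ℝ := -(Real.cos (t / 2) / sh t)

lemma one_sub_ex (t : ℝ) : 1 - ex t = -2 * Complex.I * sh t * ex (t / 2) := by
  have h : ex t = ex (t / 2) * ex (t / 2) := by rw [← ex_add]; congr 1; ring
  have h1 : (1 : ℂ) = ex (-(t / 2)) * ex (t / 2) := by rw [← ex_add]; simp [ex_zero]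
  have h2 : ex (-(t / 2)) - ex (t / 2) = -2 * Complex.I * sh t := by
    rw [ex_eq, ex_eq, Real.cos_neg, Real.sin_neg]; unfold sh; push_cast; ring
  rw [← h2, h]; linear_combination h1

lemma one_add_ex (t : ℝ) : 1 + ex t = 2 * Real.cos (t / 2) * ex (t / 2) := by
  have h : ex t = ex (t / 2) * ex (t / 2) := by rw [← ex_add]; congr 1; ring
  have h1 : (1 : ℂ) = ex (-(t / 2)) * ex (t / 2) := by rw [← ex_add]; simp [ex_zero]
  have h2 : ex (-(t / 2)) + ex (t / 2) = 2 * Real.cos (t / 2) := by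
    rw [ex_eq, ex_eq, Real.cos_neg, Real.sin_neg]; push_cast; ring
  rw [← h2, h]; linear_combination h1

lemma mc_mul {t : ℝ} (h : sh t ≠ 0) : (mc t : ℂ) * (1 - ex t) = Complex.I * (1 + ex t) := by
  have h' : (sh t : ℂ) ≠ 0 := by exact_mod_cast h
  rw [one_sub_ex, one_add_ex]; unfold mc; push_cast; field_simp

lemma mc_sub {s t : ℝ} (h : sh s ≠ 0) (h' : sh t ≠ 0) : mc s - mc t = sh (s - t) / (sh s * sh t) := by
  unfold mc; field_simp
  unfold sh
  rw [show (s - t) / 2 = s / 2 - t / 2 by ring, Real.sin_sub]; ring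

lemma one_sub_ex_ne {t : ℝ} (h : sh t ≠ 0) : 1 - ex t ≠ 0 := by
  rw [one_sub_ex]
  have h' : (sh t : ℂ) ≠ 0 := by exact_mod_cast h
  have := ex_ne (t / 2)
  simp [h', this]

/-- Cayley transform -/
def av (P : M3) (α : Fin 3 → ℝ) (x : ℝ) : M3 := sp P (fun k => ((mc (α k - x) : ℝ) : ℂ))
/-- `1 - e^{-ix} A` -/
def nv (P : M3) (α : Fin 3 → ℝ) (x : ℝ) : M3 := sp P (fun k => 1 - ex (α k - x))
def Xm (P Q : M3) (α β : Fin 3 → ℝ) (x y : ℝ) : M3 := J3 * (av P α x + av Q β y)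

lemma Xm_symm (P Q : M3) (α β : Fin 3 → ℝ) (x y : ℝ) : Xm P Q α β x y = Xm Q P β α y x := by
  unfold Xm; rw [add_comm]

lemma Xm_herm {P Q : M3} (hP : memU21 P) (hQ : memU21 Q) (α β : Fin 3 → ℝ) (x y : ℝ) :
    (Xm P Q α β x y)ᴴ = Xm P Q α β x y := by
  unfold Xm av
  rw [Matrix.mul_add, conjTranspose_add, J3_sp_herm hP, J3_sp_herm hQ]

def spe (P : M3) (α : Fin 3 → ℝ) : M3 := sp P (fun k => ex (α k))

lemma sp_ex {P : M3} (α : Fin 3 → ℝ) (x : ℝ) :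
    sp P (fun k => ex (α k - x)) = ex (-x) • spe P α := by
  unfold spe; rw [sp_smul]; congr 1; funext k
  rw [← ex_add]; congr 1; ring

lemma nv_eq {P : M3} (h : memU21 P) (α : Fin 3 → ℝ) (x : ℝ) :
    nv P α x = 1 - ex (-x) • spe P α := by
  rw [← sp_ex, ← sp_one h, sp_sub]; rfl

lemma nv_av {P : M3} (h : memU21 P) {α : Fin 3 → ℝ} {x : ℝ} (hx : ∀ k, sh (α k - x) ≠ 0) :
    nv P α x * av P α x = Complex.I • (1 + ex (-x) • spe P α) := by
  unfold nv av
  rw [← sp_ex, ← sp_one h, sp_add, sp_smul, sp_mul h]; congr 1; funext k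
  rw [mul_comm]; exact mc_mul (hx k)

lemma av_nv {P : M3} (h : memU21 P) {α : Fin 3 → ℝ} {x : ℝ} (hx : ∀ k, sh (α k - x) ≠ 0) :
    av P α x * nv P α x = Complex.I • (1 + ex (-x) • spe P α) := by
  unfold nv av
  rw [← sp_ex, ← sp_one h, sp_add, sp_smul, sp_mul h]; congr 1; funext k
  exact mc_mul (hx k)

/-- the main data -/
structure Dat (P Q R : M3) (α β μ : Fin 3 → ℝ) : Prop where
  hP : memU21 P
  hQ : memU21 Q
  hR : memU21 R
  h : spe P α * spe Q β = spe R μ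

lemma key_id {P Q R : M3} {α β μ : Fin 3 → ℝ} (D : Dat P Q R α β μ) {x y : ℝ}
    (hx : ∀ k, sh (α k - x) ≠ 0) (hy : ∀ k, sh (β k - y) ≠ 0) :
    nv P α x * (av P α x + av Q β y) * nv Q β y = (2 * Complex.I) • nv R μ (x + y) := by
  rw [Matrix.mul_add, Matrix.add_mul, nv_av D.hP hx, Matrix.mul_assoc (nv P α x), av_nv D.hQ hy,
    nv_eq D.hP, nv_eq D.hQ, nv_eq D.hR, ← D.h]
  rw [show -(x + y) = -x + -y by ring, ex_add]
  set A := spe P α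
  set B := spe Q β
  simp only [Matrix.add_mul, Matrix.mul_add, Matrix.mul_sub, Matrix.sub_mul, Matrix.smul_mul,
    Matrix.mul_smul, Matrix.one_mul, Matrix.mul_one, smul_add, smul_sub, smul_smul]
  module

lemma nv_inv {R : M3} (hR : memU21 R) {μ : Fin 3 → ℝ} {x : ℝ} (hx : ∀ k, sh (μ k - x) ≠ 0) :
    nv R μ x * sp R (fun k => 1 / (1 - ex (μ k - x))) = 1 := by
  unfold nv
  rw [sp_mul hR, ← sp_one hR]; congr 1; funext k
  exact mul_one_div_cancel (one_sub_ex_ne (hx k))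

lemma Xm_inv {P Q R : M3} {α β μ : Fin 3 → ℝ} (D : Dat P Q R α β μ) {x y : ℝ}
    (hx : ∀ k, sh (α k - x) ≠ 0) (hy : ∀ k, sh (β k - y) ≠ 0)
    (hz : ∀ k, sh (μ k - (x + y)) ≠ 0) :
    Xm P Q α β x y * ((1 / (2 * Complex.I)) • (nv Q β y *
      sp R (fun k => 1 / (1 - ex (μ k - (x + y)))) * nv P α x * J3)) = 1 := by
  set K := sp R (fun k => 1 / (1 - ex (μ k - (x + y)))) with hK
  have h1 := key_id D hx hy
  have h2 : nv P α x * ((1 / (2 * Complex.I)) • ((av P α x + av Q β y) * nv Q β y * K)) = 1 := by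
    rw [Matrix.mul_smul, ← Matrix.mul_assoc, ← Matrix.mul_assoc, h1, Matrix.smul_mul, nv_inv D.hR hz,
      smul_smul, one_div_mul_cancel (by simp), one_smul]
  have h3 := mul_eq_one_comm.mp h2
  unfold Xm
  calc _ = J3 * ((1 / (2 * Complex.I)) • ((av P α x + av Q β y) * nv Q β y * K) * nv P α x) * J3 := by
        simp only [Matrix.mul_smul, Matrix.smul_mul, Matrix.mul_assoc]
    _ = 1 := by rw [h3, Matrix.mul_one, J3_sq]

lemma Xm_unit {P Q R : M3} {α β μ : Fin 3 → ℝ} (D : Dat P Q R α β μ) {x y : ℝ}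
    (hx : ∀ k, sh (α k - x) ≠ 0) (hy : ∀ k, sh (β k - y) ≠ 0)
    (hz : ∀ k, sh (μ k - (x + y)) ≠ 0) : IsUnit (Xm P Q α β x y).det :=
  isUnit_det_of_right_inverse (Xm_inv D hx hy hz)

lemma J_sp_star {P : M3} (h : memU21 P) (d : Fin 3 → ℂ) :
    J3 * (sp P d)ᴴ * J3 = sp P (fun k => star (d k)) := by
  unfold sp
  have h1 : J3 * (P⁻¹)ᴴ = P * J3 := by
    have := J3_P h
    calc J3 * (P⁻¹)ᴴ = J3 * ((P⁻¹)ᴴ * J3) * J3 := by simp only [Matrix.mul_assoc, J3_sq, Matrix.mul_one]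
      _ = P * J3 := by rw [← this, ← Matrix.mul_assoc, J3_sq, Matrix.one_mul]
  have h2 : J3 * P⁻¹ = Pᴴ * J3 := by
    rw [memU21_inv h]; simp only [← Matrix.mul_assoc, J3_sq, Matrix.one_mul]
  have h3 : J3 * Matrix.diagonal (star d) = Matrix.diagonal (star d) * J3 := by
    unfold J3; rw [diagonal_mul_diagonal, diagonal_mul_diagonal]; congr 1; funext k; ring
  rw [conjTranspose_mul, conjTranspose_mul, diagonal_conjTranspose]
  calc J3 * ((P⁻¹)ᴴ * (Matrix.diagonal (star d) * Pᴴ)) * J3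
      = (J3 * (P⁻¹)ᴴ) * Matrix.diagonal (star d) * (Pᴴ * J3) := by simp only [Matrix.mul_assoc]
    _ = P * (J3 * Matrix.diagonal (star d)) * (J3 * P⁻¹) := by rw [h1, h2]; simp only [Matrix.mul_assoc]
    _ = P * Matrix.diagonal (star d) * ((J3 * J3) * P⁻¹) := by rw [h3]; simp only [Matrix.mul_assoc]
    _ = _ := by rw [J3_sq, Matrix.one_mul]; rfl

/-- eigenvalues of the increment -/
def dl (α : Fin 3 → ℝ) (x x' : ℝ) (k : Fin 3) : ℝ := sh (x' - x) / (sh (α k - x) * sh (α k - x'))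
def ph (μ : Fin 3 → ℝ) (x x' y : ℝ) (k : Fin 3) : ℝ :=
  sh (μ k - (x + y)) / (4 * sh (x' - x) * sh (μ k - (x' + y)))

lemma dl_c {a x x' : ℝ} (h1 : sh (a - x) ≠ 0) (h2 : sh (a - x') ≠ 0) (h3 : sh (x' - x) ≠ 0) :
    (1 / ((sh (x' - x) / (sh (a - x) * sh (a - x')) : ℝ) : ℂ)) * (ex (x' - x) - 1) =
    (1 / (2 * Complex.I)) * (ex (-(a - x')) - ex (x' - x)) * (1 - ex (a - x')) := by
  have e1 : ex (-(a - x')) - ex (x' - x) = ex (-(a - x')) * (1 - ex (a - x)) := by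
    rw [mul_sub, ← ex_add]; congr 2 <;> ring_nf
  have e2 : ex (x' - x) - 1 = -(1 - ex (x' - x)) := by ring
  have e3 : ex ((x' - x) / 2) = ex (-(a - x')) * ex ((a - x) / 2) * ex ((a - x') / 2) := by
    rw [← ex_add, ← ex_add]; congr 1; ring
  have c1 : (sh (a - x) : ℂ) ≠ 0 := by exact_mod_cast h1
  have c2 : (sh (a - x') : ℂ) ≠ 0 := by exact_mod_cast h2
  have c3 : (sh (x' - x) : ℂ) ≠ 0 := by exact_mod_cast h3
  rw [e1, e2, one_sub_ex, one_sub_ex, one_sub_ex, e3]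
  push_cast
  field_simp
  try ring_nf
  try simp

lemma ph_c {m s s' : ℝ} (h2 : sh (m - s') ≠ 0) (h3 : sh (s' - s) ≠ 0) :
    ((sh (m - s) / (4 * sh (s' - s) * sh (m - s')) : ℝ) : ℂ) * (ex (s' - s) - 1) * (1 - ex (m - s')) =
    - (1 / (2 * Complex.I)) * (1 - ex (m - s)) := by
  have e2 : ex (s' - s) - 1 = -(1 - ex (s' - s)) := by ring
  have e3 : ex ((m - s) / 2) = ex ((s' - s) / 2) * ex ((m - s') / 2) := by
    rw [← ex_add]; congr 1; ring
  have c2 : (sh (m - s') : ℂ) ≠ 0 := by exact_mod_cast h2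
  have c3 : (sh (s' - s) : ℂ) ≠ 0 := by exact_mod_cast h3
  rw [e2, one_sub_ex, one_sub_ex, one_sub_ex, e3]
  push_cast
  field_simp
  try ring_nf
  try simp

lemma jump_alg {P Q R : M3} {α β μ : Fin 3 → ℝ} (D : Dat P Q R α β μ) {x x' y : ℝ}
    (hx : ∀ k, sh (α k - x) ≠ 0) (hx' : ∀ k, sh (α k - x') ≠ 0)
    (hz' : ∀ k, sh (μ k - (x' + y)) ≠ 0) (h0 : sh (x' - x) ≠ 0) :
    (1 / (2 * Complex.I)) • (nv Q β y *
      sp R (fun k => 1 / (1 - ex (μ k - (x' + y)))) * nv P α x' * J3)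
      + sp P (fun k => 1 / ((dl α x x' k : ℝ) : ℂ)) * J3
    = sp P (fun k => 1 - ex (-(α k - x'))) * sp R (fun k => ((ph μ x x' y k : ℝ) : ℂ)) * nv P α x' * J3 := by
  set u := ex (x' - x) with hu
  have hu1 : u - 1 ≠ 0 := by
    have := one_sub_ex_ne h0
    intro h; apply this; rw [← hu]; linear_combination -h
  set K := sp R (fun k => 1 / (1 - ex (μ k - (x' + y)))) with hK
  set c := 1 / (2 * Complex.I) with hc
  -- first scalar identities lifted to matrices
  have f1 : (u - 1) • sp P (fun k => 1 / ((dl α x x' k : ℝ) : ℂ)) =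
      c • (sp P (fun k => ex (-(α k - x')) - u) * nv P α x') := by
    unfold nv
    rw [sp_mul D.hP, sp_smul, sp_smul]; congr 1; funext k
    have := dl_c (hx k) (hx' k) h0
    unfold dl; rw [hu, hc]; linear_combination this
  have f2 : (u - 1) • sp R (fun k => ((ph μ x x' y k : ℝ) : ℂ)) =
      (-c) • (sp R (fun k => 1 - ex (μ k - (x + y))) * K) := by
    rw [hK, sp_mul D.hR, sp_smul, sp_smul]; congr 1; funext k
    have h := ph_c (s := x + y) (hz' k) (by rw [show x' + y - (x + y) = x' - x by ring]; exact h0)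
    rw [show x' + y - (x + y) = x' - x by ring] at h
    have h4 := one_sub_ex_ne (hz' k)
    unfold ph; rw [hu, hc]
    field_simp at h ⊢
    linear_combination h
  have hAi : sp P (fun k => ex (-(α k - x'))) * (ex (-x') • spe P α) = 1 := by
    rw [← sp_ex, sp_mul D.hP, ← sp_one D.hP]; congr 1; funext k
    rw [← ex_add]; simp [ex_zero]
  set Ai := sp P (fun k => ex (-(α k - x'))) with hAid
  have g1 : sp P (fun k => ex (-(α k - x')) - u) = Ai - u • 1 := by
    rw [← sp_one D.hP, sp_smul, hAid, sp_sub]; simp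
  have g2 : sp P (fun k => 1 - ex (-(α k - x'))) = 1 - Ai := by
    rw [← sp_one D.hP, hAid, sp_sub]
  have g3 : sp R (fun k => 1 - ex (μ k - (x + y))) = 1 - u • (ex (-(x' + y)) • spe R μ) := by
    have := nv_eq D.hR μ (x + y)
    unfold nv at this
    rw [this, smul_smul, hu, ← ex_add]; congr 3; ring
  have g4 : nv R μ (x' + y) = 1 - ex (-(x' + y)) • spe R μ := nv_eq D.hR _ _
  have g5 : ex (-(x' + y)) • spe R μ = (ex (-x') • spe P α) * (ex (-y) • spe Q β) := by
    rw [← D.h, Matrix.smul_mul, Matrix.mul_smul, smul_smul, ← ex_add]; congr 2; ring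
  have g6 : nv Q β y = 1 - ex (-y) • spe Q β := nv_eq D.hQ _ _
  have gK : nv R μ (x' + y) * K = 1 := nv_inv D.hR hz'
  set A := ex (-x') • spe P α
  set B := ex (-y) • spe Q β
  have hAB : Ai * (A * B) = B := by rw [← Matrix.mul_assoc, hAi, Matrix.one_mul]
  have main : (u - 1) • nv Q β y + (Ai - u • 1) * nv R μ (x' + y) = - ((1 - Ai) * (1 - u • (A * B))) := by
    rw [g4, g5, g6]
    simp only [Matrix.sub_mul, Matrix.mul_sub, Matrix.mul_smul, Matrix.smul_mul, Matrix.one_mul,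
      Matrix.mul_one, hAB]
    module
  have hfin : (u - 1) • (c • (nv Q β y * K) * nv P α x' + sp P (fun k => 1 / ((dl α x x' k : ℝ) : ℂ)))
      = (u - 1) • (sp P (fun k => 1 - ex (-(α k - x'))) * sp R (fun k => ((ph μ x x' y k : ℝ) : ℂ))
         * nv P α x') := by
    have q : (u - 1) • ((1 - Ai) * sp R (fun k => ((ph μ x x' y k : ℝ) : ℂ)) * nv P α x')
        = (1 - Ai) * ((u - 1) • sp R (fun k => ((ph μ x x' y k : ℝ) : ℂ))) * nv P α x' := by
      rw [Matrix.mul_smul, Matrix.smul_mul]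
    rw [smul_add, f1, g1, g2, q, f2, g3, g5]
    have e := congrArg (fun Z => c • (Z * K * nv P α x')) main
    rw [Matrix.add_mul, Matrix.mul_assoc (Ai - u • 1), gK, Matrix.mul_one] at e
    have e' : c • ((((u - 1) • nv Q β y * K + (Ai - u • 1)) * nv P α x'))
      = (u - 1) • (c • (nv Q β y * K) * nv P α x') + c • ((Ai - u • 1) * nv P α x') := by
      rw [Matrix.add_mul, smul_add]
      simp only [Matrix.smul_mul, smul_smul]; rw [mul_comm]
    rw [← e', e]
    simp only [Matrix.smul_mul, Matrix.mul_smul, neg_smul, Matrix.neg_mul, smul_neg, Matrix.mul_assoc,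
      Matrix.mul_neg]
  have hfin' := smul_right_injective M3 hu1 hfin
  rw [← hfin', Matrix.add_mul, Matrix.smul_mul, Matrix.smul_mul]

lemma jump {P Q R : M3} {α β μ : Fin 3 → ℝ} (D : Dat P Q R α β μ) {x x' y : ℝ}
    (hx : ∀ k, sh (α k - x) ≠ 0) (hx' : ∀ k, sh (α k - x') ≠ 0) (hy : ∀ k, sh (β k - y) ≠ 0)
    (hz : ∀ k, sh (μ k - (x + y)) ≠ 0) (hz' : ∀ k, sh (μ k - (x' + y)) ≠ 0) (h0 : sh (x' - x) ≠ 0) :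
    Nidx (Xm P Q α β x' y) + cnt (fun k => sJ k * dl α x x' k)
      = Nidx (Xm P Q α β x y) + cnt (fun k => sJ k * ph μ x x' y k) := by
  obtain ⟨W1, d1, u1, h1, n1⟩ := Nidx_spec (show (Xm P Q α β x' y).IsHermitian from Xm_herm D.hP D.hQ ..)
  obtain ⟨W3, d3, u3, h3, n3⟩ := Nidx_spec (show (Xm P Q α β x y).IsHermitian from Xm_herm D.hP D.hQ ..)
  rw [n1, n3]
  have hdl : ∀ k, dl α x x' k ≠ 0 := fun k => by
    unfold dl; exact div_ne_zero h0 (mul_ne_zero (hx k) (hx' k))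
  have hD : av P α x = av P α x' + sp P (fun k => ((dl α x x' k : ℝ) : ℂ)) := by
    unfold av; rw [sp_add]; congr 1; funext k
    have := mc_sub (hx k) (hx' k)
    rw [show α k - x - (α k - x') = x' - x by ring] at this
    unfold dl; rw [← this]; push_cast; ring
  have hE : (J3 * sp P (fun k => ((dl α x x' k : ℝ) : ℂ))) *
      (sp P (fun k => 1 / ((dl α x x' k : ℝ) : ℂ)) * J3) = 1 := by
    rw [Matrix.mul_assoc, ← Matrix.mul_assoc (sp P _), sp_mul D.hP,
      show (fun k => ((dl α x x' k : ℝ) : ℂ) * (1 / ((dl α x x' k : ℝ) : ℂ))) = fun _ => 1 from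
        funext fun k => mul_one_div_cancel (by exact_mod_cast hdl k), sp_one D.hP, Matrix.one_mul, J3_sq]
  have hnu : IsUnit (nv P α x' * J3).det := by
    rw [det_mul]
    exact (isUnit_det_of_right_inverse (nv_inv D.hP hx')).mul (isUnit_det_of_right_inverse J3_sq)
  have hY := Xm_inv D hx' hy hz'
  refine jump_idx (W2 := P⁻¹) (W4 := R⁻¹ * (nv P α x' * J3)) ?_ (Xm_unit D hx hy hz) hY hE
    (inv_herm (Xm_herm D.hP D.hQ ..) hY) (inv_herm (J3_sp_herm D.hP _) hE) u1
    (memU21_isUnit (memU21_inv' D.hP)) u3 ?_ h1 (J3_sp D.hP _) h3 ?_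
  · unfold Xm; rw [hD, ← Matrix.mul_add]; congr 1; abel
  · rw [det_mul]; exact (memU21_isUnit (memU21_inv' D.hR)).mul hnu
  · rw [jump_alg D hx hx' hz' h0]
    have e1 : sp P (fun k => 1 - ex (-(α k - x'))) = J3 * (nv P α x')ᴴ * J3 := by
      unfold nv; rw [J_sp_star D.hP]; congr 1; funext k
      rw [star_sub, ex_star, star_one]
    rw [e1, conjTranspose_mul]
    calc _ = (nv P α x' * J3)ᴴ * (J3 * sp R (fun k => ((ph μ x x' y k : ℝ) : ℂ))) * (nv P α x' * J3) := by
          rw [conjTranspose_mul, J3_star]; simp only [Matrix.mul_assoc]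
      _ = _ := by rw [J3_sp D.hR]; simp only [Matrix.mul_assoc]

/-- the count function -/
def nn (p : Pt) (x : ℝ) : ℤ := (if x < p.1 then 1 else 0) + (if x < p.2 then 1 else 0) - 1
/-- generic point -/
def Gd (p : Pt) (x : ℝ) : Prop := 0 < x ∧ x < 2 * π ∧ x ≠ p.1 ∧ x ≠ p.2
/-- angles inside the circle -/
def In (p : Pt) : Prop := 0 < p.1 ∧ p.1 < 2 * π ∧ 0 < p.2 ∧ p.2 < 2 * π
/-- angle vector -/
def vc (p : Pt) : Fin 3 → ℝ := ![p.1, p.2, 0]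
def vm (θ : ℝ) (p : Pt) : Fin 3 → ℝ := ![θ - p.1, θ - p.2, θ]

lemma sh_pos_iff {t : ℝ} (h1 : -(2 * π) < t) (h2 : t < 2 * π) : 0 < sh t ↔ 0 < t := by
  constructor
  · intro h
    by_contra hc
    have := sh_nonneg (x := -t) (by linarith) (by linarith)
    rw [sh_neg] at this; linarith
  · intro h; exact sh_pos h h2

lemma sh_ne {t : ℝ} (h1 : -(2 * π) < t) (h2 : t < 2 * π) (h : t ≠ 0) : sh t ≠ 0 := by
  rcases lt_or_gt_of_ne h with h | h
  · have := sh_pos (x := -t) (by linarith) (by linarith)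
    rw [sh_neg] at this; linarith
  · exact (sh_pos h h2).ne'

lemma sh_int (t : ℝ) (m : ℤ) : sh (t - 2 * π * m) = (-1) ^ m * sh t := by
  unfold sh
  rw [show (t - 2 * π * m) / 2 = t / 2 - m * π by ring, Real.sin_sub_int_mul_pi]

lemma pow_sq (m : ℤ) : ((-1 : ℝ) ^ m) * (-1) ^ m = 1 := by
  rw [← zpow_add₀ (by norm_num), ← two_mul, _root_.zpow_mul]; norm_num

lemma pow_ne (m : ℤ) : ((-1 : ℝ) ^ m) ≠ 0 := zpow_ne_zero _ (by norm_num)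

lemma gd_sh {p : Pt} (hp : In p) {x : ℝ} (h : Gd p x) (k : Fin 3) : sh (vc p k - x) ≠ 0 := by
  obtain ⟨h1, h2, h3, h4⟩ := h
  obtain ⟨p1, p2, p3, p4⟩ := hp
  fin_cases k
  · exact sh_ne (show -(2 * π) < p.1 - x by linarith) (show p.1 - x < 2 * π by linarith)
      (sub_ne_zero.mpr (Ne.symm h3))
  · exact sh_ne (show -(2 * π) < p.2 - x by linarith) (show p.2 - x < 2 * π by linarith)
      (sub_ne_zero.mpr (Ne.symm h4))
  · exact sh_ne (show -(2 * π) < 0 - x by linarith) (show 0 - x < 2 * π by linarith)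
      (by intro h; change 0 - x = 0 at h; linarith)

lemma vm_sh (θ : ℝ) (p : Pt) {s z : ℝ} {m : ℤ} (h : s + z = θ + 2 * π * m) (k : Fin 3) :
    sh (vm θ p k - s) = - (-1) ^ m * sh (vc p k - z) := by
  have e : vm θ p k - s = -(vc p k - z) - 2 * π * m := by
    fin_cases k
    · show θ - p.1 - s = -(p.1 - z) - 2 * π * m; linarith
    · show θ - p.2 - s = -(p.2 - z) - 2 * π * m; linarith
    · show θ - s = -(0 - z) - 2 * π * m; linarith
  rw [e, sh_int, sh_neg]; ring

lemma gd_vm {p : Pt} (hp : In p) {θ s z : ℝ} {m : ℤ} (hz : Gd p z) (h : s + z = θ + 2 * π * m)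
    (k : Fin 3) : sh (vm θ p k - s) ≠ 0 := by
  rw [vm_sh θ p h]
  exact mul_ne_zero (neg_ne_zero.mpr (pow_ne m)) (gd_sh hp hz k)

lemma div_mul_pos {c a b : ℝ} (hc : 0 < c) : 0 < c / (a * b) ↔ 0 < a * b := by
  constructor
  · intro h; by_contra hn
    have := div_nonpos_of_nonneg_of_nonpos hc.le (not_lt.mp hn); linarith
  · intro h; positivity

lemma mul_sg {p x x' : ℝ} (h1 : 0 < x) (h2 : x' < 2 * π) (hx : x < x') (hp : 0 < p) (hp' : p < 2 * π)
    (n1 : x ≠ p) (n2 : x' ≠ p) :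
    (if 0 < sh (p - x) * sh (p - x') then (1 : ℤ) else 0)
      = 1 + (if x' < p then 1 else 0) - (if x < p then 1 else 0) := by
  rcases lt_or_gt_of_ne n1 with h | h
  · have a := sh_pos (x := p - x) (by linarith) (by linarith)
    rcases lt_or_gt_of_ne n2 with h' | h'
    · have b := sh_pos (x := p - x') (by linarith) (by linarith)
      rw [if_pos (by positivity), if_pos h', if_pos h]; ring
    · have b := sh_pos (x := -(p - x')) (by linarith) (by linarith)
      rw [sh_neg] at b
      rw [if_neg (by nlinarith), if_neg (by linarith), if_pos h]; ring
  · have a := sh_pos (x := -(p - x)) (by linarith) (by linarith)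
    have b := sh_pos (x := -(p - x')) (by linarith) (by linarith)
    rw [sh_neg] at a b
    rw [if_pos (by nlinarith), if_neg (by linarith), if_neg (by linarith)]; ring

lemma mul_sg0 {x x' : ℝ} (h1 : 0 < x) (h2 : x < 2 * π) (h3 : 0 < x') (h4 : x' < 2 * π) :
    0 < sh (0 - x) * sh (0 - x') := by
  have a := sh_pos h1 h2
  have b := sh_pos h3 h4
  rw [zero_sub, zero_sub, sh_neg, sh_neg]; nlinarith

lemma mul_sg' {p x x' : ℝ} (h1 : 0 < x) (h2 : x' < 2 * π) (hx : x < x') (hp : 0 < p) (hp' : p < 2 * π)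
    (n1 : x ≠ p) (n2 : x' ≠ p) :
    (if 0 < - (sh (p - x) * sh (p - x')) then (1 : ℤ) else 0)
      = (if x < p then 1 else 0) - (if x' < p then 1 else 0) := by
  have := mul_sg h1 h2 hx hp hp' n1 n2
  have hne : sh (p - x) * sh (p - x') ≠ 0 := mul_ne_zero
    (sh_ne (by linarith) (by linarith) (sub_ne_zero.mpr (Ne.symm n1)))
    (sh_ne (by linarith) (by linarith) (sub_ne_zero.mpr (Ne.symm n2)))
  rcases lt_or_gt_of_ne hne with h | h
  · rw [if_neg (by linarith)] at this
    rw [if_pos (by linarith)]; linarith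
  · rw [if_pos h] at this
    rw [if_neg (by linarith)]; linarith

lemma cnt_dl {p : Pt} (hp : In p) {x x' : ℝ} (hx : Gd p x) (hx' : Gd p x') (hlt : x < x') :
    cnt (fun k => sJ k * dl (vc p) x x' k) = 2 + nn p x' - nn p x := by
  obtain ⟨h1, h2, h3, h4⟩ := hx
  obtain ⟨h1', h2', h3', h4'⟩ := hx'
  obtain ⟨p1, p2, p3, p4⟩ := hp
  have hc : 0 < sh (x' - x) := sh_pos (by linarith) (by linarith)
  rw [cnt3]
  have e0 : sJ 0 * dl (vc p) x x' 0 = sh (x' - x) / (sh (p.1 - x) * sh (p.1 - x')) := one_mul _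
  have e1 : sJ 1 * dl (vc p) x x' 1 = sh (x' - x) / (sh (p.2 - x) * sh (p.2 - x')) := one_mul _
  have e2 : sJ 2 * dl (vc p) x x' 2 = -(sh (x' - x) / (sh (0 - x) * sh (0 - x'))) := neg_one_mul _
  have i2 := mul_sg0 h1 h2 h1' h2'
  have i3 : 0 < sh (x' - x) / (sh (0 - x) * sh (0 - x')) := by positivity
  rw [e0, e1, e2]
  simp only [div_mul_pos hc]
  rw [mul_sg h1 h2' hlt p1 p2 h3 h3', mul_sg h1 h2' hlt p3 p4 h4 h4',
    if_neg (show ¬ 0 < -(sh (x' - x) / (sh (0 - x) * sh (0 - x'))) by linarith)]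
  unfold nn; ring

lemma ph_sign {c a b e : ℝ} (hc : 0 < c) (he : e * e = 1) (ha : a ≠ 0) (hb : b ≠ 0):
    0 < -e * a / (4 * c * (-e * b)) ↔ 0 < a * b := by
  have he0 : e ≠ 0 := by rintro rfl; simp at he
  have : -e * a / (4 * c * (-e * b)) = a * b / (4 * c * b ^ 2) := by field_simp
  rw [this]
  constructor
  · intro h; by_contra hn
    have := div_nonpos_of_nonpos_of_nonneg (not_lt.mp hn) (show 0 ≤ 4 * c * b ^ 2 by positivity)
    linarith
  · intro h; positivity

lemma cnt_ph {p : Pt} (hp : In p) {θ x x' y z z' : ℝ} {m m' : ℤ} (hz : Gd p z) (hz' : Gd p z')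
    (hlt : x < x') (hx : 0 < x) (hx' : x' < 2 * π) (h : x + y + z = θ + 2 * π * m)
    (h' : x' + y + z' = θ + 2 * π * m') :
    cnt (fun k => sJ k * ph (vm θ p) x x' y k) = 2 - (m' - m) + nn p z - nn p z' := by
  have hc : 0 < sh (x' - x) := sh_pos (by linarith) (by linarith)
  have k1 := gd_sh hp hz
  have k2 := gd_sh hp hz'
  obtain ⟨h1, h2, h3, h4⟩ := hz
  obtain ⟨h1', h2', h3', h4'⟩ := hz'
  obtain ⟨p1, p2, p3, p4⟩ := hp
  have hpi := Real.pi_pos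
  have hm : m' = m ∨ m' = m + 1 := by
    have i1 : ((m' - m : ℤ) : ℝ) < 2 := by push_cast; nlinarith
    have i2 : (-1 : ℝ) < ((m' - m : ℤ) : ℝ) := by push_cast; nlinarith
    have i1' : m' - m < 2 := by exact_mod_cast i1
    have i2' : -1 < m' - m := by exact_mod_cast i2
    omega
  have hphk : ∀ k, ph (vm θ p) x x' y k = -(-1) ^ m * sh (vc p k - z) /
      (4 * sh (x' - x) * (- (-1) ^ m' * sh (vc p k - z'))) := fun k => by
    unfold ph; rw [vm_sh θ p h, vm_sh θ p h']
  rw [cnt3]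
  have e0 : sJ 0 * ph (vm θ p) x x' y 0 = ph (vm θ p) x x' y 0 := one_mul _
  have e1 : sJ 1 * ph (vm θ p) x x' y 1 = ph (vm θ p) x x' y 1 := one_mul _
  have e2 : sJ 2 * ph (vm θ p) x x' y 2 = -ph (vm θ p) x x' y 2 := neg_one_mul _
  rw [e0, e1, e2]
  have i2 := mul_sg0 h1 h2 h1' h2'
  have v0 : vc p 0 = p.1 := rfl
  have v1 : vc p 1 = p.2 := rfl
  have v2 : vc p 2 = 0 := rfl
  rcases hm with rfl | rfl
  · have hzz : z' < z := by linarith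
    have hs : ∀ k, 0 < ph (vm θ p) x x' y k ↔ 0 < sh (vc p k - z') * sh (vc p k - z) := fun k => by
      rw [hphk, ph_sign hc (pow_sq _) (k1 k) (k2 k), mul_comm]
    have : 0 < ph (vm θ p) x x' y 2 := by rw [hs, v2, mul_comm]; exact i2
    simp only [hs]
    rw [if_neg (show ¬ 0 < -ph (vm θ p) x x' y 2 by linarith), v0, v1, mul_sg h1' h2 hzz p1 p2 h3' h3, mul_sg h1' h2 hzz p3 p4 h4' h4]
    unfold nn; ring
  · have hzz : z < z' := by push_cast at h'; linarith
    have hs : ∀ k, 0 < -ph (vm θ p) x x' y k ↔ 0 < sh (vc p k - z) * sh (vc p k - z') := fun k => by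
      rw [hphk, ← ph_sign hc (pow_sq m) (k1 k) (k2 k), zpow_add₀ (by norm_num), zpow_one]
      have := pow_ne m
      have k3 := k2 k
      have k4 := hc.ne'
      rw [show -(-(-1) ^ m * sh (vc p k - z) / (4 * sh (x' - x) * (-((-1) ^ m * -1) * sh (vc p k - z'))))
        = -(-1) ^ m * sh (vc p k - z) / (4 * sh (x' - x) * (-(-1) ^ m * sh (vc p k - z'))) by
          field_simp]
    have hs' : ∀ k, 0 < ph (vm θ p) x x' y k ↔ 0 < -(sh (vc p k - z) * sh (vc p k - z')) := fun k => by
      have n1 : ph (vm θ p) x x' y k ≠ 0 := by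
        rw [hphk]
        have := pow_ne m
        have := pow_ne (m + 1)
        exact div_ne_zero (mul_ne_zero (neg_ne_zero.mpr ‹_›) (k1 k))
          (mul_ne_zero (by positivity) (mul_ne_zero (neg_ne_zero.mpr ‹_›) (k2 k)))
      have n2 := mul_ne_zero (k1 k) (k2 k)
      have := hs k
      constructor
      · intro q
        rcases lt_or_gt_of_ne n2 with j | j
        · linarith
        · have := this.mpr j; linarith
      · intro q
        rcases lt_or_gt_of_ne n1 with j | j
        · have := this.mp (by linarith); linarith
        · exact j
    simp only [hs]
    rw [v2, if_pos i2]
    simp only [hs']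
    rw [v0, v1, mul_sg' h1 h2' hzz p1 p2 h3 h3', mul_sg' h1 h2' hzz p3 p4 h4 h4']
    unfold nn; ring

section mv
variable {P Q R : M3} {a b g : Pt} {θ : ℝ}

lemma moveA_lt (D : Dat P Q R (vc a) (vc b) (vm θ g)) (ha : In a) (hb : In b) (hg : In g)
    {x x' y z z' : ℝ} {m m' : ℤ} (hx : Gd a x) (hx' : Gd a x') (hy : Gd b y) (hz : Gd g z) (hz' : Gd g z')
    (h : x + y + z = θ + 2 * π * m) (h' : x' + y + z' = θ + 2 * π * m') (hlt : x < x') :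
    Nidx (Xm P Q (vc a) (vc b) x y) + nn a x + nn g z + m
      = Nidx (Xm P Q (vc a) (vc b) x' y) + nn a x' + nn g z' + m' := by
  have j := jump D (gd_sh ha hx) (gd_sh ha hx') (gd_sh hb hy) (gd_vm hg hz h) (gd_vm hg hz' h')
    (sh_pos (by linarith) (by linarith [hx.1, hx'.2.1])).ne'
  rw [cnt_dl ha hx hx' hlt, cnt_ph hg hz hz' hlt hx.1 hx'.2.1 h h'] at j
  linarith

lemma moveA (D : Dat P Q R (vc a) (vc b) (vm θ g)) (ha : In a) (hb : In b) (hg : In g)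
    {x x' y z z' : ℝ} {m m' : ℤ} (hx : Gd a x) (hx' : Gd a x') (hy : Gd b y) (hz : Gd g z) (hz' : Gd g z')
    (h : x + y + z = θ + 2 * π * m) (h' : x' + y + z' = θ + 2 * π * m') :
    Nidx (Xm P Q (vc a) (vc b) x y) + nn a x + nn g z + m
      = Nidx (Xm P Q (vc a) (vc b) x' y) + nn a x' + nn g z' + m' := by
  rcases lt_trichotomy x x' with hl | rfl | hl
  · exact moveA_lt D ha hb hg hx hx' hy hz hz' h h' hl
  · have hpi := Real.pi_pos
    obtain ⟨h1, h2, -, -⟩ := hz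
    obtain ⟨h1', h2', -, -⟩ := hz'
    have i1 : ((m' - m : ℤ) : ℝ) < 1 := by push_cast; nlinarith
    have i2 : (-1 : ℝ) < ((m' - m : ℤ) : ℝ) := by push_cast; nlinarith
    have i1' : m' - m < 1 := by exact_mod_cast i1
    have i2' : -1 < m' - m := by exact_mod_cast i2
    have : m' = m := by omega
    subst this
    have : z' = z := by linarith
    rw [this]
  · exact (moveA_lt D ha hb hg hx' hx hy hz' hz h' h hl).symm

lemma Dat_swap {α β μ : Fin 3 → ℝ} (D : Dat P Q R α β μ) : ∃ R', Dat Q P R' β α μ := by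
  have hA : memU21 (spe P α) := by
    unfold spe sp
    exact memU21_mul (memU21_mul D.hP (memU21_diag fun i => ex_star_mul _)) (memU21_inv' D.hP)
  refine ⟨(spe P α)⁻¹ * R, D.hQ, D.hP, memU21_mul (memU21_inv' hA) D.hR, ?_⟩
  have e0 : ∀ A : M3, memU21 A → spe (A⁻¹ * R) μ = A⁻¹ * spe R μ * A := by
    intro A hA
    unfold spe sp
    rw [Matrix.mul_inv_rev, nonsing_inv_nonsing_inv _ (memU21_isUnit hA)]
    simp only [Matrix.mul_assoc]
  have e := e0 _ hA
  rw [e, ← D.h, ← Matrix.mul_assoc, U_inv_mul hA, Matrix.one_mul]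

lemma moveB (D : Dat P Q R (vc a) (vc b) (vm θ g)) (ha : In a) (hb : In b) (hg : In g)
    {x y y' z z' : ℝ} {m m' : ℤ} (hx : Gd a x) (hy : Gd b y) (hy' : Gd b y') (hz : Gd g z) (hz' : Gd g z')
    (h : x + y + z = θ + 2 * π * m) (h' : x + y' + z' = θ + 2 * π * m') :
    Nidx (Xm P Q (vc a) (vc b) x y) + nn b y + nn g z + m
      = Nidx (Xm P Q (vc a) (vc b) x y') + nn b y' + nn g z' + m' := by
  obtain ⟨R', D'⟩ := Dat_swap D
  rw [Xm_symm, Xm_symm P Q (vc a) (vc b) x y']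
  exact moveA D' hb ha hg hy hy' hx hz hz' (by linarith) (by linarith)
end mv

lemma Gd_of_mod {g : Pt} {s : ℝ} (h0 : ∀ n : ℤ, s ≠ 2 * π * n) (h1 : ∀ n : ℤ, s ≠ 2 * π * n - g.1)
    (h2 : ∀ n : ℤ, s ≠ 2 * π * n - g.2) : ∃ (z : ℝ) (m : ℤ), Gd g z ∧ s + z = 2 * π * m := by
  have hpi := Real.pi_pos
  have f1 := Int.floor_le (s / (2 * π))
  have f2 := Int.lt_floor_add_one (s / (2 * π))
  rw [le_div_iff₀ (by positivity)] at f1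
  rw [div_lt_iff₀ (by positivity)] at f2
  refine ⟨2 * π * ((⌊s / (2 * π)⌋ + 1 : ℤ) : ℝ) - s, ⌊s / (2 * π)⌋ + 1, ⟨?_, ?_, ?_, ?_⟩, by ring⟩
  · push_cast; nlinarith
  · have := lt_of_le_of_ne f1 (by intro h; apply h0 ⌊s / (2 * π)⌋; linarith)
    push_cast; nlinarith
  · intro h; apply h1 (⌊s / (2 * π)⌋ + 1); linarith
  · intro h; apply h2 (⌊s / (2 * π)⌋ + 1); linarith

lemma exists_generic (p g : Pt) (t1 t2 : ℝ) : ∃ x, Gd p x ∧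
    (∃ (z : ℝ) (m : ℤ), Gd g z ∧ x + t1 + z = 2 * π * m) ∧
    (∃ (z : ℝ) (m : ℤ), Gd g z ∧ x + t2 + z = 2 * π * m) := by
  let f : ℝ → ℝ → ℤ → ℝ := fun t c n => 2 * π * n - c - t
  let bad : Set ℝ := {p.1, p.2} ∪ (((range (f t1 0)) ∪ (range (f t1 g.1)) ∪ (range (f t1 g.2))) ∪
    ((range (f t2 0)) ∪ (range (f t2 g.1)) ∪ (range (f t2 g.2))))
  have hbad : bad.Countable := by
    refine Set.Countable.union ((Set.toFinite _).countable) (Set.Countable.union ?_ ?_) <;>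
    exact ((countable_range _).union (countable_range _)).union (countable_range _)
  have hd : Dense badᶜ := hbad.dense_compl ℝ
  obtain ⟨x, hx, hx0, hx1⟩ := hd.exists_between (show (0 : ℝ) < 2 * π by positivity)
  have key : ∀ t c, (range (f t c) ⊆ bad) → ∀ n : ℤ, x + t ≠ 2 * π * n - c := by
    intro t c hs n h
    apply hx; apply hs
    exact ⟨n, by show 2 * π * n - c - t = x; linarith⟩
  have hne1 : x ≠ p.1 := by rintro rfl; apply hx; left; simp
  have hne2 : x ≠ p.2 := by rintro rfl; apply hx; left; simp
  have s1 : range (f t1 0) ⊆ bad := fun w hw => Or.inr (Or.inl (Or.inl (Or.inl hw)))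
  have s2 : range (f t1 g.1) ⊆ bad := fun w hw => Or.inr (Or.inl (Or.inl (Or.inr hw)))
  have s3 : range (f t1 g.2) ⊆ bad := fun w hw => Or.inr (Or.inl (Or.inr hw))
  have s4 : range (f t2 0) ⊆ bad := fun w hw => Or.inr (Or.inr (Or.inl (Or.inl hw)))
  have s5 : range (f t2 g.1) ⊆ bad := fun w hw => Or.inr (Or.inr (Or.inl (Or.inr hw)))
  have s6 : range (f t2 g.2) ⊆ bad := fun w hw => Or.inr (Or.inr (Or.inr hw))
  refine ⟨x, ⟨hx0, hx1, hne1, hne2⟩, Gd_of_mod ?_ (key _ _ s2) (key _ _ s3),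
    Gd_of_mod ?_ (key _ _ s5) (key _ _ s6)⟩
  · intro n; have := key _ _ s1 n; rwa [sub_zero] at this
  · intro n; have := key _ _ s4 n; rwa [sub_zero] at this

/-- sign -/
def SG (r : ℝ) (n : ℤ) : Prop := ∃ c : ℝ, 0 < c ∧ r = c * (-1) ^ n

lemma SG.mul {r s : ℝ} {n k : ℤ} (h : SG r n) (h' : SG s k) : SG (r * s) (n + k) := by
  obtain ⟨c, hc, rfl⟩ := h
  obtain ⟨d, hd, rfl⟩ := h'
  exact ⟨c * d, by positivity, by rw [zpow_add₀ (by norm_num)]; ring⟩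

lemma SG_pow (n : ℤ) : SG ((-1) ^ n) n := ⟨1, one_pos, by ring⟩

lemma SG.uniq {r : ℝ} {n k : ℤ} (h : SG r n) (h' : SG r k) : Even (n - k) := by
  obtain ⟨c, hc, rfl⟩ := h
  obtain ⟨d, hd, e⟩ := h'
  have key : c / d = (-1 : ℝ) ^ (k - n) := by
    rw [zpow_sub₀ (by norm_num)]
    have := pow_ne n
    field_simp; linarith
  rcases Int.even_or_odd (k - n) with hh | hh
  · rw [show n - k = -(k - n) by ring]; exact hh.neg
  · rw [hh.neg_one_zpow] at key
    have : 0 < c / d := by positivity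
    linarith

lemma SG_ite {r : ℝ} {q : Prop} [Decidable q] (h : r ≠ 0) (hq : 0 < r ↔ q) :
    SG r (1 + if q then 1 else 0) := by
  split_ifs with hh
  · exact ⟨r, hq.mpr hh, by norm_num⟩
  · refine ⟨-r, ?_, by norm_num⟩
    have : ¬ 0 < r := fun k => hh (hq.mp k)
    have := lt_of_le_of_ne (not_lt.mp this) h
    linarith

lemma SG_vc {p : Pt} (hp : In p) {x : ℝ} (hx : Gd p x) :
    SG (sh (vc p 0 - x) * sh (vc p 1 - x) * sh (vc p 2 - x)) (nn p x + 4) := by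
  have k := gd_sh hp hx
  obtain ⟨h1, h2, h3, h4⟩ := hx
  obtain ⟨p1, p2, p3, p4⟩ := hp
  have a0 : SG (sh (vc p 0 - x)) (1 + if x < p.1 then 1 else 0) := SG_ite (k 0) (by
    show 0 < sh (p.1 - x) ↔ _
    rw [sh_pos_iff (by linarith) (by linarith), sub_pos])
  have a1 : SG (sh (vc p 1 - x)) (1 + if x < p.2 then 1 else 0) := SG_ite (k 1) (by
    show 0 < sh (p.2 - x) ↔ _
    rw [sh_pos_iff (by linarith) (by linarith), sub_pos])
  have a2 : SG (sh (vc p 2 - x)) (1 + if False then 1 else 0) := SG_ite (k 2) (by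
    show 0 < sh (0 - x) ↔ _
    rw [sh_pos_iff (by linarith) (by linarith), sub_pos]; simp; linarith)
  have := (a0.mul a1).mul a2
  convert this using 1
  unfold nn; simp; ring

lemma nv_det {P : M3} (h : memU21 P) (α : Fin 3 → ℝ) (x : ℝ) : (nv P α x).det =
    (-2 * Complex.I) ^ 3 * ((sh (α 0 - x) * sh (α 1 - x) * sh (α 2 - x) : ℝ) : ℂ)
      * ex ((α 0 + α 1 + α 2 - 3 * x) / 2) := by
  unfold nv
  rw [sp_det h, one_sub_ex, one_sub_ex, one_sub_ex,
    show (α 0 + α 1 + α 2 - 3 * x) / 2 = (α 0 - x) / 2 + (α 1 - x) / 2 + (α 2 - x) / 2 by ring, ex_add, ex_add]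
  push_cast; ring

lemma ex_int (p : ℤ) : ex (π * p) = (((-1 : ℝ) ^ p : ℝ) : ℂ) := by
  unfold ex
  rw [show ((π * p : ℝ) : ℂ) * Complex.I = p * (π * Complex.I) by push_cast; ring, Complex.exp_int_mul,
    Complex.exp_pi_mul_I]
  push_cast; rfl

section mv
variable {P Q R : M3} {a b g : Pt} {θ : ℝ}

lemma parity (D : Dat P Q R (vc a) (vc b) (vm θ g)) (ha : In a) (hb : In b) (hg : In g)
    {x y z : ℝ} {m p : ℤ} (hx : Gd a x) (hy : Gd b y) (hz : Gd g z)
    (h : x + y + z = θ + 2 * π * m) (hS : a.1 + a.2 + b.1 + b.2 + g.1 + g.2 = 3 * θ + 2 * π * p) :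
    Even (Nidx (Xm P Q (vc a) (vc b) x y) - (p + m + nn a x + nn b y + nn g z)) := by
  have kx := gd_sh ha hx
  have ky := gd_sh hb hy
  have kz := gd_vm hg hz h
  obtain ⟨W, d, hW, hXW, hN⟩ := Nidx_spec
    (show (Xm P Q (vc a) (vc b) x y).IsHermitian from Xm_herm D.hP D.hQ ..)
  have hu := Xm_unit D kx ky kz
  have hdet : (Xm P Q (vc a) (vc b) x y).det = ((‖W.det‖ ^ 2 * (d 0 * d 1 * d 2) : ℝ) : ℂ) := by
    rw [hXW, det_mul, det_mul, det_conjTranspose]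
    unfold rd
    rw [det_diagonal, Fin.prod_univ_three]
    have : (‖W.det‖ : ℂ) ^ 2 = star W.det * W.det := by rw [Complex.star_def, Complex.conj_mul']
    push_cast
    rw [this]; ring
  rw [hN]
  have hw0 : 0 < ‖W.det‖ ^ 2 := by
    have := norm_pos_iff.mpr hW.ne_zero
    positivity
  have hd0 : d 0 * d 1 * d 2 ≠ 0 := by
    intro h0
    rw [hdet, h0] at hu
    simp at hu
  have hd2 : d 2 ≠ 0 := right_ne_zero_of_mul hd0
  have hd1 : d 1 ≠ 0 := right_ne_zero_of_mul (left_ne_zero_of_mul hd0)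
  have hd00 : d 0 ≠ 0 := left_ne_zero_of_mul (left_ne_zero_of_mul hd0)
  have s1 : SG (d 0 * d 1 * d 2) (cnt d + 3) := by
    have := ((SG_ite hd00 Iff.rfl).mul (SG_ite hd1 Iff.rfl)).mul (SG_ite hd2 Iff.rfl)
    convert this using 1
    rw [cnt3]; ring
  -- determinant identity
  have kd := congrArg Matrix.det (key_id D kx ky)
  have hXd : (Xm P Q (vc a) (vc b) x y).det = -(av P (vc a) x + av Q (vc b) y).det := by
    unfold Xm; rw [det_mul]; unfold J3; rw [det_diagonal, Fin.prod_univ_three]; simp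
  rw [det_mul, det_mul, det_smul, nv_det D.hP, nv_det D.hQ, nv_det D.hR] at kd
  set sA := sh (vc a 0 - x) * sh (vc a 1 - x) * sh (vc a 2 - x) with hsA
  set sB := sh (vc b 0 - y) * sh (vc b 1 - y) * sh (vc b 2 - y) with hsB
  set sC := sh (vc g 0 - z) * sh (vc g 1 - z) * sh (vc g 2 - z) with hsC
  have hM : sh (vm θ g 0 - (x + y)) * sh (vm θ g 1 - (x + y)) * sh (vm θ g 2 - (x + y))
      = - (-1) ^ m * sC := by
    rw [vm_sh θ g h, vm_sh θ g h, vm_sh θ g h, hsC]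
    have := pow_sq m
    linear_combination (-(-1 : ℝ) ^ m * (sh (vc g 0 - z) * sh (vc g 1 - z) * sh (vc g 2 - z))) * this
  rw [hM] at kd
  have hE : ex ((vc a 0 + vc a 1 + vc a 2 - 3 * x) / 2) * ex ((vc b 0 + vc b 1 + vc b 2 - 3 * y) / 2)
      = ex (π * p) * ex ((vm θ g 0 + vm θ g 1 + vm θ g 2 - 3 * (x + y)) / 2) := by
    rw [← ex_add, ← ex_add]; congr 1
    show (a.1 + a.2 + 0 - 3 * x) / 2 + (b.1 + b.2 + 0 - 3 * y) / 2
      = π * p + (θ - g.1 + (θ - g.2) + θ - 3 * (x + y)) / 2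
    linarith
  have hfin : ‖W.det‖ ^ 2 * (d 0 * d 1 * d 2) * sA * sB * (-1) ^ p = (-1) ^ (1 : ℤ) * (-1) ^ m * sC := by
    have hI : (Complex.I) ^ 2 = -1 := Complex.I_sq
    have e0 := ex_ne ((vm θ g 0 + vm θ g 1 + vm θ g 2 - 3 * (x + y)) / 2)
    have hc := hXd.symm.trans hdet
    set e1 := ex ((vm θ g 0 + vm θ g 1 + vm θ g 2 - 3 * (x + y)) / 2)
    set e2 := ex ((vc a 0 + vc a 1 + vc a 2 - 3 * x) / 2)
    set e3 := ex ((vc b 0 + vc b 1 + vc b 2 - 3 * y) / 2)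
    rw [ex_int] at hE
    set dt := (av P (vc a) x + av Q (vc b) y).det
    have hdt : dt = -((‖W.det‖ ^ 2 * (d 0 * d 1 * d 2) : ℝ) : ℂ) := by rw [← hc]; ring
    rw [hdt] at kd
    simp only [Fintype.card_fin] at kd
    have : (((‖W.det‖ ^ 2 * (d 0 * d 1 * d 2) * sA * sB * (-1) ^ p : ℝ)) : ℂ)
      = (((-1) ^ (1 : ℤ) * (-1) ^ m * sC : ℝ) : ℂ) := by
      apply mul_right_cancel₀ e0
      have h6 : Complex.I ^ 6 = -1 := by
        calc Complex.I ^ 6 = (Complex.I ^ 2) ^ 3 := by ring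
          _ = -1 := by rw [hI]; norm_num
      push_cast at kd hE ⊢
      simp only [zpow_one]
      generalize (‖W.det‖ : ℂ) ^ 2 * ((d 0 : ℂ) * d 1 * d 2) = T at *
      have kd' : -T * sA * sB * (e2 * e3) = (-1) ^ m * sC * e1 := by
        have h64 : (64 : ℂ) ≠ 0 := by norm_num
        apply mul_left_cancel₀ h64
        have l : (-2 * Complex.I) ^ 3 * (-2 * Complex.I) ^ 3 = -64 := by linear_combination 64 * h6
        have r : (2 * Complex.I) ^ 3 * (-2 * Complex.I) ^ 3 = 64 := by linear_combination -64 * h6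
        linear_combination -kd + (-T * sA * sB * (e2 * e3)) * l + ((-1) ^ m * sC * e1) * r
      rw [hE] at kd'
      linear_combination -kd'
    exact_mod_cast this
  have sa := SG_vc ha hx
  have sb := SG_vc hb hy
  have sc := SG_vc hg hz
  have sw : SG (‖W.det‖ ^ 2) 0 := ⟨_, hw0, by simp⟩
  have L := (((sw.mul s1).mul sa).mul sb).mul (SG_pow p)
  rw [← hsA, ← hsB, hfin] at L
  have Rr := ((SG_pow 1).mul (SG_pow m)).mul sc
  obtain ⟨r, hr⟩ := L.uniq Rr
  exact ⟨r - (3 + nn a x + nn b y + p), by linarith⟩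

lemma invar (D : Dat P Q R (vc a) (vc b) (vm θ g)) (ha : In a) (hb : In b) (hg : In g)
    {x y z x' y' z' : ℝ} {m m' : ℤ} (hx : Gd a x) (hy : Gd b y) (hz : Gd g z)
    (hx' : Gd a x') (hy' : Gd b y') (hz' : Gd g z')
    (h : x + y + z = θ + 2 * π * m) (h' : x' + y' + z' = θ + 2 * π * m') :
    Nidx (Xm P Q (vc a) (vc b) x y) + nn a x + nn b y + nn g z + m
    = Nidx (Xm P Q (vc a) (vc b) x' y') + nn a x' + nn b y' + nn g z' + m' := by
  obtain ⟨x0, hx0, ⟨z1, m1, hz1, e1⟩, ⟨z2, m2, hz2, e2⟩⟩ := exists_generic a g (y - θ) (y' - θ)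
  have i1 := moveA D ha hb hg hx hx0 hy hz hz1 h (show x0 + y + z1 = θ + 2 * π * m1 by linarith)
  have i2 := moveB D ha hb hg hx0 hy hy' hz1 hz2 (show x0 + y + z1 = θ + 2 * π * m1 by linarith)
    (show x0 + y' + z2 = θ + 2 * π * m2 by linarith)
  have i3 := moveA D ha hb hg hx0 hx' hy' hz2 hz' (show x0 + y' + z2 = θ + 2 * π * m2 by linarith) h'
  linarith

/-- the combinatorial conclusion -/
def Claim (a b g : Pt) (θ : ℝ) (p : ℤ) : Prop :=
  a.1 + a.2 + b.1 + b.2 + g.1 + g.2 = 3 * θ + 2 * π * p ∧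
  ∀ (x y z : ℝ) (m : ℤ), Gd a x → Gd b y → Gd g z → x + y + z = θ + 2 * π * m →
    0 ≤ p - m - nn a x - nn b y - nn g z ∧ p - m - nn a x - nn b y - nn g z ≤ 3

lemma claim_of_dat (D : Dat P Q R (vc a) (vc b) (vm θ g)) (ha : In a) (hb : In b) (hg : In g) {p : ℤ}
    (hS : a.1 + a.2 + b.1 + b.2 + g.1 + g.2 = 3 * θ + 2 * π * p) : ∃ θ p, Claim a b g θ p := by
  obtain ⟨y, hy, -, -⟩ := exists_generic b g 0 0
  obtain ⟨x, hx, ⟨z, m, hz, e⟩, -⟩ := exists_generic a g (y - θ) 0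
  have h : x + y + z = θ + 2 * π * m := by linarith
  obtain ⟨j, hj⟩ := parity D ha hb hg hx hy hz h hS
  set c := Nidx (Xm P Q (vc a) (vc b) x y) + nn a x + nn b y + nn g z + m with hc
  let q : ℤ := -j - (m + nn a x + nn b y + nn g z)
  have hq : p - c = 2 * q := by simp only [q]; linarith
  refine ⟨θ + 2 * π * q, p - 3 * q, by push_cast; linarith, ?_⟩
  intro x' y' z' m' hx' hy' hz' h'
  have i := invar D ha hb hg hx hy hz hx' hy' hz' h
    (show x' + y' + z' = θ + 2 * π * ((m' + q : ℤ) : ℝ) by push_cast; linarith)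
  have n1 := Nidx_nonneg (Xm P Q (vc a) (vc b) x' y')
  have n2 := Nidx_le (Xm P Q (vc a) (vc b) x' y')
  constructor <;> linarith
end mv

lemma E_spe (P : M3) (p : Pt) : P * Emat p.1 p.2 * P⁻¹ = spe P (vc p) := by
  unfold spe sp
  rw [Emat_ex]; congr 3; funext k
  fin_cases k
  · rfl
  · rfl
  · exact ex_zero.symm

lemma claim_of_Hs {a b g : Pt} (ha : In a) (hb : In b) (hg : In g) (h : Hs (a, b, g)) :
    ∃ θ p, Claim a b g θ p := by
  obtain ⟨A, B, C, hA, hB, hC, ⟨P, hP, eA⟩, ⟨Q, hQ, eB⟩, ⟨R, hR, eC⟩, lam, hl⟩ := h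
  change A = P * Emat a.1 a.2 * P⁻¹ at eA
  change B = Q * Emat b.1 b.2 * Q⁻¹ at eB
  change C = R * Emat g.1 g.2 * R⁻¹ at eC
  rw [E_spe] at eA eB eC
  have hU : memU21 (lam • (1 : M3)) := hl ▸ memU21_mul (memU21_mul hA hB) hC
  have hlam : star lam * lam = 1 := by
    have h1 : (lam • (1 : M3))ᴴ * J3 * (lam • (1 : M3)) = J3 := hU
    have h2 := congrFun (congrFun h1 0) 0
    simp [J3, Matrix.smul_apply] at h2
    simpa [mul_comm] using h2
  have hn : ‖lam‖ = 1 := by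
    rw [Complex.star_def, Complex.conj_mul'] at hlam
    have : ‖lam‖ ^ 2 = 1 := by exact_mod_cast hlam
    nlinarith [norm_nonneg lam]
  set θ := Complex.arg lam
  have hθ : lam = ex θ := by
    have := Complex.norm_mul_exp_arg_mul_I lam
    rw [hn] at this; simp at this; exact this.symm
  have hAB : A * B = spe R (vm θ g) := by
    have e1 : C * sp R (fun k => ex (-(vc g k))) = 1 := by
      rw [eC]; unfold spe; rw [sp_mul hR, ← sp_one hR]; congr 1; funext k
      rw [← ex_add]; simp [ex_zero]
    calc A * B = A * B * C * sp R (fun k => ex (-(vc g k))) := by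
          rw [Matrix.mul_assoc (A * B), e1, Matrix.mul_one]
      _ = lam • sp R (fun k => ex (-(vc g k))) := by rw [hl, Matrix.smul_mul, Matrix.one_mul]
      _ = _ := by
        unfold spe; rw [sp_smul, hθ]; congr 1; funext k
        rw [← ex_add]; congr 1
        fin_cases k
        · exact (sub_eq_add_neg _ _).symm
        · exact (sub_eq_add_neg _ _).symm
        · show θ + -0 = θ; simp
  have D : Dat P Q R (vc a) (vc b) (vm θ g) := ⟨hP, hQ, hR, by rw [← eA, ← eB, hAB]⟩
  have hdet : ex (a.1 + a.2 + b.1 + b.2 + g.1 + g.2) = ex (3 * θ) := by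
    have d := congrArg Matrix.det hAB
    rw [eA, eB, det_mul] at d
    unfold spe at d
    rw [sp_det hP, sp_det hQ, sp_det hR] at d
    simp only [← ex_add] at d
    change ex (a.1 + a.2 + 0 + (b.1 + b.2 + 0)) = ex (θ - g.1 + (θ - g.2) + θ) at d
    calc ex (a.1 + a.2 + b.1 + b.2 + g.1 + g.2)
        = ex (a.1 + a.2 + 0 + (b.1 + b.2 + 0)) * ex (g.1 + g.2) := by rw [← ex_add]; congr 1; ring
      _ = ex (3 * θ) := by rw [d, ← ex_add]; congr 1; ring
  unfold ex at hdet
  obtain ⟨p, hp⟩ := Complex.exp_eq_exp_iff_exists_int.mp hdet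
  refine claim_of_dat D ha hb hg (p := p) ?_
  have := congrArg Complex.im hp
  simp at this
  linarith

/-- a segment on which the count is constant -/
def Seg (p : Pt) (l u : ℝ) (n : ℤ) : Prop := l < u ∧ ∀ x, l < x → x < u → Gd p x ∧ nn p x = n

lemma seg_p {p : Pt} (h : memTo p) : Seg p 0 p.2 1 := by
  obtain ⟨h1, h2, h3⟩ := h
  refine ⟨h1, fun x hl hu => ⟨⟨hl, by linarith, by linarith |> ne_of_lt, ne_of_lt hu⟩, ?_⟩⟩
  unfold nn; rw [if_pos (by linarith), if_pos hu]; norm_num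

lemma seg_z {p : Pt} (h : memTo p) : Seg p p.2 p.1 0 := by
  obtain ⟨h1, h2, h3⟩ := h
  refine ⟨h2, fun x hl hu => ⟨⟨by linarith, by linarith, ne_of_lt hu, ne_of_gt hl⟩, ?_⟩⟩
  unfold nn; rw [if_pos hu, if_neg (by linarith)]; norm_num

lemma seg_n {p : Pt} (h : memTo p) : Seg p p.1 (2 * π) (-1) := by
  obtain ⟨h1, h2, h3⟩ := h
  refine ⟨h3, fun x hl hu => ⟨⟨by linarith, by linarith, ne_of_gt hl, ne_of_gt (by linarith)⟩, ?_⟩⟩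
  unfold nn; rw [if_neg (by linarith), if_neg (by linarith)]; norm_num

lemma box {a b g : Pt} {θ : ℝ} {p : ℤ} (hC : Claim a b g θ p) {l1 u1 l2 u2 l3 u3 : ℝ} {n1 n2 n3 : ℤ}
    (h1 : Seg a l1 u1 n1) (h2 : Seg b l2 u2 n2) (h3 : Seg g l3 u3 n3) (m : ℤ)
    (hb : p - m - n1 - n2 - n3 < 0 ∨ 3 < p - m - n1 - n2 - n3) :
    θ + 2 * π * m ≤ l1 + l2 + l3 ∨ u1 + u2 + u3 ≤ θ + 2 * π * m := by
  by_contra hc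
  push Not at hc
  obtain ⟨c1, c2⟩ := hc
  have i1 := h1.1
  have i2 := h2.1
  have i3 := h3.1
  set s := (θ + 2 * π * m - (l1 + l2 + l3)) / (u1 + u2 + u3 - (l1 + l2 + l3)) with hs
  have hD : 0 < u1 + u2 + u3 - (l1 + l2 + l3) := by linarith
  have s0 : 0 < s := div_pos (by linarith) hD
  have s1 : s < 1 := (div_lt_one hD).mpr (by linarith)
  have hse : s * (u1 + u2 + u3 - (l1 + l2 + l3)) = θ + 2 * π * m - (l1 + l2 + l3) :=
    div_mul_cancel₀ _ hD.ne'
  have q : ∀ l u : ℝ, l < u → l < l + s * (u - l) ∧ l + s * (u - l) < u := fun l u h => by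
    constructor <;> nlinarith
  obtain ⟨g1, k1⟩ := h1.2 _ (q l1 u1 i1).1 (q l1 u1 i1).2
  obtain ⟨g2, k2⟩ := h2.2 _ (q l2 u2 i2).1 (q l2 u2 i2).2
  obtain ⟨g3, k3⟩ := h3.2 _ (q l3 u3 i3).1 (q l3 u3 i3).2
  have := hC.2 _ _ _ m g1 g2 g3 (by linarith)
  rw [k1, k2, k3] at this
  omega

lemma nec2 {a b g : Pt} (ha : memTo a) (hb : memTo b) (hg : memTo g) {θ : ℝ} {p : ℤ}
    (hC : Claim a b g θ p) (hp : p ≤ 2) :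
    2 * (a.2 + b.2 + g.2) - (a.1 + b.1 + g.1) ≤ -(4 * π) ∨
    (a.1 + a.2 + b.1 + b.2 + g.1 + g.2 ≤ 4 * π ∧ 2 * (a.1 + b.2 + g.2) - (a.2 + b.1 + g.1) ≤ 2 * π ∧
     2 * (a.2 + b.1 + g.2) - (a.1 + b.2 + g.1) ≤ 2 * π ∧ 2 * (a.2 + b.2 + g.1) - (a.1 + b.1 + g.2) ≤ 2 * π ∧
     2 * π ≤ 2 * (a.1 + b.1 + g.1) - (a.2 + b.2 + g.2)) := by
  have hS := hC.1
  have hpi := Real.pi_pos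
  have ap := seg_p ha
  have az := seg_z ha
  have an := seg_n ha
  have bp := seg_p hb
  have bz := seg_z hb
  have bn := seg_n hb
  have gp := seg_p hg
  have gz := seg_z hg
  have gn := seg_n hg
  obtain ⟨a1, a2, a3⟩ := ha
  obtain ⟨b1, b2, b3⟩ := hb
  obtain ⟨g1, g2, g3⟩ := hg
  -- bounding four boxes at once
  have four : ∀ m : ℤ, p - m - 2 < 0 → 0 < θ + 2 * π * m → a.2 + b.2 + g.2 ≤ θ + 2 * π * m ∧
      a.1 + b.2 + g.2 ≤ θ + 2 * π * m ∧ a.2 + b.1 + g.2 ≤ θ + 2 * π * m ∧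
      a.2 + b.2 + g.1 ≤ θ + 2 * π * m := by
    intro m hm h0
    have e := (box hC ap bp gp m (by omega)).resolve_left (by linarith)
    exact ⟨e, (box hC az bp gp m (by omega)).resolve_left (by linarith),
      (box hC ap bz gp m (by omega)).resolve_left (by linarith),
      (box hC ap bp gz m (by omega)).resolve_left (by linarith)⟩
  rcases eq_or_lt_of_le hp with rfl | hp
  · push_cast at hS
    rcases box hC ap bp gp 0 (by omega) with h | h
    · push_cast at h
      right
      have f := four 1 (by norm_num) (by push_cast; linarith)
      have e := (box hC an bn gn 1 (by omega)).resolve_right (by push_cast; linarith)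
      push_cast at f e
      obtain ⟨f1, f2, f3, f4⟩ := f
      refine ⟨?_, ?_, ?_, ?_, ?_⟩ <;> linarith
    · left; push_cast at h; linarith
  · exfalso
    have hp1 : p ≤ 1 := by omega
    have hp1' : (p : ℝ) ≤ 1 := by exact_mod_cast hp1
    by_cases h0 : 0 < θ + 2 * π * ((p - 1 : ℤ) : ℝ)
    · obtain ⟨f1, f2, f3, f4⟩ := four (p - 1) (by omega) h0
      push_cast at f1 f2 f3 f4
      nlinarith
    · have hf1 := Int.lt_floor_add_one (-θ / (2 * π))
      have hf2 := Int.floor_le (-θ / (2 * π))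
      rw [div_lt_iff₀ (by positivity)] at hf1
      rw [le_div_iff₀ (by positivity)] at hf2
      set m := ⌊-θ / (2 * π)⌋ + 1 with hm
      have hmc : (m : ℝ) = (⌊-θ / (2 * π)⌋ : ℝ) + 1 := by rw [hm]; push_cast; ring
      have t1 : 0 < θ + 2 * π * m := by rw [hmc]; linarith
      have t2 : θ + 2 * π * m ≤ 2 * π := by rw [hmc]; linarith
      have hpm : p - 1 < m := by
        have : ((p - 1 : ℤ) : ℝ) < m := by nlinarith
        exact_mod_cast this
      obtain ⟨f1, f2, f3, f4⟩ := four m (by omega) t1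
      have := (box hC an bp gp m (by omega)).resolve_left (by linarith)
      linarith

lemma nec3 {a b g : Pt} (ha : memTo a) (hb : memTo b) (hg : memTo g) {θ : ℝ}
    (hC : Claim a b g θ 3) :
    2 * (a.2 + b.2 + g.2) - (a.1 + b.1 + g.1) ≤ 0 ∧
    6 * π ≤ 2 * (a.1 + b.1 + g.1) - (a.2 + b.2 + g.2) := by
  have hS := hC.1
  have ap := seg_p ha
  have an := seg_n ha
  have bp := seg_p hb
  have bn := seg_n hb
  have gp := seg_p hg
  have gn := seg_n hg
  obtain ⟨a1, a2, a3⟩ := ha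
  obtain ⟨b1, b2, b3⟩ := hb
  obtain ⟨g1, g2, g3⟩ := hg
  push_cast at hS
  have e1 := (box hC ap bp gp 1 (by omega)).resolve_left (by push_cast; linarith)
  have e2 := (box hC an bn gn 2 (by omega)).resolve_right (by push_cast; linarith)
  push_cast at e1 e2
  constructor <;> linarith

lemma cjp_memTo {p : Pt} (h : memTo p) : memTo (cjp p) := by
  obtain ⟨h1, h2, h3⟩ := h
  refine ⟨?_, ?_, ?_⟩ <;> simp only [cjp] <;> linarith

lemma Gd_cjp {p : Pt} {x : ℝ} (h : Gd (cjp p) x) : Gd p (2 * π - x) ∧ nn p (2 * π - x) = - nn (cjp p) x := by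
  obtain ⟨h1, h2, h3, h4⟩ := h
  simp only [cjp] at h3 h4
  refine ⟨⟨by linarith, by linarith, ?_, ?_⟩, ?_⟩
  · intro h; apply h4; linarith
  · intro h; apply h3; linarith
  · have key : ∀ c : ℝ, x ≠ 2 * π - c →
        (if 2 * π - x < c then (1 : ℤ) else 0) + (if x < 2 * π - c then (1 : ℤ) else 0) = 1 := by
      intro c hc
      rcases lt_or_gt_of_ne hc with k | k
      · rw [if_neg (by linarith), if_pos k]; norm_num
      · rw [if_pos (by linarith), if_neg (by linarith)]; norm_num
    have e1 := key p.1 h4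
    have e2 := key p.2 h3
    show (if 2 * π - x < p.1 then (1 : ℤ) else 0) + (if 2 * π - x < p.2 then (1 : ℤ) else 0) - 1 =
      -((if x < 2 * π - p.2 then (1 : ℤ) else 0) + (if x < 2 * π - p.1 then (1 : ℤ) else 0) - 1)
    linarith

lemma Claim_cj {a b g : Pt} {θ : ℝ} {p : ℤ} (hC : Claim a b g θ p) :
    Claim (cjp a) (cjp b) (cjp g) (-θ) (6 - p) := by
  refine ⟨?_, ?_⟩
  · have := hC.1; simp only [cjp]; push_cast; linarith
  · intro x y z m hx hy hz h
    obtain ⟨gx, kx⟩ := Gd_cjp hx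
    obtain ⟨gy, ky⟩ := Gd_cjp hy
    obtain ⟨gz, kz⟩ := Gd_cjp hz
    have := hC.2 _ _ _ (3 - m) gx gy gz (by push_cast; linarith)
    rw [kx, ky, kz] at this
    constructor <;> linarith [this.1, this.2]

lemma memTo_In {p : Pt} (h : memTo p) : In p := by
  obtain ⟨h1, h2, h3⟩ := h
  exact ⟨by linarith, h3, h1, by linarith⟩

lemma nec {τ : Tri} (ho : memTo3 τ) (h : Hs τ) : τ ∈ P4cl ∪ P6cl ∪ P8cl := by
  obtain ⟨a, b, g⟩ := τ
  obtain ⟨ha, hb, hg⟩ := ho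
  change memTo a at ha
  change memTo b at hb
  change memTo g at hg
  have hT : memT3 (a, b, g) := ⟨memTo_memT ha, memTo_memT hb, memTo_memT hg⟩
  obtain ⟨θ, p, hC⟩ := claim_of_Hs (memTo_In ha) (memTo_In hb) (memTo_In hg) h
  rcases lt_trichotomy p 3 with hp | rfl | hp
  · left; left
    refine ⟨hT, ?_⟩
    have := nec2 ha hb hg hC (by omega)
    simpa [Hf, sg, coord, Sf] using this
  · left; right
    refine ⟨hT, ?_⟩
    have := nec3 ha hb hg hC
    simpa [Hf, sg, coord, Sf] using this
  · right
    refine ⟨hT, ?_⟩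
    have := nec2 (cjp_memTo ha) (cjp_memTo hb) (cjp_memTo hg) (Claim_cj hC) (by omega)
    simp only [cjp] at this
    simp [Hf, sg, coord, Sf]
    rcases this with h | ⟨h1, h2, h3, h4, h5⟩
    · left; linarith
    · right; refine ⟨?_, ?_, ?_, ?_, ?_⟩ <;> linarith

/-- Explicit solution of the elliptic multiplicative Horn problem in PU(2,1). -/
theorem horn_PU21 :
    HornSol ∩ {τ : Tri | memTo3 τ} = (P4cl ∪ P6cl ∪ P8cl) ∩ {τ : Tri | memTo3 τ} := by
  ext τ
  constructor
  · rintro ⟨h, ho⟩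
    exact ⟨nec ho ((HornSol_iff τ).mp h).2, ho⟩
  · rintro ⟨h, ho⟩
    exact ⟨(HornSol_iff τ).mpr ⟨⟨memTo_memT ho.1, memTo_memT ho.2.1, memTo_memT ho.2.2⟩, suff ho h⟩, ho⟩
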